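/- arXiv:math/9502232 — 2 statements merged into one kernel-verified Lean document; each statement's English description precedes it below -/
import Mathlib

section
/- Let κ be a supercompact cardinal. Then the set B of cardinals δ < κ such that (for λ_δ the least singular strong limit cardinal above δ of cofinality δ) δ is λ_δ strongly compact, δ is not λ_δ supercompact, yet δ is α supercompact for all α < λ_δ, is unbounded in κ. -/
open Cardinal

/-- `P_κ(l) = { x ⊆ l : |x| < κ }` (for `l` an ordinal). -/
def Pk (κ : Cardinal.{0}) (l : Ordinal.{0}) : Type 1 :=
  {s : Set Ordinal.{0} // s ⊆ Set.Iio l ∧ Cardinal.mk ↥s < Cardinal.lift.{1} κ}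

/-- An ultrafilter is `κ`-complete (`κ`-additive): it is closed under
intersections of fewer than `κ` members. -/
def IsCompleteUF (κ : Cardinal.{0}) {α : Type u} (U : Ultrafilter α) : Prop :=
  ∀ (ι : Type) (f : ι → Set α), Cardinal.mk ι < κ → (∀ i, f i ∈ U) → (⋂ i, f i) ∈ U

/-- A fine ultrafilter on `P_κ(l)`. -/
def IsFineUF (κ : Cardinal.{0}) (l : Ordinal.{0}) (U : Ultrafilter (Pk κ l)) : Prop :=
  ∀ γ < l, {x : Pk κ l | γ ∈ x.1} ∈ U

/-- A normal ultrafilter on `P_κ(l)`: closed under diagonal intersections. -/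
def IsNormalUF (κ : Cardinal.{0}) (l : Ordinal.{0}) (U : Ultrafilter (Pk κ l)) : Prop :=
  ∀ f : Ordinal.{0} → Set (Pk κ l), (∀ γ < l, f γ ∈ U) →
    {x : Pk κ l | ∀ γ ∈ x.1, x ∈ f γ} ∈ U

/-- `κ` is `λ` strongly compact: there is a `κ`-complete fine ultrafilter on
`P_κ(λ)`. -/
def IsLamStronglyCompact (κ lam : Cardinal.{0}) : Prop :=
  ∃ U : Ultrafilter (Pk κ lam.ord), IsCompleteUF κ U ∧ IsFineUF κ lam.ord U

/-- `κ` is `λ` supercompact: there is a `κ`-complete normal fine ultrafilter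
on `P_κ(λ)`. -/
def IsLamSupercompact (κ lam : Cardinal.{0}) : Prop :=
  ∃ U : Ultrafilter (Pk κ lam.ord),
    IsCompleteUF κ U ∧ IsFineUF κ lam.ord U ∧ IsNormalUF κ lam.ord U

/-- The least singular strong limit cardinal greater than `δ` of cofinality `δ`. -/
noncomputable def leastLam (δ : Cardinal.{0}) : Cardinal.{0} :=
  sInf {μ : Cardinal.{0} | δ < μ ∧ μ.IsStrongLimit ∧ ¬ μ.IsRegular ∧ μ.ord.cof = δ}


/-! ## Normal ultrafilters on the power set of a type -/

section Magidor

open Filter Set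

universe v

/-- Initial segments of a well-order realise every smaller cardinal. -/
theorem exists_le_mk_Iio {α : Type v} [LinearOrder α] [WellFoundedLT α] {c : Cardinal.{v}}
    (h : c < Cardinal.mk α) : ∃ a : α, c ≤ Cardinal.mk (Iio a) := by
  have h1 : c.ord < Ordinal.type (α := α) (· < ·) := by
    have h2 : ¬ Ordinal.type (α := α) (· < ·) ≤ c.ord := by
      intro h3
      have := Ordinal.card_le_card h3
      rw [Ordinal.card_type, Cardinal.card_ord] at this
      exact absurd h this.not_gt
    exact not_le.mp h2
  obtain ⟨a, ha⟩ := Ordinal.typein_surj (α := α) (· < ·) h1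
  refine ⟨a, ?_⟩
  have := Ordinal.card_typein (r := ((· < ·) : α → α → Prop)) a
  rw [ha, Cardinal.card_ord] at this
  exact this.le

/-- `U` is (the image of) a `κ`-complete normal fine ultrafilter on `P_κ(S)`. -/
structure NF (κ : Cardinal.{0}) {S : Type v} (U : Ultrafilter (Set S)) : Prop where
  complete : IsCompleteUF κ U
  fine : ∀ s, ∀ᶠ x : Set S in (U : Filter (Set S)), s ∈ x
  small : ∀ᶠ x : Set S in (U : Filter (Set S)), Cardinal.mk ↥x < Cardinal.lift.{v} κ
  normal : ∀ P : S → Set S → Prop, (∀ s, ∀ᶠ x : Set S in (U : Filter (Set S)), P s x) →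
    ∀ᶠ x : Set S in (U : Filter (Set S)), ∀ s ∈ x, P s x

def SC (κ : Cardinal.{0}) (S : Type v) : Prop := ∃ U : Ultrafilter (Set S), NF κ U

theorem NF.map {κ : Cardinal.{0}} {S : Type v} {T : Type u} {U : Ultrafilter (Set T)}
    (hU : NF κ U) (f : S ↪ T) : NF κ (U.map (fun x => f ⁻¹' x)) where
  complete := by
    intro ι F hι hF
    have := hU.complete ι (fun i => (fun x => f ⁻¹' x) ⁻¹' F i) hι (fun i => hF i)
    rw [Ultrafilter.mem_map, preimage_iInter]
    exact this
  fine := fun s => hU.fine (f s)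
  small := by
    rw [Ultrafilter.coe_map, eventually_map]
    filter_upwards [hU.small] with x hx
    have h1 : Cardinal.lift.{v} (Cardinal.mk x) < Cardinal.lift.{v} (Cardinal.lift.{u} κ) :=
      Cardinal.lift_lt.2 hx
    have h2 : Cardinal.lift.{u} (Cardinal.mk ↥(f ⁻¹' x)) ≤ Cardinal.lift.{v} (Cardinal.mk x) :=
      Cardinal.mk_preimage_of_injective_lift _ _ f.injective
    have h3 := h2.trans_lt h1
    have h4 : Cardinal.lift.{v} (Cardinal.lift.{u} κ) = Cardinal.lift.{u} (Cardinal.lift.{v} κ) := by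
      rw [Cardinal.lift_lift, Cardinal.lift_lift]
    rw [h4] at h3
    exact Cardinal.lift_lt.1 h3
  normal := by
    intro P hP
    rw [Ultrafilter.coe_map, eventually_map]
    have := hU.normal (fun t x => ∀ s, f s = t → P s (f ⁻¹' x)) ?_
    · filter_upwards [this] with x hx s hs
      exact hx _ hs s rfl
    · intro t
      by_cases h : ∃ s, f s = t
      · obtain ⟨s, rfl⟩ := h
        have := hP s
        rw [Ultrafilter.coe_map, eventually_map] at this
        filter_upwards [this] with x hx s' hs'
        rw [f.injective hs']
        exact hx
      · exact Eventually.of_forall fun x s hs => (h ⟨s, hs⟩).elim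

theorem SC.of_embedding {κ : Cardinal.{0}} {S : Type v} {T : Type u} (h : SC κ T) (f : S ↪ T) :
    SC κ S := by
  obtain ⟨U, hU⟩ := h
  exact ⟨_, hU.map f⟩

theorem isLamSupercompact_iff {κ lam : Cardinal.{0}} :
    IsLamSupercompact κ lam ↔ SC κ (Iio lam.ord) := by
  constructor
  · rintro ⟨U, hc, hf, hn⟩
    refine ⟨U.map (fun x => Subtype.val ⁻¹' x.1), ?_, ?_, ?_, ?_⟩
    · intro ι F hι hF
      rw [Ultrafilter.mem_map, preimage_iInter]
      exact hc ι _ hι hF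
    · rintro ⟨s, hs⟩
      exact hf s hs
    · rw [Ultrafilter.coe_map, eventually_map]
      refine Eventually.of_forall fun x => ?_
      refine lt_of_le_of_lt ?_ x.2.2
      exact Cardinal.mk_preimage_of_injective _ _ Subtype.val_injective
    · intro P hP
      rw [Ultrafilter.coe_map, eventually_map]
      have := hn (fun γ => {x | ∀ h : γ < lam.ord, P ⟨γ, h⟩ (Subtype.val ⁻¹' x.1)}) ?_
      · filter_upwards [this] with x hx s hs
        exact hx s hs s.2
      · intro γ hγ
        have := hP ⟨γ, hγ⟩
        rw [Ultrafilter.coe_map, eventually_map] at this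
        filter_upwards [this] with x hx h
        exact hx
  · rintro ⟨U, hU⟩
    have hκ : (0 : Cardinal.{1}) < Cardinal.lift.{1} κ := by
      obtain ⟨x, hx⟩ := hU.small.exists
      exact (zero_le).trans_lt hx
    have hex : ∀ x : Set (Iio lam.ord), ∃ p : Pk κ lam.ord,
        Cardinal.mk x < Cardinal.lift.{1} κ → p.1 = Subtype.val '' x := by
      intro x
      by_cases h : Cardinal.mk x < Cardinal.lift.{1} κ
      · refine ⟨⟨Subtype.val '' x, ?_, Cardinal.mk_image_le.trans_lt h⟩, fun _ => rfl⟩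
        rintro _ ⟨y, -, rfl⟩
        exact y.2
      · exact ⟨⟨∅, empty_subset _, by simpa using hκ⟩, fun h' => (h h').elim⟩
    choose g hg using hex
    refine ⟨U.map g, ?_, ?_, ?_⟩
    · intro ι F hι hF
      rw [Ultrafilter.mem_map, preimage_iInter]
      exact hU.complete ι _ hι hF
    · intro γ hγ
      rw [Ultrafilter.mem_map]
      filter_upwards [hU.small, hU.fine ⟨γ, hγ⟩] with x hx hx2
      simp only [mem_preimage, mem_ofPred_eq, hg x hx]
      exact ⟨_, hx2, rfl⟩
    · intro F hF
      rw [Ultrafilter.mem_map]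
      have := hU.normal (fun γ x => g x ∈ F γ.1) (fun s => hF s.1 s.2)
      filter_upwards [hU.small, this] with x hx hx2
      simp only [mem_preimage, mem_ofPred_eq, hg x hx]
      rintro _ ⟨y, hy, rfl⟩
      exact hx2 y hy

theorem isLamSupercompact_of_le {κ lam : Cardinal.{0}} {T : Type} (h : SC κ T)
    (hT : lam ≤ Cardinal.mk T) : IsLamSupercompact κ lam := by
  rw [isLamSupercompact_iff]
  have : Nonempty (Iio lam.ord ↪ T) := by
    rw [← Cardinal.lift_mk_le']
    simpa using hT
  exact h.of_embedding this.some

theorem SC_of_isLamSupercompact {κ lam : Cardinal.{0}} {T : Type} (h : IsLamSupercompact κ lam)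
    (hT : Cardinal.mk T ≤ lam) : SC κ T := by
  rw [isLamSupercompact_iff] at h
  have : Nonempty (T ↪ Iio lam.ord) := by
    rw [← Cardinal.lift_mk_le']
    simpa using hT
  exact h.of_embedding this.some


/-! ## The basic calculus of normal ultrafilters -/

section Basic

variable {κ : Cardinal.{0}} {S : Type} {U : Ultrafilter (Set S)}

theorem NF.normal' (hU : NF κ U) {T : Type} (e : T ↪ S) (P : T → Set S → Prop)
    (h : ∀ t, ∀ᶠ x in (U : Filter (Set S)), P t x) :
    ∀ᶠ x in (U : Filter (Set S)), ∀ t, e t ∈ x → P t x := by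
  have := hU.normal (fun s x => ∀ t, e t = s → P t x) ?_
  · filter_upwards [this] with x hx t ht
    exact hx _ ht t rfl
  · intro s
    by_cases hs : ∃ t, e t = s
    · obtain ⟨t, rfl⟩ := hs
      filter_upwards [h t] with x hx t' ht'
      rw [e.injective ht']
      exact hx
    · exact Eventually.of_forall fun x t ht => (hs ⟨t, ht⟩).elim

theorem NF.closed (hU : NF κ U) {T T' : Type} (e : T ↪ S) (e' : T' ↪ S) (f : T → T') :
    ∀ᶠ x in (U : Filter (Set S)), ∀ t, e t ∈ x → e' (f t) ∈ x :=
  hU.normal' e (fun t x => e' (f t) ∈ x) (fun _ => hU.fine _)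

theorem NF.closed₂ (hU : NF κ U) {T T' T'' : Type} (e : T ↪ S) (e' : T' ↪ S) (e'' : T'' ↪ S)
    (f : T → T' → T'') :
    ∀ᶠ x in (U : Filter (Set S)), ∀ t, e t ∈ x → ∀ t', e' t' ∈ x → e'' (f t t') ∈ x :=
  hU.normal' e (fun t x => ∀ t', e' t' ∈ x → e'' (f t t') ∈ x) (fun t => hU.closed e' e'' (f t))

theorem NF.all (hU : NF κ U) {T : Type} (hT : Cardinal.mk T < κ) (P : T → Set S → Prop)
    (h : ∀ t, ∀ᶠ x in (U : Filter (Set S)), P t x) :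
    ∀ᶠ x in (U : Filter (Set S)), ∀ t, P t x := by
  have := hU.complete T (fun t => {x | P t x}) hT h
  filter_upwards [this] with x hx t
  exact mem_iInter.1 hx t

theorem NF.subset (hU : NF κ U) {T : Type} (e : T ↪ S) (a : Set T) (ha : Cardinal.mk a < κ) :
    ∀ᶠ x in (U : Filter (Set S)), ∀ t ∈ a, e t ∈ x := by
  filter_upwards [hU.all ha (fun t x => e t.1 ∈ x) (fun t => hU.fine _)] with x hx t ht
  exact hx ⟨t, ht⟩

theorem NF.small' (hU : NF κ U) : ∀ᶠ x : Set S in (U : Filter (Set S)), Cardinal.mk x < κ := by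
  filter_upwards [hU.small] with x hx
  simpa using hx

theorem NF.small_pre (hU : NF κ U) {T : Type} (e : T ↪ S) :
    ∀ᶠ x in (U : Filter (Set S)), Cardinal.mk ↥(e ⁻¹' x) < κ := by
  filter_upwards [hU.small'] with x hx
  exact (Cardinal.mk_preimage_of_injective _ _ e.injective).trans_lt hx

theorem NF.two_power_lt (hU : NF κ U) (hS : κ ≤ Cardinal.mk S) {μ : Cardinal.{0}} (hμ : μ < κ) :
    2 ^ μ < κ := by
  by_contra hcon
  rw [not_lt] at hcon
  obtain ⟨K, rfl⟩ : ∃ K : Type, Cardinal.mk K = κ := ⟨κ.out, Cardinal.mk_out κ⟩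
  obtain ⟨M, rfl⟩ : ∃ M : Type, Cardinal.mk M = μ := ⟨μ.out, Cardinal.mk_out μ⟩
  rw [← Cardinal.mk_set, Cardinal.le_def] at hcon
  rw [Cardinal.le_def] at hS
  obtain ⟨f⟩ := hcon
  obtain ⟨e⟩ := hS
  have h1 : ∀ x : Set S, ∃ k : K, Cardinal.mk ↥(e ⁻¹' x) < Cardinal.mk K → e k ∉ x := by
    intro x
    by_cases h : ∃ k, e k ∉ x
    · exact ⟨h.choose, fun _ => h.choose_spec⟩
    · push Not at h
      have h2 : e ⁻¹' x = Set.univ := eq_univ_of_forall h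
      obtain ⟨y, hy⟩ := hU.small'.exists
      have hne : Nonempty K := by
        rw [← Cardinal.mk_ne_zero_iff]
        exact (zero_le.trans_lt hy).ne'
      exact ⟨hne.some, fun h3 => by rw [h2, Cardinal.mk_univ] at h3; exact (lt_irrefl _ h3).elim⟩
  choose s hs using h1
  have h3 : ∀ᶠ x in (U : Filter (Set S)), ∀ m, (m ∈ f (s x) ↔
      ∀ᶠ x in (U : Filter (Set S)), m ∈ f (s x)) := by
    refine hU.all hμ _ fun m => ?_
    rcases U.em (fun x => m ∈ f (s x)) with h | h
    · filter_upwards [h] with x hx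
      simp [hx, h]
    · filter_upwards [h] with x hx
      have := Ultrafilter.eventually_not.1 h
      simp [hx, this]
  obtain ⟨x0, hx0⟩ := h3.exists
  have h4 : ∀ᶠ x in (U : Filter (Set S)), s x = s x0 := by
    filter_upwards [h3] with x hx
    apply f.injective
    ext m
    rw [hx m, hx0 m]
  obtain ⟨x, hx1, hx2, hx3⟩ := (h4.and ((hU.small_pre e).and (hU.fine (e (s x0))))).exists
  have := hs x hx2
  rw [hx1] at this
  exact this hx3

theorem mk_Iio_ord_lt (c : Cardinal.{0}) (i : c.ord.ToType) : Cardinal.mk (Iio i) < c := by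
  have := Cardinal.mk_Iio_lt i (by simp)
  simpa using this

theorem NF.regular (hU : NF κ U) (hS : κ ≤ Cardinal.mk S) (h0 : ℵ₀ ≤ κ) : κ.IsRegular := by
  refine ⟨h0, ?_⟩
  by_contra hcon
  rw [not_le, ← Ordinal.cof_toType] at hcon
  obtain ⟨C, hC, hCc⟩ := Order.exists_cof_eq κ.ord.ToType
  rw [← hCc] at hcon
  rw [← Cardinal.mk_ord_toType κ, Cardinal.le_def] at hS
  obtain ⟨e⟩ := hS
  have h1 := hU.subset e C hcon
  have h2 := hU.all hcon (fun c x => ∀ t ∈ Iio c.1, e t ∈ x)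
    (fun c => hU.subset e _ (mk_Iio_ord_lt _ _))
  obtain ⟨x, hx1, hx2, hx3⟩ := (h1.and (h2.and (hU.small_pre e))).exists
  have : e ⁻¹' x = Set.univ := by
    refine eq_univ_of_forall fun k => ?_
    obtain ⟨c, hc, hkc⟩ := hC k
    rcases hkc.lt_or_eq with h | rfl
    · exact hx2 ⟨c, hc⟩ k h
    · exact hx1 _ hc
  rw [this, Cardinal.mk_univ, Cardinal.mk_ord_toType] at hx3
  exact lt_irrefl _ hx3

theorem NF.mk_lt (hU : NF κ U) {K : Type} (hK : Cardinal.mk K = κ) (eK : K ↪ S) {Y : Type}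
    (hY : Cardinal.mk Y < κ) :
    ∀ᶠ x in (U : Filter (Set S)), Cardinal.mk Y < Cardinal.mk ↥(eK ⁻¹' x) := by
  have hS : κ ≤ Cardinal.mk S := hK ▸ Cardinal.mk_le_of_injective eK.injective
  have h1 := hU.two_power_lt hS hY
  have h2 : Nonempty (Set Y ↪ K) := by
    rw [← Cardinal.le_def, Cardinal.mk_set, hK]; exact h1.le
  obtain ⟨f⟩ := h2
  have h3 : Cardinal.mk (range f) = 2 ^ Cardinal.mk Y := by
    rw [Cardinal.mk_range_eq _ f.injective, Cardinal.mk_set]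
  filter_upwards [hU.subset eK (range f) (h3 ▸ h1)] with x hx
  calc Cardinal.mk Y < 2 ^ Cardinal.mk Y := Cardinal.cantor _
    _ = Cardinal.mk (range f) := h3.symm
    _ ≤ _ := Cardinal.mk_le_mk_of_subset hx

theorem NF.guess (hU : NF κ U) {T : Type} (e : T ↪ S) (b : Set S → Set T) :
    ∃ B : Set T, ∀ᶠ x in (U : Filter (Set S)), ∀ t, e t ∈ x → (t ∈ b x ↔ t ∈ B) := by
  refine ⟨{t | ∀ᶠ x in (U : Filter (Set S)), t ∈ b x}, ?_⟩
  refine hU.normal' e _ fun t => ?_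
  rcases U.em (fun x => t ∈ b x) with h | h
  · filter_upwards [h] with x hx
    simp [hx, h]
  · filter_upwards [h] with x hx
    have := Ultrafilter.eventually_not.1 h
    simp [hx, this]

theorem NF.surj (hU : NF κ U) {T : Type} (e : T ↪ S) (c : Set T ↪ S) :
    ∀ᶠ x in (U : Filter (Set S)), ∀ b : Set T, ∃ B : Set T, c B ∈ x ∧
      ∀ t, e t ∈ x → (t ∈ b ↔ t ∈ B) := by
  by_contra hcon
  rw [← Ultrafilter.eventually_not] at hcon
  have h1 : ∀ x : Set S, ∃ b : Set T, (¬ ∀ b : Set T, ∃ B : Set T, c B ∈ x ∧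
      ∀ t, e t ∈ x → (t ∈ b ↔ t ∈ B)) → ¬ ∃ B : Set T, c B ∈ x ∧
      ∀ t, e t ∈ x → (t ∈ b ↔ t ∈ B) := by
    intro x
    by_cases h : ∀ b : Set T, ∃ B : Set T, c B ∈ x ∧ ∀ t, e t ∈ x → (t ∈ b ↔ t ∈ B)
    · exact ⟨∅, fun h' => (h' h).elim⟩
    · obtain ⟨b, hb⟩ := not_forall.1 h
      exact ⟨b, fun _ => hb⟩
  choose b hb using h1
  obtain ⟨B, hB⟩ := hU.guess e b
  obtain ⟨x, hx1, hx2, hx3⟩ := (hcon.and (hB.and (hU.fine (c B)))).exists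
  exact hb x hx1 ⟨B, hx3, hx2⟩

theorem NF.small_coded (hU : NF κ U) {K : Type} (hK : Cardinal.mk K = κ) (eK : K ↪ S)
    {T : Type} (e : T ↪ S) {T' : Type} (c : T' ↪ S) (g : Set T → T') :
    ∀ᶠ x in (U : Filter (Set S)), ∀ a : Set T, (∀ t ∈ a, e t ∈ x) →
      Cardinal.mk a < Cardinal.mk ↥(eK ⁻¹' x) → c (g a) ∈ x := by
  by_contra hcon
  rw [← Ultrafilter.eventually_not] at hcon
  have h1 : ∀ x : Set S, ∃ a : Set T, (¬ ∀ a : Set T, (∀ t ∈ a, e t ∈ x) →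
      Cardinal.mk a < Cardinal.mk ↥(eK ⁻¹' x) → c (g a) ∈ x) → (∀ t ∈ a, e t ∈ x) ∧
      Cardinal.mk a < Cardinal.mk ↥(eK ⁻¹' x) ∧ c (g a) ∉ x := by
    intro x
    by_cases h : ∀ a : Set T, (∀ t ∈ a, e t ∈ x) →
      Cardinal.mk a < Cardinal.mk ↥(eK ⁻¹' x) → c (g a) ∈ x
    · exact ⟨∅, fun h' => (h' h).elim⟩
    · push Not at h
      obtain ⟨a, ha⟩ := h
      exact ⟨a, fun _ => ha⟩
  choose b hb using h1
  obtain ⟨B, hB⟩ := hU.guess e b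
  by_cases hBκ : Cardinal.mk B < κ
  · obtain ⟨x, hx1, hx2, hx3, hx4⟩ :=
      (hcon.and (hB.and ((hU.fine (c (g B))).and (hU.subset e B hBκ)))).exists
    obtain ⟨h2, -, h4⟩ := hb x hx1
    have : b x = B := by
      ext t
      constructor
      · intro ht
        exact (hx2 t (h2 t ht)).1 ht
      · intro ht
        exact (hx2 t (hx4 t ht)).2 ht
    rw [this] at h4
    exact h4 hx3
  · rw [not_lt, ← hK, Cardinal.le_def] at hBκ
    obtain ⟨f⟩ := hBκ
    obtain ⟨x, hx1, hx2, hx3⟩ := (hcon.and (hB.and (hU.closed eK e (fun k => (f k).1)))).exists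
    obtain ⟨h2, h3, -⟩ := hb x hx1
    refine absurd h3 (not_lt.2 ?_)
    refine Cardinal.mk_le_of_injective (f := fun k : ↥(eK ⁻¹' x) =>
      (⟨(f k.1).1, (hx2 _ (hx3 k.1 k.2)).2 (f k.1).2⟩ : b x)) ?_
    intro k k' hkk
    apply Subtype.ext
    apply f.injective
    apply Subtype.ext
    simpa using hkk

theorem NF.mk_power (hU : NF κ U) {T : Type} (e : T ↪ S) (c : Set T ↪ S) :
    ∀ᶠ x in (U : Filter (Set S)), 2 ^ Cardinal.mk ↥(e ⁻¹' x) ≤ Cardinal.mk ↥(x ∩ range c) := by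
  filter_upwards [hU.surj e c] with x hx
  have h1 : Cardinal.mk ↥(c ⁻¹' x) ≤ Cardinal.mk ↥(x ∩ range c) := by
    refine Cardinal.mk_le_of_injective (f := fun B : ↥(c ⁻¹' x) =>
      (⟨c B.1, B.2, B.1, rfl⟩ : ↥(x ∩ range c))) ?_
    intro B B' h
    apply Subtype.ext
    apply c.injective
    exact congrArg Subtype.val h
  refine le_trans ?_ h1
  rw [← Cardinal.mk_set]
  refine Cardinal.mk_le_of_surjective (f := fun B : ↥(c ⁻¹' x) =>
    (Subtype.val ⁻¹' B.1 : Set ↥(e ⁻¹' x))) ?_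
  intro b
  obtain ⟨B, hB1, hB2⟩ := hx (Subtype.val '' b)
  refine ⟨⟨B, hB1⟩, ?_⟩
  ext t
  have := hB2 t.1 t.2
  simp only [mem_preimage]
  rw [← this]
  exact ⟨fun ⟨y, hy, hyt⟩ => Subtype.ext hyt ▸ hy, fun h => ⟨t, h, rfl⟩⟩

end Basic


/-! ## Reflection of supercompactness -/

theorem NF.of_normal {K A : Type} [LinearOrder K] [WellFoundedLT K] (i : K ↪ A)
    (W : Ultrafilter (Set A))
    (fine : ∀ s, ∀ᶠ x in (W : Filter (Set A)), s ∈ x)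
    (small : ∀ᶠ x : Set A in (W : Filter (Set A)), Cardinal.mk ↥x < Cardinal.mk K)
    (normal : ∀ P : A → Set A → Prop, (∀ s, ∀ᶠ x in (W : Filter (Set A)), P s x) →
      ∀ᶠ x in (W : Filter (Set A)), ∀ s ∈ x, P s x)
    (hK : ∀ k : K, ∀ᶠ x in (W : Filter (Set A)), ∀ j < k, i j ∈ x) :
    NF (Cardinal.mk K) W where
  complete := by
    intro ι F hι hF
    obtain ⟨k, hk⟩ := exists_le_mk_Iio hι
    rw [Cardinal.le_def] at hk
    obtain ⟨f⟩ := hk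
    have h1 := normal (fun a y => ∀ j, i (f j).1 = a → y ∈ F j) ?_
    · filter_upwards [h1, hK k] with y hy1 hy2
      rw [mem_iInter]
      intro j
      exact hy1 _ (hy2 _ (f j).2) j rfl
    · intro a
      by_cases h : ∃ j, i (f j).1 = a
      · obtain ⟨j, rfl⟩ := h
        filter_upwards [hF j] with y hy j' hj'
        have : j' = j := f.injective (Subtype.ext (i.injective hj'))
        rw [this]
        exact hy
      · exact Eventually.of_forall fun y j hj => (h ⟨j, hj⟩).elim
  fine := fine
  small := by simpa using small
  normal := normal

theorem NF.reflect {κ : Cardinal.{0}} {S : Type} {U : Ultrafilter (Set S)} (hU : NF κ U)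
    {K A : Type} [LinearOrder K] [WellFoundedLT K] (hK : Cardinal.mk K = κ)
    (hKi : ∀ k : K, Cardinal.mk (Iio k) < κ) (eK : K ↪ S) (i : K ↪ A) (eA : A ↪ S)
    (cA : Set A ↪ S) (e2 : Set (Set A) ↪ S) (eP : A × Set A ↪ S) (eR : Set (A × Set A) ↪ S) :
    ∀ᶠ x in (U : Filter (Set S)), SC (Cardinal.mk ↥(eK ⁻¹' x)) ↥(eA ⁻¹' x) := by
  set V : Ultrafilter (Set A) := U.map (fun x => eA ⁻¹' x) with hVdef
  have hV : NF κ V := hU.map eA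
  have H1 := hU.surj cA e2
  have H2 := hU.small_coded hK eK eA cA id
  have H3 : ∀ᶠ x in (U : Filter (Set S)), ∀ X, e2 X ∈ x → X ∈ V → ∃ y ∈ X,
      (∀ a ∈ y, eA a ∈ x) ∧ Cardinal.mk y < Cardinal.mk ↥(eK ⁻¹' x) := by
    refine hU.normal' e2 _ fun X => ?_
    by_cases hX : X ∈ V
    · obtain ⟨y, hy1, hy2⟩ := ((show ∀ᶠ y in (V : Filter (Set A)), y ∈ X from hX).and
        hV.small').exists
      filter_upwards [hU.subset eA y hy2, hU.mk_lt hK eK hy2] with x h1 h2 _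
      exact ⟨y, hy1, h1, h2⟩
    · exact Eventually.of_forall fun x h => (hX h).elim
  have H4 := hU.closed₂ e2 e2 e2 (fun X Y => X ∩ Y)
  have H4' := hU.closed e2 e2 (fun X => Xᶜ)
  have H5 := hU.closed eA e2 (fun a => {y | a ∈ y})
  have H6 := hU.closed eK e2 (fun k => {y | ∀ j < k, i j ∈ y})
  have H6' := hU.closed eK eA i
  have H7 := hU.surj eP eR
  have H8 := hU.closed₂ eA cA eP (fun a y => (a, y))
  have H9 := hU.closed₂ eR eA e2 (fun R a => {y | (a, y) ∈ R})
  have H10 : ∀ᶠ x in (U : Filter (Set S)), ∀ R, eR R ∈ x →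
      (∀ a, eA a ∈ x → {y | (a, y) ∈ R} ∈ V) → ∀ a, {y | (a, y) ∈ R} ∈ V := by
    refine hU.normal' eR _ fun R => ?_
    by_cases hR : ∀ a, {y | (a, y) ∈ R} ∈ V
    · exact Eventually.of_forall fun x _ => hR
    · obtain ⟨a, ha⟩ := not_forall.1 hR
      filter_upwards [hU.fine (eA a)] with x hx h
      exact (ha (h a hx)).elim
  have H11 := hU.closed eR e2 (fun R => {y | ∀ a ∈ y, (a, y) ∈ R})
  have H12 := hU.fine (e2 Set.univ)
  filter_upwards [H1, H2, H3, H4, H4', H5, H6, H6', H7, H8, H9, H10, H11, H12] with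
    x h1 h2 h3 h4 h4' h5 h6 h6' h7 h8 h9 h10 h11 h12
  set Ax : Set A := eA ⁻¹' x with hAx
  set Kx : Set K := eK ⁻¹' x with hKx
  -- the trace filter
  let F : Filter (Set Ax) :=
    { sets := {b | ∃ X, e2 X ∈ x ∧ X ∈ V ∧ ∀ y ∈ X, (∀ a ∈ y, eA a ∈ x) →
        Cardinal.mk y < Cardinal.mk Kx → (Subtype.val ⁻¹' y : Set Ax) ∈ b}
      univ_sets := ⟨Set.univ, h12, Filter.univ_mem, fun _ _ _ _ => mem_univ _⟩
      sets_of_superset := by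
        rintro b b' ⟨X, hX1, hX2, hX3⟩ hb
        exact ⟨X, hX1, hX2, fun y hy ha hc => hb (hX3 y hy ha hc)⟩
      inter_sets := by
        rintro b b' ⟨X, hX1, hX2, hX3⟩ ⟨X', hX1', hX2', hX3'⟩
        exact ⟨X ∩ X', h4 X hX1 X' hX1', Filter.inter_mem hX2 hX2',
          fun y hy ha hc => ⟨hX3 y hy.1 ha hc, hX3' y hy.2 ha hc⟩⟩ }
  have memF : ∀ b, b ∈ F ↔ ∃ X, e2 X ∈ x ∧ X ∈ V ∧ ∀ y ∈ X, (∀ a ∈ y, eA a ∈ x) →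
        Cardinal.mk y < Cardinal.mk Kx → (Subtype.val ⁻¹' y : Set Ax) ∈ b := fun _ => Iff.rfl
  have hF : ∀ s, sᶜ ∉ F ↔ s ∈ F := by
    intro s
    constructor
    · intro hs
      obtain ⟨X, hX1, hX2⟩ := h1 {y | (Subtype.val ⁻¹' y : Set Ax) ∈ s}
      by_cases hXV : X ∈ V
      · exact ⟨X, hX1, hXV, fun y hy ha hc => (hX2 y (h2 y ha hc)).2 hy⟩
      · refine (hs ?_).elim
        exact ⟨Xᶜ, h4' X hX1, Ultrafilter.compl_mem_iff_notMem.2 hXV,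
          fun y hy ha hc hys => hy ((hX2 y (h2 y ha hc)).1 hys)⟩
    · rintro ⟨X, hX1, hX2, hX3⟩ ⟨X', hX1', hX2', hX3'⟩
      obtain ⟨y, hy, ha, hc⟩ := h3 (X ∩ X') (h4 X hX1 X' hX1') (Filter.inter_mem hX2 hX2')
      exact hX3' y hy.2 ha hc (hX3 y hy.1 ha hc)
  refine ⟨Ultrafilter.ofComplNotMemIff F hF, ?_⟩
  refine NF.of_normal (K := Kx) (A := Ax) ⟨fun k => ⟨i k.1, h6' k.1 k.2⟩, ?_⟩ _ ?_ ?_ ?_ ?_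
  · intro k k' hkk
    exact Subtype.ext (i.injective (congrArg Subtype.val hkk))
  · intro s
    refine (memF _).2 ⟨{y | s.1 ∈ y}, h5 s.1 s.2, hV.fine s.1, ?_⟩
    intro y hy _ _
    exact hy
  · refine (memF _).2 ⟨Set.univ, h12, Filter.univ_mem, ?_⟩
    intro y hy _ hc
    exact (Cardinal.mk_preimage_of_injective _ _ Subtype.val_injective).trans_lt hc
  · intro P hP
    obtain ⟨R, hR1, hR2⟩ := h7 {p | ∃ h : p.1 ∈ Ax, P ⟨p.1, h⟩ (Subtype.val ⁻¹' p.2)}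
    have hRV : ∀ a, {y | (a, y) ∈ R} ∈ V := by
      refine h10 R hR1 fun a ha => ?_
      by_contra hcon
      rw [← Ultrafilter.compl_mem_iff_notMem] at hcon
      obtain ⟨X, hX1, hX2, hX3⟩ := (memF _).1 (hP ⟨a, ha⟩)
      obtain ⟨y, hy, hya, hyc⟩ := h3 _ (h4 X hX1 _ (h4' _ (h9 R hR1 a ha)))
        (Filter.inter_mem hX2 hcon)
      have hPy := hX3 y hy.1 hya hyc
      exact hy.2 ((hR2 (a, y) (h8 a ha y (h2 y hya hyc))).1 ⟨ha, hPy⟩)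
    refine (memF _).2 ⟨{y | ∀ a ∈ y, (a, y) ∈ R}, h11 R hR1,
      hV.normal (fun a y => (a, y) ∈ R) hRV, ?_⟩
    intro y hy hya hyc s hs
    obtain ⟨_, h⟩ := (hR2 (s.1, y) (h8 s.1 s.2 y (h2 y hya hyc))).2 (hy s.1 hs)
    exact h
  · intro k
    refine (memF _).2 ⟨{y | ∀ j < k.1, i j ∈ y}, h6 k.1 k.2,
      hV.subset (i.trans (Function.Embedding.refl A)) (Iio k.1) (hKi k.1), ?_⟩
    intro y hy _ _ j hj
    exact hy j.1 hj


/-! ## Strong compactness at the limit -/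

theorem bdd_of_lt_cof {c δ : Cardinal.{0}} (hc : c.ord.cof = δ) (a : Set c.ord.ToType)
    (ha : Cardinal.mk a < δ) : ∃ l, ∀ s ∈ a, s < l := by
  by_contra hcon
  have h1 : IsCofinal a := by
    intro l
    by_contra h
    exact hcon ⟨l, fun s hs => not_le.1 fun hle => h ⟨s, hs, hle⟩⟩
  have h2 := Order.cof_le h1
  rw [Ordinal.cof_toType, hc] at h2
  exact absurd ha h2.not_gt

theorem exists_cofinal_fun {c δ : Cardinal.{0}} (hc : c.ord.cof = δ) :
    ∃ g : δ.ord.ToType → c.ord.ToType, ∀ s, ∃ k, s ≤ g k := by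
  obtain ⟨C, hC, hCc⟩ := Order.exists_cof_eq c.ord.ToType
  rw [Ordinal.cof_toType, hc, ← Cardinal.mk_ord_toType δ, Cardinal.eq] at hCc
  obtain ⟨f⟩ := hCc
  refine ⟨fun k => (f.symm k).1, fun s => ?_⟩
  obtain ⟨y, hy, hsy⟩ := hC s
  exact ⟨f ⟨y, hy⟩, by simpa using hsy⟩

theorem isLamStronglyCompact_of_set {κ lam : Cardinal.{0}} (hκ : 0 < κ)
    (W : Ultrafilter (Set lam.ord.ToType)) (hc : IsCompleteUF κ W)
    (hf : ∀ s, ∀ᶠ x in (W : Filter (Set lam.ord.ToType)), s ∈ x)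
    (hs : ∀ᶠ x : Set lam.ord.ToType in (W : Filter (Set lam.ord.ToType)), Cardinal.mk x < κ) :
    IsLamStronglyCompact κ lam := by
  have hex : ∀ x : Set lam.ord.ToType, ∃ p : Pk κ lam.ord,
      Cardinal.mk x < κ → p.1 = (fun s => (Ordinal.ToType.toOrd s).1) '' x := by
    intro x
    by_cases h : Cardinal.mk x < κ
    · refine ⟨⟨(fun s => (Ordinal.ToType.toOrd s).1) '' x, ?_, ?_⟩, fun _ => rfl⟩
      · rintro _ ⟨y, -, rfl⟩
        exact (Ordinal.ToType.toOrd y).2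
      · have h1 := Cardinal.mk_image_le_lift (f := fun s : lam.ord.ToType =>
          (Ordinal.ToType.toOrd s).1) (s := x)
        have h2 : Cardinal.lift.{1} (Cardinal.mk x) < Cardinal.lift.{1} κ := Cardinal.lift_lt.2 h
        have h3 := h1.trans_lt h2
        simpa using h3
    · refine ⟨⟨∅, empty_subset _, ?_⟩, fun h' => (h h').elim⟩
      simpa using hκ
  choose g hg using hex
  refine ⟨W.map g, ?_, ?_⟩
  · intro ι F hι hF
    rw [Ultrafilter.mem_map, preimage_iInter]
    exact hc ι _ hι hF
  · intro γ hγ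
    rw [Ultrafilter.mem_map]
    filter_upwards [hs, hf (Ordinal.ToType.mk ⟨γ, hγ⟩)] with x hx hx2
    simp only [mem_preimage, mem_ofPred_eq, hg x hx]
    exact ⟨_, hx2, by simp⟩

theorem stronglyCompact_of_good {δ lam : Cardinal.{0}} (hlt : δ < lam)
    (hcof : lam.ord.cof = δ) (hgood : ∀ α < lam, IsLamSupercompact δ α) :
    IsLamStronglyCompact δ lam := by
  obtain ⟨U, hU⟩ := SC_of_isLamSupercompact (T := δ.ord.ToType) (hgood δ hlt) (by simp)
  have hδ : 0 < δ := by
    obtain ⟨x, hx⟩ := hU.small'.exists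
    exact zero_le.trans_lt hx
  obtain ⟨g, hg⟩ := exists_cofinal_fun hcof
  have h1 : ∀ y : Set δ.ord.ToType, ∃ l : lam.ord.ToType, Cardinal.mk y < δ → ∀ k ∈ y, g k < l := by
    intro y
    by_cases h : Cardinal.mk y < δ
    · obtain ⟨l, hl⟩ := bdd_of_lt_cof hcof (g '' y) (Cardinal.mk_image_le.trans_lt h)
      exact ⟨l, fun _ k hk => hl _ ⟨k, hk, rfl⟩⟩
    · have : Nonempty lam.ord.ToType := by
        rw [← Cardinal.mk_ne_zero_iff, Cardinal.mk_ord_toType]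
        exact (hδ.trans hlt).ne'
      exact ⟨this.some, fun h' => (h h').elim⟩
  choose l hl using h1
  have h2 : ∀ s : lam.ord.ToType, SC δ (Iio s) := fun s =>
    SC_of_isLamSupercompact (hgood _ (mk_Iio_ord_lt lam s)) le_rfl
  choose Ul hUl using h2
  let W : Ultrafilter (Set lam.ord.ToType) :=
    U.bind (fun y => (Ul (l y)).map (fun z => Subtype.val '' z))
  have hW : ∀ s, s ∈ W ↔ ∀ᶠ y in (U : Filter (Set δ.ord.ToType)),
      ∀ᶠ z in (Ul (l y) : Filter (Set (Iio (l y)))), Subtype.val '' z ∈ s := by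
    intro s
    exact Filter.mem_bind'
  refine isLamStronglyCompact_of_set hδ W ?_ ?_ ?_
  · intro ι F hι hF
    rw [hW]
    have h3 := hU.all hι _ (fun i => (hW _).1 (hF i))
    filter_upwards [h3] with y hy
    have h4 := (hUl (l y)).all hι _ hy
    filter_upwards [h4] with z hz
    exact mem_iInter.2 hz
  · intro s
    refine (hW _).2 ?_
    obtain ⟨k, hk⟩ := hg s
    filter_upwards [hU.fine k, hU.small'] with y hy1 hy2
    have hs : s < l y := hk.trans_lt (hl y hy2 k hy1)
    filter_upwards [(hUl (l y)).fine ⟨s, hs⟩] with z hz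
    exact ⟨_, hz, rfl⟩
  · refine (hW _).2 ?_
    refine Eventually.of_forall fun y => ?_
    filter_upwards [(hUl (l y)).small'] with z hz
    exact Cardinal.mk_image_le.trans_lt hz

/-! ## Supercompact cardinals are regular and uncountable -/

theorem aleph0_lt_of_supercompact {κ : Cardinal.{0}}
    (hκ : ∀ lam : Cardinal.{0}, κ ≤ lam → IsLamSupercompact κ lam) : ℵ₀ < κ := by
  by_contra hcon
  rw [not_lt] at hcon
  obtain ⟨U, hU⟩ := SC_of_isLamSupercompact (T := ℕ) (hκ ℵ₀ hcon) (by simp)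
  have h1 := hU.closed (Function.Embedding.refl ℕ) (Function.Embedding.refl ℕ) Nat.succ
  obtain ⟨x, hx1, hx2, hx3⟩ := (h1.and ((hU.fine 0).and hU.small')).exists
  have : x = Set.univ := by
    refine eq_univ_of_forall fun n => ?_
    induction n with
    | zero => exact hx2
    | succ n ih => exact hx1 n ih
  rw [this, Cardinal.mk_univ, Cardinal.mk_nat] at hx3
  exact absurd hx3 hcon.not_gt

theorem exists_lam {κ : Cardinal.{0}} (h : κ.IsRegular) :
    ∃ μ : Cardinal.{0}, κ < μ ∧ μ.IsStrongLimit ∧ ¬ μ.IsRegular ∧ μ.ord.cof = κ := by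
  have hlim : Order.IsSuccLimit κ.ord := Cardinal.isSuccLimit_ord h.aleph0_le
  have hlim2 : Order.IsSuccLimit (κ.ord + κ.ord) := Ordinal.isSuccLimit_add _ hlim
  have hlt : κ < Cardinal.beth (κ.ord + κ.ord) := by
    refine (Cardinal.le_beth_ord κ).trans_lt ?_
    rw [Cardinal.beth_lt_beth]
    have : 0 < κ.ord := h.ord_pos
    simpa using this
  have hcof : (Cardinal.beth (κ.ord + κ.ord)).ord.cof = κ := by
    have h1 : Order.IsNormal (fun o : Ordinal.{0} => (Cardinal.beth o).ord) :=
      Cardinal.isNormal_ord.comp Cardinal.isNormal_beth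
    rw [Ordinal.cof_map_of_isNormal h1 hlim2,
      Ordinal.cof_map_of_isNormal (Ordinal.isNormal_add_right κ.ord) hlim, h.cof_ord]
  refine ⟨_, hlt, Cardinal.isStrongLimit_beth.2 hlim2.isSuccPrelimit, ?_, hcof⟩
  intro hr
  rw [hr.cof_ord] at hcof
  exact hlt.ne' hcof


/-! ## The reflection step -/

theorem cof_eq_of_family {μ δ : Cardinal.{0}} (hμ : μ.IsStrongLimit) {I : Type}
    (hI : Cardinal.mk I = δ) (f : I → Cardinal.{0}) (hf : ∀ i, f i < μ)
    (hcof : ∀ c < μ, ∃ i, c ≤ f i)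
    (hdir : ∀ a : Set I, Cardinal.mk a < δ → ∃ c < μ, ∀ i ∈ a, f i ≤ c) :
    μ.ord.cof = δ := by
  apply le_antisymm
  · by_contra hcon
    rw [not_le, ← hI] at hcon
    have h1 : ⨆ i, (f i).ord < μ.ord :=
      Ordinal.iSup_lt_of_lt_cof hcon (fun i => Cardinal.ord_lt_ord.2 (hf i))
    have h2 : (⨆ i, (f i).ord).card < μ := Cardinal.lt_ord.1 h1
    obtain ⟨i, hi⟩ := hcof _ (hμ.isStrongPrelimit h2)
    have h3 : f i ≤ (⨆ i, (f i).ord).card := by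
      have := Ordinal.card_le_card (Ordinal.le_iSup (fun i => (f i).ord) i)
      simpa using this
    exact absurd (Cardinal.cantor _) (hi.trans h3).not_gt
  · by_contra hcon
    rw [not_le] at hcon
    obtain ⟨C, hC, hCc⟩ := Order.exists_cof_eq μ.ord.ToType
    rw [Ordinal.cof_toType] at hCc
    choose F hF using fun y : μ.ord.ToType => hcof _ (mk_Iio_ord_lt μ y)
    obtain ⟨c, hc, hc2⟩ := hdir (F '' C) (Cardinal.mk_image_le.trans_lt (hCc ▸ hcon))
    have h1 : 2 ^ c < Cardinal.mk μ.ord.ToType := by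
      rw [Cardinal.mk_ord_toType]
      exact hμ.isStrongPrelimit hc
    obtain ⟨l, hl⟩ := exists_le_mk_Iio h1
    obtain ⟨y, hy, hly⟩ := hC l
    have h2 : 2 ^ c ≤ c :=
      hl.trans ((Cardinal.mk_le_mk_of_subset (Iio_subset_Iio hly)).trans
        ((hF y).trans (hc2 _ ⟨y, hy, rfl⟩)))
    exact absurd (Cardinal.cantor _) h2.not_gt

theorem exists_emb {A S : Type} {lam : Cardinal.{0}} (hS : Cardinal.mk S = lam)
    (h : Cardinal.mk A < lam) : Nonempty (A ↪ S) := by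
  rw [← Cardinal.le_def, hS]
  exact h.le

theorem step {κ lam β : Cardinal.{0}} (hlt : κ < lam) (hsl : lam.IsStrongLimit)
    (hinf : ℵ₀ ≤ lam)
    (hcof : lam.ord.cof = κ) (hsc : IsLamSupercompact κ lam) (hβ : β < κ) :
    ∃ δ, β < δ ∧ δ < κ ∧ ∃ μ : Cardinal.{0}, δ < μ ∧ μ.IsStrongLimit ∧ ¬ μ.IsRegular ∧
      μ.ord.cof = δ ∧ ∀ α < μ, IsLamSupercompact δ α := by
  obtain ⟨U, hU⟩ := SC_of_isLamSupercompact (T := lam.ord.ToType) hsc (by simp)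
  set S := lam.ord.ToType with hSdef
  have hS : Cardinal.mk S = lam := by simp [hSdef]
  set K := κ.ord.ToType with hKdef
  have hK : Cardinal.mk K = κ := by simp [hKdef]
  obtain ⟨s0, hs0⟩ : ∃ s0 : S, κ ≤ Cardinal.mk (Iio s0) := exists_le_mk_Iio (by rwa [hS])
  obtain ⟨eK0⟩ : Nonempty (K ↪ Iio s0) := by
    rw [← Cardinal.le_def, hK]
    exact hs0
  let eK : K ↪ S := eK0.trans (Function.Embedding.subtype _)
  have heK : ∀ k, eK k < s0 := fun k => (eK0 k).2
  obtain ⟨g, hg⟩ := exists_cofinal_fun hcof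
  choose h hh using hg
  have hσ : ∀ a : Set K, ∃ l : S, Cardinal.mk a < κ → ∀ k ∈ a, g k < l := by
    intro a
    by_cases ha : Cardinal.mk a < κ
    · obtain ⟨l, hl⟩ := bdd_of_lt_cof hcof (g '' a) (Cardinal.mk_image_le.trans_lt ha)
      exact ⟨l, fun _ k hk => hl _ ⟨k, hk, rfl⟩⟩
    · exact ⟨s0, fun h' => (ha h').elim⟩
  choose σ hσ using hσ
  have hI : ∀ s : S, Cardinal.mk (Iio s) < lam := mk_Iio_ord_lt lam
  have hp : ∀ s : S, ∃ t : S, Nonempty (Set (Iio s) ↪ Iio t) := by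
    intro s
    obtain ⟨t, ht⟩ : ∃ t : S, Cardinal.mk (Set (Iio s)) ≤ Cardinal.mk (Iio t) := by
      refine exists_le_mk_Iio ?_
      rw [hS, Cardinal.mk_set]
      exact hsl.isStrongPrelimit (hI s)
    exact ⟨t, (Cardinal.le_def _ _).1 ht⟩
  choose p c using hp
  let c' : ∀ s, Set (Iio s) ↪ S := fun s => (c s).some.trans (Function.Embedding.subtype _)
  have hc' : ∀ s, range (c' s) ⊆ Iio (p s) := by
    rintro s _ ⟨b, rfl⟩
    exact ((c s).some b).2
  have G1 := hU.closed (Function.Embedding.refl S) (Function.Embedding.refl S) p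
  have G2 := hU.normal' (Function.Embedding.refl S) _
    (fun s => hU.mk_power (Function.Embedding.subtype (· ∈ Iio s)) (c' s))
  have G3 := hU.normal' (Function.Embedding.refl S)
    (fun s x => SC (Cardinal.mk ↥(eK ⁻¹' x))
      ↥((Function.Embedding.subtype (· ∈ Iio (max s s0))) ⁻¹' x)) (by
    intro s
    have hA := hI (max s s0)
    have hA1 : Cardinal.mk (Set (Iio (max s s0))) < lam := by
      rw [Cardinal.mk_set]
      exact hsl.isStrongPrelimit hA
    have hA2 : Cardinal.mk (Set (Set (Iio (max s s0)))) < lam := by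
      rw [Cardinal.mk_set]
      exact hsl.isStrongPrelimit hA1
    have hA3 : Cardinal.mk (Iio (max s s0) × Set (Iio (max s s0))) < lam := by
      rw [Cardinal.mk_prod, Cardinal.lift_id, Cardinal.lift_id]
      exact Cardinal.mul_lt_of_lt hinf hA hA1
    have hA4 : Cardinal.mk (Set (Iio (max s s0) × Set (Iio (max s s0)))) < lam := by
      rw [Cardinal.mk_set]
      exact hsl.isStrongPrelimit hA3
    obtain ⟨cA⟩ := exists_emb hS hA1
    obtain ⟨e2⟩ := exists_emb hS hA2
    obtain ⟨eP⟩ := exists_emb hS hA3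
    obtain ⟨eR⟩ := exists_emb hS hA4
    let i : K ↪ Iio (max s s0) :=
      ⟨fun k => ⟨eK k, (heK k).trans_le (le_max_right _ _)⟩, fun a b hab => by
        apply eK.injective
        exact (Subtype.mk.injEq _ _ _ _).mp hab⟩
    exact hU.reflect hK (mk_Iio_ord_lt κ) eK i _ cA e2 eP eR)
  have G4 := hU.closed (Function.Embedding.refl S) eK h
  have G4' := hU.closed eK (Function.Embedding.refl S) g
  have G5 := hU.small_coded hK eK eK (Function.Embedding.refl S) σ
  have G6 := hU.mk_lt hK eK (Y := β.out) (by simpa using hβ)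
  obtain ⟨x, g1, g2, g3, g4, g4', g5, g6, g7, g8⟩ :=
    (G1.and (G2.and (G3.and (G4.and (G4'.and (G5.and (G6.and
      ((hU.small_pre eK).and (hU.fine s0))))))))).exists
  rw [Cardinal.mk_out] at g6
  simp only [Function.Embedding.refl_apply] at g1 g2 g3 g4 g4' g5
  let n : S → Cardinal.{0} := fun s => Cardinal.mk ↥(x ∩ Iio s)
  have hn : ∀ s, Cardinal.mk ↥((Function.Embedding.subtype (· ∈ Iio s)) ⁻¹' x) = n s := by
    intro s
    refine Cardinal.mk_congr ⟨fun y => ⟨y.1.1, y.2, y.1.2⟩, fun y => ⟨⟨y.1, y.2.2⟩, y.2.1⟩,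
      fun y => rfl, fun y => rfl⟩
  have hmono : ∀ s t, s ≤ t → n s ≤ n t := fun s t hst =>
    Cardinal.mk_le_mk_of_subset (inter_subset_inter_right _ (Iio_subset_Iio hst))
  have hpow : ∀ s ∈ x, 2 ^ n s ≤ n (p s) := by
    intro s hs
    have := g2 s hs
    rw [hn] at this
    exact this.trans (Cardinal.mk_le_mk_of_subset (inter_subset_inter_right _ (hc' s)))
  have hnle : ∀ s, n s ≤ Cardinal.mk x := fun s => Cardinal.mk_le_mk_of_subset inter_subset_left
  have hpow2 : ∀ s ∈ x, 2 ^ n s < Cardinal.mk x := fun s hs =>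
    (hpow s hs).trans_lt ((Cardinal.cantor _).trans_le ((hpow _ (g1 s hs)).trans (hnle _)))
  have hnlt : ∀ s ∈ x, n s < Cardinal.mk x := fun s hs => (Cardinal.cantor _).trans (hpow2 s hs)
  have hcf : ∀ c < Cardinal.mk x, ∃ s ∈ x, c ≤ n s := by
    intro c hc
    obtain ⟨a, ha⟩ := exists_le_mk_Iio hc
    refine ⟨a.1, a.2, ha.trans ?_⟩
    exact Cardinal.mk_le_of_injective (f := fun y : Iio a => (⟨y.1.1, y.1.2, y.2⟩ : ↥(x ∩ Iio a.1)))
      (fun y z hyz => Subtype.ext (Subtype.ext ((Subtype.mk.injEq _ _ _ _).mp hyz)))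
  have hsl' : (Cardinal.mk x).IsStrongLimit := by
    refine ⟨?_, ?_⟩
    · exact ((zero_le).trans_lt (hnlt _ g8)).ne'
    · intro c hc
      obtain ⟨s, hs, hcs⟩ := hcf c hc
      exact (Cardinal.power_le_power_left two_ne_zero hcs).trans_lt (hpow2 s hs)
  have hδ : Cardinal.mk ↥(eK ⁻¹' x) < Cardinal.mk x := by
    refine lt_of_le_of_lt ?_ (hnlt _ g8)
    exact Cardinal.mk_le_of_injective
      (f := fun k : ↥(eK ⁻¹' x) => (⟨eK k.1, k.2, heK k.1⟩ : ↥(x ∩ Iio s0)))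
      (fun y z hyz => Subtype.ext (eK.injective ((Subtype.mk.injEq _ _ _ _).mp hyz)))
  have hcof' : (Cardinal.mk x).ord.cof = Cardinal.mk ↥(eK ⁻¹' x) := by
    refine cof_eq_of_family hsl' rfl (fun k => n (g k.1)) ?_ ?_ ?_
    · intro k
      exact hnlt _ (g4' _ k.2)
    · intro c hc
      obtain ⟨s, hs, hcs⟩ := hcf c hc
      exact ⟨⟨h s, g4 s hs⟩, hcs.trans (hmono _ _ (hh s))⟩
    · intro a ha
      have ha' : Cardinal.mk ↥(Subtype.val '' a) < Cardinal.mk ↥(eK ⁻¹' x) :=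
        Cardinal.mk_image_le.trans_lt ha
      have ht := g5 (Subtype.val '' a) (by rintro _ ⟨k, -, rfl⟩; exact k.2) ha'
      refine ⟨_, hnlt _ ht, fun i hi => hmono _ _ ?_⟩
      exact (hσ _ (ha'.trans g7) _ ⟨i, hi, rfl⟩).le
  refine ⟨_, g6, g7, _, hδ, hsl', ?_, hcof', ?_⟩
  · intro hr
    rw [hr.cof_ord] at hcof'
    exact hδ.ne' hcof'
  · intro α hα
    obtain ⟨s, hs, hαs⟩ := hcf α hα
    refine isLamSupercompact_of_le (g3 s hs) ?_
    rw [hn]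
    exact hαs.trans (hmono _ _ (le_max_left _ _))

end Magidor

/-- (Magidor) If `κ` is supercompact, then the set of `δ < κ` such that, for
`λ_δ` the least singular strong limit cardinal above `δ` of cofinality `δ`,
`δ` is `λ_δ` strongly compact, `δ` is not `λ_δ` supercompact, yet `δ` is `α`
supercompact for all `α < λ_δ`, is unbounded in `κ`. -/
theorem magidor_unbounded_bad_instances (κ : Cardinal.{0})
    (hκ : ∀ lam : Cardinal.{0}, κ ≤ lam → IsLamSupercompact κ lam) :
    ∀ β < κ, ∃ δ : Cardinal.{0}, β < δ ∧ δ < κ ∧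
      IsLamStronglyCompact δ (leastLam δ) ∧
      ¬ IsLamSupercompact δ (leastLam δ) ∧
      ∀ α : Cardinal.{0}, α < leastLam δ → IsLamSupercompact δ α := by
  intro β hβ
  have h0 := aleph0_lt_of_supercompact hκ
  have hmem : ∀ c : Cardinal.{0}, (∃ μ : Cardinal.{0}, c < μ ∧ μ.IsStrongLimit ∧ ¬ μ.IsRegular ∧
      μ.ord.cof = c) → c < leastLam c ∧ (leastLam c).IsStrongLimit ∧ ¬ (leastLam c).IsRegular ∧
      (leastLam c).ord.cof = c := fun c hc => csInf_mem (s := {μ : Cardinal.{0} | c < μ ∧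
        μ.IsStrongLimit ∧ ¬ μ.IsRegular ∧ μ.ord.cof = c}) hc
  let P : Set Cardinal.{0} := {c | max β ℵ₀ < c ∧ (∃ μ : Cardinal.{0}, c < μ ∧ μ.IsStrongLimit ∧
    ¬ μ.IsRegular ∧ μ.ord.cof = c) ∧ IsLamSupercompact c (leastLam c)}
  have hPκ : κ ∈ P := by
    have hreg : κ.IsRegular := by
      obtain ⟨U, hU⟩ := SC_of_isLamSupercompact (T := κ.ord.ToType) (hκ κ le_rfl) (by simp)
      exact hU.regular (by simp) h0.le
    exact ⟨max_lt hβ h0, exists_lam hreg, hκ _ (hmem κ (exists_lam hreg)).1.le⟩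
  obtain ⟨κ', hP', hmin⟩ := WellFounded.has_min Cardinal.lt_wf P ⟨κ, hPκ⟩
  have hle : κ' ≤ κ := not_lt.1 (hmin κ hPκ)
  obtain ⟨hβ', hex', hsc'⟩ := hP'
  obtain ⟨m1, m2, m3, m4⟩ := hmem κ' hex'
  obtain ⟨δ, hδ1, hδ2, μ, n1, n2, n3, n4, n5⟩ :=
    step m1 m2 (((le_max_right β ℵ₀).trans_lt hβ').trans m1).le m4 hsc' hβ'
  have hexδ : ∃ μ : Cardinal.{0}, δ < μ ∧ μ.IsStrongLimit ∧ ¬ μ.IsRegular ∧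
      μ.ord.cof = δ := ⟨μ, n1, n2, n3, n4⟩
  obtain ⟨l1, l2, l3, l4⟩ := hmem δ hexδ
  have hlμ : leastLam δ ≤ μ := csInf_le' ⟨n1, n2, n3, n4⟩
  have hgood : ∀ α : Cardinal.{0}, α < leastLam δ → IsLamSupercompact δ α :=
    fun α hα => n5 α (hα.trans_le hlμ)
  exact ⟨δ, (le_max_left _ _).trans_lt hδ1, hδ2.trans_le hle,
    stronglyCompact_of_good l1 l4 hgood, fun hs => hmin δ ⟨hδ1, hexδ, hs⟩ hδ2, hgood⟩
end

section
/- Assume GCH. Let δ < λ be regular cardinals, λ ≥ ℵ₁. The three-step forcing P⁰_{δ,λ} * (P¹_{δ,λ}[Ṡ] × P²_{δ,λ}[Ṡ]) — first adding a non-reflecting stationary set S ⊆ λ⁺ of δ-cofinal ordinals, then simultaneously forcing with the ultrafilter-destroying poset P¹ and the club-shooting poset P² killing the stationarity of S — is forcing equivalent to Q⁰_λ * Q̇¹_λ, the addition of a Cohen subset of λ⁺ followed by the addition of λ⁺ many Cohen subsets of λ. -/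
open Cardinal

def IsClubIn (C : Set Ordinal) (α : Ordinal) : Prop :=
  (∀ β < α, ∃ γ ∈ C, β < γ ∧ γ < α) ∧
  (∀ β < α, 0 < β → (∀ γ < β, ∃ ξ ∈ C, γ < ξ ∧ ξ < β) → β ∈ C)

def StationaryIn (S : Set Ordinal) (α : Ordinal) : Prop :=
  ∀ C : Set Ordinal, IsClubIn C α → (S ∩ C).Nonempty

/-- GCH. -/
def GCHolds : Prop := ∀ c : Cardinal.{0}, ℵ₀ ≤ c → 2 ^ c = Order.succ c

/-- The forcing `P⁰_{δ,λ}` adding a non-reflecting stationary subset of `λ⁺`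
of `δ`-cofinal ordinals. -/
structure P0 (δc lam : Cardinal.{0}) : Type 1 where
  dom : Ordinal.{0}
  s : Set Ordinal.{0}
  dom_lt : dom < (Order.succ lam).ord
  s_sub : s ⊆ Set.Iio dom
  s_cof : ∀ β ∈ s, β.cof = δc ∧ δc.ord < β
  s_nonstat : ¬ StationaryIn s (sSup s)
  s_nonstat_init : ∀ γ : Ordinal, ¬ StationaryIn (s ∩ Set.Iio γ) (sSup (s ∩ Set.Iio γ))

/-- End-extension ordering on `P⁰`. -/
def P0.le {δc lam : Cardinal.{0}} (p q : P0 δc lam) : Prop :=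
  p.dom ≤ q.dom ∧ p.s ⊆ q.s ∧ q.s ∩ Set.Iio p.dom = p.s

/-- A condition of the club-shooting forcing `P²_{δ,λ}[S]`: the
characteristic function of a closed bounded `c ⊆ α` club in a successor
ordinal `α < λ⁺` (the disjointness from `S` is imposed at the level of the
iteration, where `S` is decided). -/
structure P2 (lam : Cardinal.{0}) : Type 1 where
  dom : Ordinal.{0}
  c : Set Ordinal.{0}
  dom_lt : dom < (Order.succ lam).ord
  dom_succ : ∃ γ : Ordinal.{0}, dom = γ + 1
  c_sub : c ⊆ Set.Iio dom
  c_closed : ∀ β < dom, 0 < β → (∀ γ < β, ∃ ξ ∈ c, γ < ξ ∧ ξ < β) → β ∈ c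
  c_unbdd : ∀ β < dom, ∃ ξ ∈ c, β ≤ ξ

/-- A condition of the three-step iteration
`P⁰_{δ,λ} * (P¹_{δ,λ}[Ṡ] × P²_{δ,λ}[Ṡ])`, presented concretely: a `P⁰`
condition `p` deciding an initial segment of the generic set `Ṡ`, a
(syntactic) `P¹` condition `⟨w, a, r, Z⟩` whose `Z`-sets are values of the
name `xseq` for the `♣(Ṡ)`-sequence at ordinals already decided to be in `Ṡ`,
and a `P²` condition whose club is decided and avoids the decided part of
`Ṡ`. -/
structure Trip (δc lam : Cardinal.{0})
    (xseq : Set Ordinal.{0} → Ordinal.{0} → Set Ordinal.{0}) : Type 1 where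
  p : P0 δc lam
  w : Set Ordinal.{0}
  a : Ordinal.{0}
  r : Ordinal.{0} → Ordinal.{0} → Bool
  Z : Set (Set Ordinal.{0})
  q2 : P2 lam
  w_sub : w ⊆ Set.Iio (Order.succ lam).ord
  w_small : Cardinal.mk ↥w < Cardinal.lift.{1} lam
  a_lt : a < lam.ord
  Z_mem : ∀ z ∈ Z, ∃ β ∈ p.s, z = xseq p.s β ∧ ∃ y : Set Ordinal.{0},
    y ⊆ z ∧ y ⊆ w ∧ Cardinal.mk ↥y = Cardinal.lift.{1} δc ∧
    ∃ b < β, ∀ ξ ∈ z \ y, ξ < b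
  q2_avoids : q2.c ∩ p.s = ∅
  q2_dom : q2.dom ≤ p.dom

/-- The ordering of the three-step iteration. -/
def TripLE {δc lam : Cardinal.{0}}
    {xseq : Set Ordinal.{0} → Ordinal.{0} → Set Ordinal.{0}}
    (t t' : Trip δc lam xseq) : Prop :=
  P0.le t.p t'.p ∧
  t.w ⊆ t'.w ∧ t.a ≤ t'.a ∧
  (∀ i ∈ t.w, ∀ ξ < t.a, t'.r i ξ = t.r i ξ) ∧ t.Z ⊆ t'.Z ∧
  (∀ z ∈ t.Z, z ⊆ t.w → Cardinal.mk ↥z = Cardinal.lift.{1} δc →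
    ∀ ξ : Ordinal.{0}, t.a ≤ ξ → ξ < t'.a →
      Cardinal.mk ↥{i | i ∈ z ∧ t'.r i ξ = false} = Cardinal.lift.{1} δc ∧
      Cardinal.mk ↥{i | i ∈ z ∧ t'.r i ξ = true} = Cardinal.lift.{1} δc) ∧
  t.q2.dom ≤ t'.q2.dom ∧ t'.q2.c ∩ Set.Iio t.q2.dom = t.q2.c

/-- Partial functions, as functional sets of pairs. -/
def IsPFun {α : Type u} (g : Set (α × Bool)) : Prop :=
  ∀ a b b', (a, b) ∈ g → (a, b') ∈ g → b = b'

/-- `Q⁰_λ = Add(λ⁺, 1)`: partial functions `λ⁺ → 2` of size `≤ λ`. -/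
structure Q0 (lam : Cardinal.{0}) : Type 1 where
  g : Set (Ordinal.{0} × Bool)
  pfun : IsPFun g
  dom_sub : ∀ t ∈ g, t.1 < (Order.succ lam).ord
  small : Cardinal.mk ↥g ≤ Cardinal.lift.{1} lam

/-- `Q¹_λ = Add(λ, λ⁺)`: partial functions `λ × λ⁺ → 2` of size `< λ`. -/
structure Q1 (lam : Cardinal.{0}) : Type 1 where
  g : Set ((Ordinal.{0} × Ordinal.{0}) × Bool)
  pfun : IsPFun g
  dom_sub : ∀ t ∈ g, t.1.1 < lam.ord ∧ t.1.2 < (Order.succ lam).ord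
  small : Cardinal.mk ↥g < Cardinal.lift.{1} lam

/-- The ordering of (a dense presentation of) `Q⁰_λ * Q̇¹_λ`. -/
def QLE {lam : Cardinal.{0}} (x y : Q0 lam × Q1 lam) : Prop :=
  x.1.g ⊆ y.1.g ∧ x.2.g ⊆ y.2.g

/-- `D` is dense for the ordering `le`. -/
def IsDenseR {α : Type*} (le : α → α → Prop) (D : Set α) : Prop :=
  ∀ p : α, ∃ q ∈ D, le p q


theorem tree_label {X L K : Type u} (ltX : X → X → Prop) (ltL : L → L → Prop)
    (lx : X → L) (mX : ∀ a b, ltX a b → ltL (lx a) (lx b))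
    (tX : ∀ a b c, ltX a b → ltX b c → ltX a c)
    (linX : ∀ a b c, ltX a c → ltX b c → a = b ∨ ltX a b ∨ ltX b a)
    (KS : L → Set K)
    (cX : ∀ (b : Set X) (l : L), (∀ x ∈ b, ∀ y, ltX y x → y ∈ b) →
      (∀ x ∈ b, ∀ y ∈ b, x = y ∨ ltX x y ∨ ltX y x) → (∀ x ∈ b, ltL (lx x) l) →
      Nonempty ({x // lx x = l ∧ ∀ y, ltX y x ↔ y ∈ b} ≃ KS l)) :
    ∃ lab : X → K, (∀ x, lab x ∈ KS (lx x)) ∧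
      (∀ (b : Set X) (l : L), (∀ x ∈ b, ∀ y, ltX y x → y ∈ b) →
        (∀ x ∈ b, ∀ y ∈ b, x = y ∨ ltX x y ∨ ltX y x) → (∀ x ∈ b, ltL (lx x) l) →
        ∀ k ∈ KS l, ∃ x, lx x = l ∧ (∀ y, ltX y x ↔ y ∈ b) ∧ lab x = k) ∧
      (∀ x y, lx x = lx y → (∀ z, ltX z x ↔ ltX z y) → lab x = lab y → x = y) := by
  classical
  have key : ∀ (b : Set X) (l : L), ∃ e : X → K,
      ((∀ x ∈ b, ∀ y, ltX y x → y ∈ b) →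
      (∀ x ∈ b, ∀ y ∈ b, x = y ∨ ltX x y ∨ ltX y x) → (∀ x ∈ b, ltL (lx x) l) →
      Set.BijOn e {x | lx x = l ∧ ∀ y, ltX y x ↔ y ∈ b} (KS l)) := by
    intro b l
    by_cases h : (∀ x ∈ b, ∀ y, ltX y x → y ∈ b) ∧
      (∀ x ∈ b, ∀ y ∈ b, x = y ∨ ltX x y ∨ ltX y x) ∧ (∀ x ∈ b, ltL (lx x) l)
    · obtain ⟨e⟩ := cX b l h.1 h.2.1 h.2.2
      by_cases hK : Nonempty K
      · obtain ⟨k0⟩ := hK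
        refine ⟨fun x => if hx : lx x = l ∧ ∀ y, ltX y x ↔ y ∈ b then (e ⟨x, hx⟩).1 else k0, ?_⟩
        intro _ _ _
        refine ⟨?_, ?_, ?_⟩
        · intro x hx
          have hx' : lx x = l ∧ ∀ y, ltX y x ↔ y ∈ b := hx
          simp only [dif_pos hx']
          exact (e ⟨x, hx'⟩).2
        · intro x hx y hy hxy
          have hx' : lx x = l ∧ ∀ y, ltX y x ↔ y ∈ b := hx
          have hy' : lx y = l ∧ ∀ z, ltX z y ↔ z ∈ b := hy
          simp only [dif_pos hx', dif_pos hy'] at hxy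
          have := e.injective (Subtype.ext hxy)
          exact congrArg Subtype.val this
        · intro k hk
          refine ⟨(e.symm ⟨k, hk⟩).1, (e.symm ⟨k, hk⟩).2, ?_⟩
          have h2 := (e.symm ⟨k, hk⟩).2
          simp only [dif_pos h2]
          simp
      · have hX : IsEmpty {x // lx x = l ∧ ∀ y, ltX y x ↔ y ∈ b} :=
          ⟨fun x => hK ⟨(e x).1⟩⟩
        have hX2 : IsEmpty X := by
          refine ⟨fun x => ?_⟩
          obtain ⟨e'⟩ := cX {y | ltX y x} (lx x) (fun a ha c hc => tX _ _ _ hc ha)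
            (fun a ha c hc => linX _ _ _ ha hc) (fun a ha => mX _ _ ha)
          exact hK ⟨(e' ⟨x, rfl, fun y => Iff.rfl⟩).1⟩
        refine ⟨fun x => (hX2.false x).elim, fun _ _ _ => ⟨fun x => (hX2.false x).elim,
          fun x => (hX2.false x).elim, fun k => (hK ⟨k⟩).elim⟩⟩
    · by_cases hX : Nonempty X
      · obtain ⟨x⟩ := hX
        obtain ⟨e'⟩ := cX {y | ltX y x} (lx x) (fun a ha c hc => tX _ _ _ hc ha)
            (fun a ha c hc => linX _ _ _ ha hc) (fun a ha => mX _ _ ha)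
        exact ⟨fun _ => (e' ⟨x, rfl, fun y => Iff.rfl⟩).1, fun h1 h2 h3 => (h ⟨h1, h2, h3⟩).elim⟩
      · exact ⟨fun x => (hX ⟨x⟩).elim, fun h1 h2 h3 => (h ⟨h1, h2, h3⟩).elim⟩
  choose e he using key
  have hp : ∀ x, Set.BijOn (e {y | ltX y x} (lx x))
      {z | lx z = lx x ∧ ∀ y, ltX y z ↔ y ∈ {y | ltX y x}} (KS (lx x)) := fun x =>
    he _ _ (fun a ha c hc => tX _ _ _ hc ha)
            (fun a ha c hc => linX _ _ _ ha hc) (fun a ha => mX _ _ ha)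
  refine ⟨fun x => e {y | ltX y x} (lx x) x, ?_, ?_, ?_⟩
  · intro x
    exact (hp x).mapsTo ⟨rfl, fun y => Iff.rfl⟩
  · intro b l h1 h2 h3 k hk
    obtain ⟨x, ⟨hx1, hx2⟩, hx3⟩ := (he b l h1 h2 h3).surjOn hk
    refine ⟨x, hx1, hx2, ?_⟩
    have : {y | ltX y x} = b := Set.ext hx2
    simp only [this, hx1, hx3]
  · intro x y h1 h2 h3
    have hb : {z | ltX z x} = {z | ltX z y} := Set.ext h2
    simp only [hb, h1] at h3
    exact (hp y).injOn ⟨h1, h2⟩ ⟨rfl, fun _ => Iff.rfl⟩ h3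

theorem tree_iso {X Y L K : Type u} (ltX : X → X → Prop) (ltY : Y → Y → Prop)
    (ltL : L → L → Prop) (wf : WellFounded ltL)
    (lx : X → L) (ly : Y → L)
    (mX : ∀ a b, ltX a b → ltL (lx a) (lx b))
    (tX : ∀ a b c, ltX a b → ltX b c → ltX a c)
    (linX : ∀ a b c, ltX a c → ltX b c → a = b ∨ ltX a b ∨ ltX b a)
    (mY : ∀ a b, ltY a b → ltL (ly a) (ly b))
    (tY : ∀ a b c, ltY a b → ltY b c → ltY a c)
    (linY : ∀ a b c, ltY a c → ltY b c → a = b ∨ ltY a b ∨ ltY b a)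
    (KS : L → Set K)
    (cX : ∀ (b : Set X) (l : L), (∀ x ∈ b, ∀ y, ltX y x → y ∈ b) →
      (∀ x ∈ b, ∀ y ∈ b, x = y ∨ ltX x y ∨ ltX y x) → (∀ x ∈ b, ltL (lx x) l) →
      Nonempty ({x // lx x = l ∧ ∀ y, ltX y x ↔ y ∈ b} ≃ KS l))
    (cY : ∀ (b : Set Y) (l : L), (∀ x ∈ b, ∀ y, ltY y x → y ∈ b) →
      (∀ x ∈ b, ∀ y ∈ b, x = y ∨ ltY x y ∨ ltY y x) → (∀ x ∈ b, ltL (ly x) l) →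
      Nonempty ({x // ly x = l ∧ ∀ y, ltY y x ↔ y ∈ b} ≃ KS l)) :
    ∃ F : X ≃ Y, (∀ x, ly (F x) = lx x) ∧ ∀ a b, ltX a b ↔ ltY (F a) (F b) := by
  classical
  obtain ⟨labX, mlX, exX, unX⟩ := tree_label ltX ltL lx mX tX linX KS cX
  obtain ⟨labY, mlY, exY, unY⟩ := tree_label ltY ltL ly mY tY linY KS cY
  by_cases hX : Nonempty X
  swap
  · have hY : IsEmpty Y := by
      refine ⟨fun y => ?_⟩
      -- minimal level element of `Y` gives an element of `X`
      obtain ⟨x, -⟩ := exX ∅ (ly y) (by simp) (by simp) (by simp) (labY y) (mlY y)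
      exact hX ⟨x⟩
    have hX' : IsEmpty X := not_nonempty_iff.1 hX
    exact ⟨Equiv.equivOfIsEmpty X Y, fun x => (hX'.false x).elim, fun x => (hX'.false x).elim⟩
  have hY : Nonempty Y := by
    obtain ⟨x⟩ := hX
    obtain ⟨y, -⟩ := exY ∅ (lx x) (by simp) (by simp) (by simp) (labX x) (mlX x)
    exact ⟨y⟩
  have wfX : WellFounded ltX := Subrelation.wf (fun {a b} h => mX a b h) (InvImage.wf lx wf)
  have wfY : WellFounded ltY := Subrelation.wf (fun {a b} h => mY a b h) (InvImage.wf ly wf)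
  let F : X → Y := wfX.fix (fun x ih =>
    Classical.epsilon (fun y => ly y = lx x ∧ (∀ z, ltY z y ↔ ∃ x', ∃ h : ltX x' x, ih x' h = z) ∧
      labY y = labX x))
  have hF : ∀ x, F x = Classical.epsilon (fun y => ly y = lx x ∧
      (∀ z, ltY z y ↔ ∃ x', ∃ _ : ltX x' x, F x' = z) ∧ labY y = labX x) := fun x =>
    wfX.fix_eq _ x
  have main : ∀ x, ly (F x) = lx x ∧
      (∀ z, ltY z (F x) ↔ ∃ x', ∃ _ : ltX x' x, F x' = z) ∧ labY (F x) = labX x := by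
    intro x
    induction x using wfX.induction with
    | _ x ih =>
    rw [hF x]
    apply Classical.epsilon_spec (p := fun y => ly y = lx x ∧
      (∀ z, ltY z y ↔ ∃ x', ∃ _ : ltX x' x, F x' = z) ∧ labY y = labX x)
    have hmono : ∀ a c, ltX c x → ltX a c → ltY (F a) (F c) := fun a c hc hac =>
      ((ih c hc).2.1 _).2 ⟨a, hac, rfl⟩
    obtain ⟨y, h1, h2, h3⟩ := exY {z | ∃ x', ∃ _ : ltX x' x, F x' = z} (lx x)
      (by
        rintro _ ⟨x', hx', rfl⟩ y hy
        obtain ⟨x'', hx'', rfl⟩ := ((ih x' hx').2.1 y).1 hy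
        exact ⟨x'', tX _ _ _ hx'' hx', rfl⟩)
      (by
        rintro _ ⟨x', hx', rfl⟩ _ ⟨x'', hx'', rfl⟩
        rcases linX _ _ _ hx' hx'' with h | h | h
        · left; rw [h]
        · right; left; exact hmono _ _ hx'' h
        · right; right; exact hmono _ _ hx' h)
      (by
        rintro _ ⟨x', hx', rfl⟩
        rw [(ih x' hx').1]
        exact mX _ _ hx')
      (labX x) (mlX x)
    exact ⟨y, h1, h2, h3⟩
  have inj : ∀ x x', F x = F x' → x = x' := by
    intro x
    induction x using wfX.induction with
    | _ x ih =>
    intro x' h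
    apply unX
    · rw [← (main x).1, ← (main x').1, h]
    · intro z
      constructor
      · intro hz
        have : ltY (F z) (F x') := by rw [← h]; exact ((main x).2.1 _).2 ⟨z, hz, rfl⟩
        obtain ⟨z', hz', e⟩ := ((main x').2.1 _).1 this
        rw [ih z hz z' e.symm]; exact hz'
      · intro hz
        have : ltY (F z) (F x) := by rw [h]; exact ((main x').2.1 _).2 ⟨z, hz, rfl⟩
        obtain ⟨z', hz', e⟩ := ((main x).2.1 _).1 this
        rw [← ih z' hz' z e]; exact hz'
    · rw [← (main x).2.2, ← (main x').2.2, h]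
  have ordF : ∀ a b, ltX a b ↔ ltY (F a) (F b) := by
    intro a b
    constructor
    · intro h; exact ((main b).2.1 _).2 ⟨a, h, rfl⟩
    · intro h
      obtain ⟨z, hz, e⟩ := ((main b).2.1 _).1 h
      rw [← inj _ _ e]; exact hz
  have sur : ∀ y, ∃ x, F x = y := by
    intro y
    induction y using wfY.induction with
    | _ y ih =>
    obtain ⟨x, h1, h2, h3⟩ := exX {x | ltY (F x) y} (ly y)
      (by
        intro x hx z hz
        exact tY _ _ _ ((ordF _ _).1 hz) hx)
      (by
        intro x hx z hz
        rcases linY _ _ _ hx hz with h | h | h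
        · left; exact inj _ _ h
        · right; left; exact (ordF _ _).2 h
        · right; right; exact (ordF _ _).2 h)
      (by
        intro x hx
        rw [← (main x).1]
        exact mY _ _ hx)
      (labY y) (mlY y)
    refine ⟨x, unY _ _ ?_ ?_ ?_⟩
    · rw [(main x).1, h1]
    · intro z
      rw [(main x).2.1]
      constructor
      · rintro ⟨x', hx', rfl⟩
        exact (h2 x').1 hx'
      · intro hz
        obtain ⟨x', rfl⟩ := ih z hz
        exact ⟨x', (h2 x').2 hz, rfl⟩
    · rw [(main x).2.2, h3]
  exact ⟨Equiv.ofBijective F ⟨fun a b => inj a b, sur⟩, fun x => (main x).1, ordF⟩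

theorem mk_Iic_inf (η : Ordinal.{0}) (h : Ordinal.omega0 ≤ η) :
    #(Set.Iic η) = #(Set.Iio η) := by
  have : Set.Iic η = Set.Iio (η + 1) := by
    ext x; simp
  rw [this, Cardinal.mk_Iio_ordinal, Cardinal.mk_Iio_ordinal]
  congr 1
  rw [Ordinal.card_add, Ordinal.card_one]
  apply Cardinal.add_one_eq
  have := Ordinal.card_le_card h
  simpa using this

/-- Data of a block: rows `Bk` ranked by `ρ`, lower rows `N`, promises `M`. -/
structure BData where
  Lam : Ordinal.{0}
  Bk : Set Ordinal.{0}
  ρ : Ordinal.{0} → Ordinal.{0}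
  hρ : Set.BijOn ρ Bk (Set.Iio Lam)
  M : Ordinal.{0} → Set (Set Ordinal.{0})
  Mmono : ∀ η η', η ≤ η' → M η ⊆ M η'
  hM : ∀ η, ∀ z ∈ M η, ∀ i ∈ z, i ∈ Bk → ρ i ≤ η

namespace BData
variable (d : BData)

def N (η : Ordinal.{0}) : Set Ordinal.{0} := {i | i ∉ d.Bk ∧ ∃ z ∈ d.M η, i ∈ z}
def Dm (η : Ordinal.{0}) : Set Ordinal.{0} := {i | (i ∈ d.Bk ∧ d.ρ i ≤ η) ∨ i ∈ d.N η}
def Fl (η : Ordinal.{0}) (r : Ordinal.{0} → Ordinal.{0} → Bool) : Prop :=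
  ∀ i ∈ d.Bk, d.ρ i = η → r i 0 = true
def Agree (η : Ordinal.{0}) (r r' : Ordinal.{0} → Ordinal.{0} → Bool) : Prop :=
  ∀ i ∈ d.Dm η, ∀ ξ ≤ η, r' i ξ = r i ξ

theorem Nmono {η η' : Ordinal.{0}} (h : η ≤ η') : d.N η ⊆ d.N η' :=
  fun _ hi => ⟨hi.1, hi.2.choose, d.Mmono _ _ h hi.2.choose_spec.1, hi.2.choose_spec.2⟩

theorem Dmono {η η' : Ordinal.{0}} (h : η ≤ η') : d.Dm η ⊆ d.Dm η' := by
  rintro i (hi | hi)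
  · exact Or.inl ⟨hi.1, hi.2.trans h⟩
  · exact Or.inr (d.Nmono h hi)

theorem Msub {η : Ordinal.{0}} {z : Set Ordinal.{0}} (hz : z ∈ d.M η) : z ⊆ d.Dm η := by
  intro i hi
  by_cases h : i ∈ d.Bk
  · exact Or.inl ⟨h, d.hM _ _ hz _ hi h⟩
  · exact Or.inr ⟨h, z, hz, hi⟩

@[ext] structure BT where
  η : Ordinal.{0}
  r : Ordinal.{0} → Ordinal.{0} → Bool
  hη : Ordinal.omega0 ≤ η ∧ η < d.Lam
  supp : ∀ i ξ, r i ξ = true → i ∈ d.Dm η ∧ ξ ≤ η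
  fl : d.Fl η r

@[ext] structure Lv where
  η : Ordinal.{0}
  G : Ordinal.{0} → Ordinal.{0} → Bool
  hη : Ordinal.omega0 ≤ η ∧ η < d.Lam
  supp : ∀ i ξ, G i ξ = true → i ∈ d.N η ∧ ξ ≤ η

def ltL (x y : d.Lv) : Prop :=
  x.η < y.η ∧ ∀ i ∈ d.N x.η, ∀ ξ ≤ x.η, y.G i ξ = x.G i ξ

open Classical in
noncomputable def lev (x : d.BT) : d.Lv where
  η := x.η
  G := fun i ξ => decide (i ∈ d.N x.η ∧ x.r i ξ = true)
  hη := x.hη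
  supp := by
    intro i ξ h
    have h := of_decide_eq_true h
    exact ⟨h.1, (x.supp _ _ h.2).2⟩

theorem lev_G (x : d.BT) (i ξ : Ordinal.{0}) (h : i ∈ d.N x.η) : (d.lev x).G i ξ = x.r i ξ := by
  classical
  simp [lev, h]

theorem bt_ext {x y : d.BT} (h : x.η = y.η) (h2 : d.Agree x.η x.r y.r) : x = y := by
  apply BT.ext h
  funext i ξ
  by_cases hh : i ∈ d.Dm x.η ∧ ξ ≤ x.η
  · exact (h2 i hh.1 ξ hh.2).symm
  · have h1 : x.r i ξ = false := by
      by_contra hc; exact hh (x.supp i ξ (by simpa using hc))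
    have h2 : y.r i ξ = false := by
      by_contra hc; exact hh (h ▸ y.supp i ξ (by simpa using hc))
    rw [h1, h2]

def ltB (Sp : (Ordinal.{0} → Bool) → Set Ordinal.{0} → Prop) (x y : d.BT) : Prop :=
  x.η < y.η ∧ d.Agree x.η x.r y.r ∧
    ∀ z ∈ d.M x.η, ∀ ξ, x.η < ξ → ξ ≤ y.η → Sp (fun i => y.r i ξ) z

variable (Sp : (Ordinal.{0} → Bool) → Set Ordinal.{0} → Prop)

theorem ltB_lev (x y : d.BT) (h : d.ltB Sp x y) : d.ltL (d.lev x) (d.lev y) := by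
  refine ⟨h.1, fun i hi ξ hξ => ?_⟩
  have hi' : i ∈ d.N x.η := hi
  rw [d.lev_G x i ξ hi', d.lev_G y i ξ (d.Nmono h.1.le hi')]
  exact h.2.1 i (Or.inr hi') ξ hξ

theorem ltB_trans (hcong : ∀ g g' z, (∀ i ∈ z, g i = g' i) → Sp g z → Sp g' z)
    (x y v : d.BT) (h : d.ltB Sp x y) (h' : d.ltB Sp y v) : d.ltB Sp x v := by
  refine ⟨h.1.trans h'.1, ?_, ?_⟩
  · intro i hi ξ hξ
    rw [h'.2.1 i (d.Dmono h.1.le hi) ξ (hξ.trans h.1.le), h.2.1 i hi ξ hξ]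
  · intro z hz ξ h1 h2
    by_cases h3 : ξ ≤ y.η
    · refine hcong _ _ _ ?_ (h.2.2 z hz ξ h1 h3)
      intro i hi
      exact (h'.2.1 i (d.Dmono h.1.le (d.Msub hz hi)) ξ h3).symm
    · exact h'.2.2 z (d.Mmono _ _ h.1.le hz) ξ (not_le.1 h3) h2

theorem ltB_lin_aux (hcong : ∀ g g' z, (∀ i ∈ z, g i = g' i) → Sp g z → Sp g' z)
    (x y v : d.BT) (h : d.ltB Sp x v) (h' : d.ltB Sp y v) (hxy : x.η < y.η) :
    d.ltB Sp x y := by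
  refine ⟨hxy, ?_, ?_⟩
  · intro i hi ξ hξ
    rw [← h'.2.1 i (d.Dmono hxy.le hi) ξ (hξ.trans hxy.le), h.2.1 i hi ξ hξ]
  · intro z hz ξ h1 h2
    refine hcong _ _ _ ?_ (h.2.2 z hz ξ h1 (h2.trans h'.1.le))
    intro i hi
    exact h'.2.1 i (d.Dmono hxy.le (d.Msub hz hi)) ξ h2

theorem ltB_lin (hcong : ∀ g g' z, (∀ i ∈ z, g i = g' i) → Sp g z → Sp g' z)
    (x y v : d.BT) (h : d.ltB Sp x v) (h' : d.ltB Sp y v) :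
    x = y ∨ d.ltB Sp x y ∨ d.ltB Sp y x := by
  rcases lt_trichotomy x.η y.η with hxy | hxy | hxy
  · exact Or.inr (Or.inl (d.ltB_lin_aux Sp hcong x y v h h' hxy))
  · left
    apply d.bt_ext hxy
    intro i hi ξ hξ
    rw [← h'.2.1 i (hxy ▸ hi) ξ (hxy ▸ hξ), h.2.1 i hi ξ hξ]
  · exact Or.inr (Or.inr (d.ltB_lin_aux Sp hcong y x v h' h hxy))

theorem class_le (b : Set d.BT) (l : d.Lv) :
    #{x // d.lev x = l ∧ ∀ y, d.ltB Sp y x ↔ y ∈ b} ≤ #(𝒫 (Set.Iio l.η)) := by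
  classical
  have h1 : #{x // d.lev x = l ∧ ∀ y, d.ltB Sp y x ↔ y ∈ b} ≤
      #(𝒫 (Set.Iic l.η ×ˢ Set.Iic l.η)) := by
    refine Cardinal.mk_le_of_injective (f := fun x =>
      ⟨{q | q.1 ≤ l.η ∧ q.2 ≤ l.η ∧ ∃ i ∈ d.Bk, d.ρ i = q.1 ∧ x.1.r i q.2 = true},
        fun q hq => ⟨hq.1, hq.2.1⟩⟩) ?_
    rintro ⟨x, hx, hx'⟩ ⟨y, hy, hy'⟩ hxy
    have hxη : x.η = l.η := congrArg Lv.η hx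
    have hyη : y.η = l.η := congrArg Lv.η hy
    apply Subtype.ext
    apply d.bt_ext (hxη.trans hyη.symm)
    intro i hi ξ hξ
    have hxy := congrArg Subtype.val hxy
    dsimp only at hxy ⊢
    rcases hi with hi | hi
    · have := Set.ext_iff.1 hxy (d.ρ i, ξ)
      have e : ∀ v : d.BT, (∃ j ∈ d.Bk, d.ρ j = d.ρ i ∧ v.r j ξ = true) ↔ v.r i ξ = true := by
        intro v
        constructor
        · rintro ⟨j, hj, hji, h⟩
          rwa [d.hρ.injOn hj hi.1 hji] at h
        · intro h
          exact ⟨i, hi.1, rfl, h⟩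
      simp only [Set.mem_ofPred_eq, e, ← hxη, hi.2, hξ, true_and] at this
      rw [Bool.eq_iff_iff]; exact this.symm
    · have : (d.lev x).G i ξ = (d.lev y).G i ξ := by rw [hx, hy]
      rw [d.lev_G x i ξ hi, d.lev_G y i ξ (by rw [hyη, ← hxη]; exact hi)] at this
      exact this.symm
  refine h1.trans ?_
  rw [Cardinal.mk_powerset, Cardinal.mk_powerset, Cardinal.mk_setProd, mk_Iic_inf _ l.hη.1]
  have : ℵ₀ ≤ #(Set.Iio l.η) := by
    rw [Cardinal.mk_Iio_ordinal, Cardinal.aleph0_le_lift]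
    have := Ordinal.card_le_card l.hη.1
    simpa using this
  rw [Cardinal.mul_eq_self this]

theorem class_ge (hcong : ∀ g g' z, (∀ i ∈ z, g i = g' i) → Sp g z → Sp g' z)
    (f0 : Ordinal.{0} → Bool)
    (hf0 : ∀ η, ∀ z ∈ d.M η, ∀ g : Ordinal.{0} → Bool, (∀ i ∈ z, i ∈ d.Bk → g i = f0 i) → Sp g z)
    (b : Set d.BT) (l : d.Lv) (hdown : ∀ x ∈ b, ∀ y, d.ltB Sp y x → y ∈ b)
    (hchain : ∀ x ∈ b, ∀ y ∈ b, x = y ∨ d.ltB Sp x y ∨ d.ltB Sp y x)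
    (hlev : ∀ x ∈ b, d.ltL (d.lev x) l) :
    #(𝒫 (Set.Iio l.η)) ≤ #{x // d.lev x = l ∧ ∀ y, d.ltB Sp y x ↔ y ∈ b} := by
  classical
  have hlt : ∀ x ∈ b, x.η < l.η := fun x hx => (hlev x hx).1
  -- coherence
  have coh : ∀ x ∈ b, ∀ y ∈ b, ∀ i ∈ d.Bk, ∀ ξ, d.ρ i ≤ x.η → ξ ≤ x.η → d.ρ i ≤ y.η → ξ ≤ y.η →
      x.r i ξ = y.r i ξ := by
    intro x hx y hy i hi ξ h1 h2 h3 h4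
    rcases hchain x hx y hy with h | h | h
    · rw [h]
    · exact (h.2.1 i (Or.inl ⟨hi, h1⟩) ξ h2).symm
    · exact (h.2.1 i (Or.inl ⟨hi, h3⟩) ξ h4)
  let R : Set Ordinal.{0} → Ordinal.{0} → Ordinal.{0} → Bool := fun h i ξ =>
    if ξ ≤ l.η then
      if i ∈ d.N l.η then l.G i ξ
      else if i ∈ d.Bk ∧ d.ρ i ≤ l.η then
        if ∃ x ∈ b, d.ρ i ≤ x.η ∧ ξ ≤ x.η then
          decide (∃ x ∈ b, d.ρ i ≤ x.η ∧ ξ ≤ x.η ∧ x.r i ξ = true)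
        else if ξ = 0 then decide (d.ρ i = l.η)
        else if ∃ x ∈ b, d.ρ i ≤ x.η then f0 i
        else decide (d.ρ i = l.η ∧ ∃ ζ ∈ h, ξ = 1 + ζ)
      else false
    else false
  have hNB : ∀ i η, i ∈ d.Bk → i ∉ d.N η := fun i η h h' => h'.1 h
  have R_N : ∀ h, ∀ i ∈ d.N l.η, ∀ ξ ≤ l.η, R h i ξ = l.G i ξ := by
    intro h i hi ξ hξ
    simp only [R, if_pos hξ, if_pos hi]
  have R_b : ∀ h, ∀ x ∈ b, ∀ i ∈ d.Bk, ∀ ξ, d.ρ i ≤ x.η → ξ ≤ x.η → R h i ξ = x.r i ξ := by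
    intro h x hx i hi ξ h1 h2
    have e1 : ∃ x ∈ b, d.ρ i ≤ x.η ∧ ξ ≤ x.η := ⟨x, hx, h1, h2⟩
    simp only [R, if_pos (h2.trans (hlt x hx).le), if_neg (hNB i _ hi),
      if_pos (show i ∈ d.Bk ∧ d.ρ i ≤ l.η from ⟨hi, h1.trans (hlt x hx).le⟩), if_pos e1]
    rw [Bool.eq_iff_iff, decide_eq_true_iff]
    constructor
    · rintro ⟨y, hy, h3, h4, h5⟩
      rw [coh x hx y hy i hi ξ h1 h2 h3 h4]; exact h5
    · intro h5; exact ⟨x, hx, h1, h2, h5⟩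
  let T : Set Ordinal.{0} → d.BT := fun h =>
    { η := l.η
      r := R h
      hη := l.hη
      supp := by
        intro i ξ hr
        by_cases h1 : ξ ≤ l.η
        · refine ⟨?_, h1⟩
          by_cases h2 : i ∈ d.N l.η
          · exact Or.inr h2
          · by_cases h3 : i ∈ d.Bk ∧ d.ρ i ≤ l.η
            · exact Or.inl h3
            · simp only [R, if_pos h1, if_neg h2, if_neg h3] at hr
              exact absurd hr (by simp)
        · simp only [R, if_neg h1] at hr
          exact absurd hr (by simp)
      fl := by
        intro i hi hie
        have e1 : ¬ ∃ x ∈ b, d.ρ i ≤ x.η ∧ (0 : Ordinal.{0}) ≤ x.η := by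
          rintro ⟨x, hx, h1, -⟩
          exact absurd (hlt x hx) (not_lt.2 (hie ▸ h1))
        simp only [R, if_pos (zero_le (a := l.η)), if_neg (hNB i _ hi),
          if_pos (show i ∈ d.Bk ∧ d.ρ i ≤ l.η from ⟨hi, hie.le⟩), if_neg e1]
        simp [hie] }
  have T_lev : ∀ h, d.lev (T h) = l := by
    intro h
    apply Lv.ext
    · rfl
    · funext i ξ
      by_cases hi : i ∈ d.N l.η
      · rw [d.lev_G (T h) i ξ hi]
        by_cases hξ : ξ ≤ l.η
        · exact R_N h i hi ξ hξ
        · have : l.G i ξ = false := by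
            by_contra hc
            exact hξ (l.supp i ξ (by simpa using hc)).2
          rw [this]
          simp only [T, R, if_neg hξ]
      · have h1 : l.G i ξ = false := by
          by_contra hc
          exact hi (l.supp i ξ (by simpa using hc)).1
        have h2 : (d.lev (T h)).G i ξ = false := by
          by_contra hc
          exact hi ((d.lev (T h)).supp i ξ (by simpa using hc)).1
        rw [h1, h2]
  have T_agree : ∀ h, ∀ y ∈ b, d.Agree y.η y.r (R h) := by
    intro h y hy i hi ξ hξ
    rcases hi with hi | hi
    · exact R_b h y hy i hi.1 ξ hi.2 hξ
    · rw [R_N h i (d.Nmono (hlt y hy).le hi) ξ (hξ.trans (hlt y hy).le), (hlev y hy).2 i hi ξ hξ,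
        d.lev_G y i ξ hi]
  have T_gt : ∀ h, ∀ y ∈ b, d.ltB Sp y (T h) := by
    intro h y hy
    refine ⟨hlt y hy, T_agree h y hy, ?_⟩
    intro z hz ξ h1 h2
    have h2' : ξ ≤ l.η := h2
    by_cases hx : ∃ x ∈ b, ξ ≤ x.η
    · obtain ⟨x, hx, hξx⟩ := hx
      have hyx : d.ltB Sp y x := by
        rcases hchain y hy x hx with e | e | e
        · exact absurd (h1.trans_le hξx) (by rw [e]; exact lt_irrefl _)
        · exact e
        · exact absurd (h1.trans_le hξx) (not_lt.2 e.1.le)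
      refine hcong _ _ _ ?_ (hyx.2.2 z hz ξ h1 hξx)
      intro i hi
      exact (T_agree h x hx i (d.Dmono hyx.1.le (d.Msub hz hi)) ξ hξx).symm
    · apply hf0 y.η z hz
      intro i hi hiB
      have hr := d.hM _ _ hz i hi hiB
      have e1 : ¬ ∃ x ∈ b, d.ρ i ≤ x.η ∧ ξ ≤ x.η := fun ⟨x, hx', _, h⟩ => hx ⟨x, hx', h⟩
      have e2 : ξ ≠ 0 := (pos_of_gt h1).ne'
      have e3 : ∃ x ∈ b, d.ρ i ≤ x.η := ⟨y, hy, hr⟩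
      show R h i ξ = f0 i
      simp only [R, if_pos h2', if_neg (hNB i _ hiB),
        if_pos (show i ∈ d.Bk ∧ d.ρ i ≤ l.η from ⟨hiB, hr.trans (hlt y hy).le⟩), if_neg e1,
        if_neg e2, if_pos e3]
  have T_lt : ∀ h y, d.ltB Sp y (T h) → y ∈ b := by
    intro h y hy
    have hyl : y.η < l.η := hy.1
    obtain ⟨i, hi, hie⟩ := d.hρ.surjOn y.hη.2
    have h1 : R h i 0 = true := (hy.2.1 i (Or.inl ⟨hi, hie.le⟩) 0 zero_le).trans (y.fl i hi hie)
    have h2 : ∃ x ∈ b, d.ρ i ≤ x.η ∧ (0 : Ordinal.{0}) ≤ x.η := by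
      by_contra hc
      simp only [R, if_pos (zero_le (a := l.η)), if_neg (hNB i _ hi),
          if_pos (show i ∈ d.Bk ∧ d.ρ i ≤ l.η from ⟨hi, hie.le.trans hyl.le⟩), if_neg hc] at h1
      simp [hie, hyl.ne] at h1
    obtain ⟨x, hx, hx1, -⟩ := h2
    rw [hie] at hx1
    rcases d.ltB_lin Sp hcong y x _ hy (T_gt h x hx) with e | e | e
    · rw [e]; exact hx
    · exact hdown x hx y e
    · exact absurd e.1 (not_lt.2 hx1)
  refine Cardinal.mk_le_of_injective (f := fun h : 𝒫 (Set.Iio l.η) =>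
    ⟨T h.1, T_lev _, fun y => ⟨T_lt _ y, T_gt _ y⟩⟩) ?_
  rintro ⟨h, hh⟩ ⟨h', hh'⟩ e
  apply Subtype.ext
  have e := congrArg (fun t => t.1.r) e
  obtain ⟨i, hi, hie⟩ := d.hρ.surjOn l.hη.2
  have key : ∀ h : Set Ordinal.{0}, ∀ ζ < l.η, R h i (1 + ζ) = true ↔ ζ ∈ h := by
    intro h ζ hζ
    have h1 : 1 + ζ ≤ l.η := by
      rw [← Ordinal.one_add_of_omega0_le l.hη.1]
      exact add_le_add_right hζ.le 1
    have e1 : ¬ ∃ x ∈ b, d.ρ i ≤ x.η ∧ 1 + ζ ≤ x.η := by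
      rintro ⟨x, hx, h1, -⟩
      exact absurd (hlt x hx) (not_lt.2 (hie ▸ h1))
    have e3 : ¬ ∃ x ∈ b, d.ρ i ≤ x.η := by
      rintro ⟨x, hx, h1⟩
      exact absurd (hlt x hx) (not_lt.2 (hie ▸ h1))
    have e2 : 1 + ζ ≠ 0 := by
      intro h0
      have := (Ordinal.add_eq_zero_iff.1 h0).1
      exact one_ne_zero this
    simp only [R, if_pos h1, if_neg (hNB i _ hi),
        if_pos (show i ∈ d.Bk ∧ d.ρ i ≤ l.η from ⟨hi, hie.le⟩), if_neg e1,
        if_neg e2, if_neg e3]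
    simp only [decide_eq_true_iff, hie, true_and]
    constructor
    · rintro ⟨ζ', h1, h2⟩
      rwa [(add_right_inj _).1 h2]
    · intro h1; exact ⟨ζ, h1, rfl⟩
  ext ζ
  by_cases hζ : ζ < l.η
  · rw [← key h ζ hζ, ← key h' ζ hζ]
    have : R h = R h' := e
    rw [this]
  · exact ⟨fun hm => absurd (hh hm) hζ, fun hm => absurd (hh' hm) hζ⟩

theorem block_main (hcong : ∀ g g' z, (∀ i ∈ z, g i = g' i) → Sp g z → Sp g' z)
    (f0 : Ordinal.{0} → Bool)
    (hf0 : ∀ η, ∀ z ∈ d.M η, ∀ g : Ordinal.{0} → Bool, (∀ i ∈ z, i ∈ d.Bk → g i = f0 i) → Sp g z)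
    : ∃ FF : Ordinal.{0} → (Ordinal.{0} → Ordinal.{0} → Bool) →
      (Ordinal.{0} → Ordinal.{0} → Bool),
    (∀ η r, Ordinal.omega0 ≤ η → η < d.Lam → d.Fl η r →
      d.Fl η (FF η r) ∧ ∀ i ∈ d.N η, ∀ ξ ≤ η, FF η r i ξ = r i ξ) ∧
    (∀ η r η' r', Ordinal.omega0 ≤ η → η ≤ η' → η' < d.Lam → d.Fl η r → d.Fl η' r' →
      ((d.Agree η r r' ∧ ∀ z ∈ d.M η, ∀ ξ, η < ξ → ξ ≤ η' → Sp (fun i => r' i ξ) z) ↔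
        d.Agree η (FF η r) (FF η' r'))) ∧
    (∀ η r, Ordinal.omega0 ≤ η → η < d.Lam → d.Fl η r →
      ∃ r', d.Fl η r' ∧ d.Agree η (FF η r') r) := by
  classical
  let Tr : (Ordinal.{0} → Bool) → Set Ordinal.{0} → Prop := fun _ _ => True
  have wfL : WellFounded d.ltL :=
    Subrelation.wf (fun {a b} h => h.1) (InvImage.wf (fun x : d.Lv => x.η) Ordinal.lt_wf)
  obtain ⟨F, hF1, hF2⟩ := tree_iso (d.ltB Sp) (d.ltB Tr) d.ltL wfL d.lev d.lev
    (d.ltB_lev Sp) (d.ltB_trans Sp hcong) (d.ltB_lin Sp hcong)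
    (d.ltB_lev Tr) (d.ltB_trans Tr (fun _ _ _ _ _ => trivial))
    (d.ltB_lin Tr (fun _ _ _ _ _ => trivial)) (fun l => 𝒫 (Set.Iio l.η))
    (fun b l h1 h2 h3 => Cardinal.eq.1 (le_antisymm (d.class_le Sp b l)
      (d.class_ge Sp hcong f0 hf0 b l h1 h2 h3)))
    (fun b l h1 h2 h3 => Cardinal.eq.1 (le_antisymm (d.class_le Tr b l)
      (d.class_ge Tr (fun _ _ _ _ _ => trivial) f0 (fun _ _ _ _ _ => trivial) b l h1 h2 h3)))
  -- truncation
  let tr : ∀ η, (Ordinal.omega0 ≤ η ∧ η < d.Lam) → ∀ r, d.Fl η r → d.BT := fun η hη r hr =>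
    { η := η
      r := fun i ξ => decide (i ∈ d.Dm η ∧ ξ ≤ η ∧ r i ξ = true)
      hη := hη
      supp := fun i ξ h => by
        have h := of_decide_eq_true h
        exact ⟨h.1, h.2.1⟩
      fl := fun i hi hie => by
        simp only [decide_eq_true_iff]
        exact ⟨Or.inl ⟨hi, hie.le⟩, zero_le, hr i hi hie⟩ }
  have tr_r : ∀ η hη r hr, ∀ i ∈ d.Dm η, ∀ ξ ≤ η, (tr η hη r hr).r i ξ = r i ξ := by
    intro η hη r hr i hi ξ hξ
    simp [tr, hi, hξ]
  let FF : Ordinal.{0} → (Ordinal.{0} → Ordinal.{0} → Bool) →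
      (Ordinal.{0} → Ordinal.{0} → Bool) := fun η r =>
    if h : (Ordinal.omega0 ≤ η ∧ η < d.Lam) ∧ d.Fl η r then (F (tr η h.1 r h.2)).r else r
  have FF_eq : ∀ η r hη hr, FF η r = (F (tr η hη r hr)).r := by
    intro η r hη hr
    simp only [FF]
    rw [dif_pos ⟨hη, hr⟩]
  have Fη : ∀ x, (F x).η = x.η := fun x => congrArg Lv.η (hF1 x)
  refine ⟨FF, ?_, ?_, ?_⟩
  · intro η r h1 h2 hr
    rw [FF_eq η r ⟨h1, h2⟩ hr]
    have e := Fη (tr η ⟨h1, h2⟩ r hr)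
    constructor
    · have := (F (tr η ⟨h1, h2⟩ r hr)).fl
      rw [e] at this
      exact this
    · intro i hi ξ hξ
      have : (d.lev (F (tr η ⟨h1, h2⟩ r hr))).G i ξ = (d.lev (tr η ⟨h1, h2⟩ r hr)).G i ξ := by
        rw [hF1]
      rw [d.lev_G _ i ξ (by rw [e]; exact hi), d.lev_G _ i ξ hi,
        tr_r η ⟨h1, h2⟩ r hr i (Or.inr hi) ξ hξ] at this
      exact this
  · intro η r η' r' h1 h2 h3 hr hr'
    rw [FF_eq η r ⟨h1, h2.trans_lt h3⟩ hr, FF_eq η' r' ⟨h1.trans h2, h3⟩ hr']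
    set x := tr η ⟨h1, h2.trans_lt h3⟩ r hr with hx
    set y := tr η' ⟨h1.trans h2, h3⟩ r' hr' with hy
    have xη : x.η = η := rfl
    have yη : y.η = η' := rfl
    have Fx : (F x).η = η := Fη x
    have Fy : (F y).η = η' := Fη y
    have hag : d.Agree η r r' ↔ d.Agree η x.r y.r := by
      refine forall_congr' fun i => forall_congr' fun hi => forall_congr' fun ξ =>
        forall_congr' fun hξ => ?_
      have a := tr_r η ⟨h1, h2.trans_lt h3⟩ r hr i hi ξ hξ
      have c := tr_r η' ⟨h1.trans h2, h3⟩ r' hr' i (d.Dmono h2 hi) ξ (hξ.trans h2)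
      rw [hx, hy, a, c]
    rcases h2.eq_or_lt with h | h
    · subst h
      rw [hag]
      constructor
      · rintro ⟨h, -⟩
        have : x = y := d.bt_ext rfl h
        rw [this]
        exact fun _ _ _ _ => rfl
      · intro h
        have : F x = F y := d.bt_ext (Fx.trans Fy.symm) (by rw [Fx]; exact h)
        rw [F.injective this]
        exact ⟨fun _ _ _ _ => rfl, fun z hz ξ a b => absurd (a.trans_le b) (lt_irrefl _)⟩
    · have : (d.Agree η r r' ∧ ∀ z ∈ d.M η, ∀ ξ, η < ξ → ξ ≤ η' → Sp (fun i => r' i ξ) z) ↔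
          d.ltB Sp x y := by
        rw [hag]
        constructor
        · rintro ⟨a, c⟩
          refine ⟨h, a, fun z hz ξ e1 e2 => hcong _ _ _ ?_ (c z hz ξ e1 e2)⟩
          intro i hi
          exact (tr_r η' ⟨h1.trans h2, h3⟩ r' hr' i (d.Dmono h2 (d.Msub hz hi)) ξ e2).symm
        · rintro ⟨-, a, c⟩
          refine ⟨a, fun z hz ξ e1 e2 => hcong _ _ _ ?_ (c z hz ξ e1 e2)⟩
          intro i hi
          exact (tr_r η' ⟨h1.trans h2, h3⟩ r' hr' i (d.Dmono h2 (d.Msub hz hi)) ξ e2)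
      rw [this, hF2]
      constructor
      · rintro ⟨-, a, -⟩
        rw [Fx] at a; exact a
      · intro a
        refine ⟨by rw [Fx, Fy]; exact h, by rw [Fx]; exact a, fun _ _ _ _ _ => trivial⟩
  · intro η r h1 h2 hr
    set y := tr η ⟨h1, h2⟩ r hr with hy
    have e : (F.symm y).η = η := by
      have := Fη (F.symm y)
      rw [F.apply_symm_apply] at this
      exact this.symm
    have hfl : d.Fl η (F.symm y).r := by
      have := (F.symm y).fl
      rw [e] at this
      exact this
    refine ⟨(F.symm y).r, hfl, ?_⟩
    rw [FF_eq η _ ⟨h1, h2⟩ hfl]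
    have : tr η ⟨h1, h2⟩ (F.symm y).r hfl = F.symm y := by
      apply d.bt_ext e.symm
      intro i hi ξ hξ
      exact (tr_r η ⟨h1, h2⟩ (F.symm y).r hfl i hi ξ hξ).symm
    rw [this, F.apply_symm_apply]
    intro i hi ξ hξ
    exact (tr_r η ⟨h1, h2⟩ r hr i hi ξ hξ).symm

end BData

/-- Marked levels. -/
def Mark (lam : Cardinal.{0}) (m : Ordinal.{0}) : Prop :=
  ∃ ν : Ordinal.{0}, m = lam.ord * ν + lam.ord

theorem Mark.ge {lam : Cardinal.{0}} {ν m : Ordinal.{0}} (hm : Mark lam m)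
    (h : lam.ord * ν < m) : lam.ord * ν + lam.ord ≤ m := by
  obtain ⟨μ, rfl⟩ := hm
  have e : ∀ ν : Ordinal.{0}, lam.ord * ν + lam.ord = lam.ord * (ν + 1) :=
    fun ν => (mul_add_one _ _).symm
  rw [e] at h
  rw [e, e]
  apply mul_le_mul_right
  rw [← Order.succ_eq_add_one]
  apply Order.succ_le_of_lt
  exact lt_of_mul_lt_mul_left h zero_le

theorem Mark.le {lam : Cardinal.{0}} {ν m : Ordinal.{0}} (hm : Mark lam m)
    (h : m < lam.ord * ν + lam.ord) : m ≤ lam.ord * ν := by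
  by_contra hc
  exact absurd (hm.ge (not_le.1 hc)) (not_le.2 h)

theorem card_lt_succ {lam : Cardinal.{0}} {γ : Ordinal.{0}} :
    γ < (Order.succ lam).ord ↔ γ.card ≤ lam := by
  rw [Cardinal.lt_ord, Order.lt_succ_iff]

theorem add_one_lt_succ {lam : Cardinal.{0}} (hl : ℵ₀ ≤ lam) {γ : Ordinal.{0}}
    (h : γ < (Order.succ lam).ord) : γ + 1 < (Order.succ lam).ord := by
  rw [card_lt_succ] at *
  rw [Ordinal.card_add, Ordinal.card_one]
  exact Cardinal.add_le_of_le hl h (Cardinal.one_le_aleph0.trans hl)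

theorem exists_mark {lam : Cardinal.{0}} (hl : ℵ₀ ≤ lam) (α : Ordinal.{0})
    (h : α < (Order.succ lam).ord) : ∃ m, Mark lam m ∧ α < m ∧ m < (Order.succ lam).ord := by
  have h0 : 0 < lam.ord := by
    rw [Cardinal.lt_ord]; simpa using (Cardinal.aleph0_pos.trans_le hl)
  refine ⟨lam.ord * α + lam.ord, ⟨α, rfl⟩, ?_, ?_⟩
  · exact (Ordinal.le_mul_right α h0).trans_lt (lt_add_of_pos_right _ h0)
  · rw [card_lt_succ] at *
    rw [Ordinal.card_add, Ordinal.card_mul, Cardinal.card_ord]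
    exact Cardinal.add_le_of_le hl (Cardinal.mul_le_of_le hl le_rfl h) le_rfl

theorem mk_Iic_le {lam : Cardinal.{0}} (hl : ℵ₀ ≤ lam) {γ : Ordinal.{0}}
    (h : γ < (Order.succ lam).ord) : #(Set.Iic γ) ≤ Cardinal.lift.{1} lam := by
  have : Set.Iic γ = Set.Iio (γ + 1) := by
    ext x; simp
  rw [this, Cardinal.mk_Iio_ordinal, Cardinal.lift_le]
  exact card_lt_succ.1 (add_one_lt_succ hl h)

@[ext] structure Nd (δc lam : Cardinal.{0}) : Type 1 where
  γ : Ordinal.{0}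
  s : Set Ordinal.{0}
  c : Set Ordinal.{0}
  mark : Mark lam γ
  γ_lt : γ < (Order.succ lam).ord
  s_sub : s ⊆ Set.Iic γ
  s_cof : ∀ β ∈ s, β.cof = δc ∧ δc.ord < β
  s_ns : ∀ γ', ¬ StationaryIn (s ∩ Set.Iio γ') (sSup (s ∩ Set.Iio γ'))
  c_sub : c ⊆ Set.Iic γ
  c_cl : ∀ β ≤ γ, 0 < β → (∀ γ' < β, ∃ ξ ∈ c, γ' < ξ ∧ ξ < β) → β ∈ c
  γ_mem : γ ∈ c
  disj : ∀ β ∈ c, β ∉ s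

namespace Nd
variable {δc lam : Cardinal.{0}}

theorem s_lt (x : Nd δc lam) {β : Ordinal.{0}} (h : β ∈ x.s) : β < x.γ :=
  lt_of_le_of_ne (x.s_sub h) (fun e => x.disj _ x.γ_mem (e ▸ h))

def le (x y : Nd δc lam) : Prop :=
  x.γ ≤ y.γ ∧ y.s ∩ Set.Iic x.γ = x.s ∧ y.c ∩ Set.Iic x.γ = x.c

def lt (x y : Nd δc lam) : Prop := x.γ < y.γ ∧ x.le y

theorem le_refl' (x : Nd δc lam) : x.le x :=
  ⟨le_rfl, Set.inter_eq_left.2 x.s_sub, Set.inter_eq_left.2 x.c_sub⟩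

theorem le_trans' {x y z : Nd δc lam} (h : x.le y) (h' : y.le z) : x.le z := by
  refine ⟨h.1.trans h'.1, ?_, ?_⟩
  · rw [← h.2.1, ← h'.2.1, Set.inter_assoc, Set.Iic_inter_Iic, min_eq_right h.1]
  · rw [← h.2.2, ← h'.2.2, Set.inter_assoc, Set.Iic_inter_Iic, min_eq_right h.1]

theorem eq_of_le {x y : Nd δc lam} (h : x.le y) (h' : y.γ ≤ x.γ) : x = y := by
  have e := le_antisymm h.1 h'
  apply Nd.ext e
  · rw [← h.2.1, e]; exact Set.inter_eq_left.2 y.s_sub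
  · rw [← h.2.2, e]; exact Set.inter_eq_left.2 y.c_sub

theorem lt_trans' {x y z : Nd δc lam} (h : x.lt y) (h' : y.lt z) : x.lt z :=
  ⟨h.1.trans h'.1, le_trans' h.2 h'.2⟩

theorem le_of_le_le {x y z : Nd δc lam} (h : x.le z) (h' : y.le z) (hxy : x.γ ≤ y.γ) : x.le y := by
  refine ⟨hxy, ?_, ?_⟩
  · rw [← h.2.1, ← h'.2.1, Set.inter_assoc, Set.Iic_inter_Iic, min_eq_right hxy]
  · rw [← h.2.2, ← h'.2.2, Set.inter_assoc, Set.Iic_inter_Iic, min_eq_right hxy]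

theorem lin {x y z : Nd δc lam} (h : x.lt z) (h' : y.lt z) : x = y ∨ x.lt y ∨ y.lt x := by
  rcases lt_trichotomy x.γ y.γ with e | e | e
  · exact Or.inr (Or.inl ⟨e, le_of_le_le h.2 h'.2 e.le⟩)
  · exact Or.inl (eq_of_le (le_of_le_le h.2 h'.2 e.le) e.ge)
  · exact Or.inr (Or.inr ⟨e, le_of_le_le h'.2 h.2 e.le⟩)

theorem s_iff {x y : Nd δc lam} (h : x.le y) {β : Ordinal.{0}} (hβ : β ≤ x.γ) :
    β ∈ x.s ↔ β ∈ y.s := by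
  rw [← h.2.1]; exact ⟨fun h => h.1, fun h => ⟨h, hβ⟩⟩

theorem c_iff {x y : Nd δc lam} (h : x.le y) {β : Ordinal.{0}} (hβ : β ≤ x.γ) :
    β ∈ x.c ↔ β ∈ y.c := by
  rw [← h.2.2]; exact ⟨fun h => h.1, fun h => ⟨h, hβ⟩⟩

/-- The node built above a branch. -/
theorem ext_node (b : Set (Nd δc lam)) (ν : Ordinal.{0}) (hγ : lam.ord * ν + lam.ord < (Order.succ lam).ord)
    (hl : ℵ₀ ≤ lam)
    (hdown : ∀ x ∈ b, ∀ y, lt y x → y ∈ b)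
    (hchain : ∀ x ∈ b, ∀ y ∈ b, x = y ∨ lt x y ∨ lt y x)
    (hlev : ∀ x ∈ b, x.γ < lam.ord * ν + lam.ord) (h : Set Ordinal.{0}) :
    ∃ t : Nd δc lam, t.γ = lam.ord * ν + lam.ord ∧ (∀ y, lt y t ↔ y ∈ b) ∧
      ∀ η < lam.ord, (lam.ord * ν + (η + 1) ∈ t.c ↔ η ∈ h) := by
  have hlev' : ∀ x ∈ b, x.γ ≤ lam.ord * ν := fun x hx => x.mark.le (hlev x hx)
  have hlim : Order.IsSuccLimit lam.ord := Cardinal.isSuccLimit_ord hl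
  have h0 : 0 < lam.ord := by
    rw [Cardinal.lt_ord]; simpa using (Cardinal.aleph0_pos.trans_le hl)
  have hle : ∀ x ∈ b, ∀ y ∈ b, x.le y ∨ y.le x := by
    intro x hx y hy
    rcases hchain x hx y hy with e | e | e
    · exact Or.inl (e ▸ le_refl' x)
    · exact Or.inl e.2
    · exact Or.inr e.2
  let s : Set Ordinal.{0} := {β | ∃ x ∈ b, β ∈ x.s}
  let U : Set Ordinal.{0} := {β | ∃ x ∈ b, β ∈ x.c}
  let LU : Ordinal.{0} → Prop := fun κ => 0 < κ ∧ ∀ γ' < κ, ∃ ξ ∈ U, γ' < ξ ∧ ξ < κ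
  have scoh : ∀ x ∈ b, ∀ β ≤ x.γ, β ∈ s → β ∈ x.s := by
    rintro x hx β hβ ⟨y, hy, hβy⟩
    rcases hle x hx y hy with e | e
    · exact (s_iff e hβ).2 hβy
    · exact (s_iff e (y.s_sub hβy)).1 hβy
  have ccoh : ∀ x ∈ b, ∀ β ≤ x.γ, β ∈ U → β ∈ x.c := by
    rintro x hx β hβ ⟨y, hy, hβy⟩
    rcases hle x hx y hy with e | e
    · exact (c_iff e hβ).2 hβy
    · exact (c_iff e (y.c_sub hβy)).1 hβy
  have lcoh : ∀ x ∈ b, ∀ β ≤ x.γ, LU β → β ∈ x.c := by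
    rintro x hx β hβ ⟨hβ0, hβ1⟩
    apply x.c_cl β hβ hβ0
    intro γ' h
    obtain ⟨ξ, h1, h2, h3⟩ := hβ1 γ' h
    exact ⟨ξ, ccoh x hx ξ (h3.le.trans hβ) h1, h2, h3⟩
  have Ule : ∀ β ∈ U, β ≤ lam.ord * ν := by
    rintro β ⟨x, hx, hβ⟩
    exact (x.c_sub hβ).trans (hlev' x hx)
  have Lle : ∀ β, LU β → β ≤ lam.ord * ν := by
    rintro β ⟨-, hβ⟩
    by_contra hc
    obtain ⟨ξ, h1, h2, -⟩ := hβ _ (not_le.1 hc)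
    exact absurd (Ule ξ h1) (not_le.2 h2)
  have Us : ∀ β ∈ U, β ∉ s := by
    rintro β hβ ⟨x, hx, hβx⟩
    exact x.disj β (ccoh x hx β (x.s_sub hβx) hβ) hβx
  have Ls : ∀ β, LU β → β ∉ s := by
    rintro β hβ ⟨x, hx, hβx⟩
    exact x.disj β (lcoh x hx β (x.s_sub hβx) hβ) hβx
  have sle : ∀ β ∈ s, β ≤ lam.ord * ν := by
    rintro β ⟨x, hx, hβ⟩
    exact (x.s_sub hβ).trans (hlev' x hx)
  let c : Set Ordinal.{0} := {κ | κ ∈ U ∨ LU κ ∨ (lam.ord * ν < κ ∧ κ < lam.ord * ν + lam.ord ∧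
    ∀ η, κ = lam.ord * ν + (η + 1) → η ∈ h) ∨ κ = lam.ord * ν + lam.ord}
  have c_low : ∀ κ ∈ c, κ ≤ lam.ord * ν → κ ∈ U ∨ LU κ := by
    rintro κ (h1 | h1 | h1 | h1) h2
    · exact Or.inl h1
    · exact Or.inr h1
    · exact absurd h1.1 (not_lt.2 h2)
    · exact absurd h2 (not_le.2 (h1 ▸ lt_add_of_pos_right _ h0))
  let t : Nd δc lam :=
    { γ := lam.ord * ν + lam.ord
      s := s
      c := c
      mark := ⟨ν, rfl⟩
      γ_lt := hγ
      s_sub := fun β hβ => (sle β hβ).trans (le_add_of_nonneg_right zero_le)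
      s_cof := by
        rintro β ⟨x, hx, hβ⟩
        exact x.s_cof β hβ
      s_ns := by
        intro γ'
        by_cases hA : ∃ x ∈ b, s ∩ Set.Iio γ' ⊆ Set.Iic x.γ
        · obtain ⟨x, hx, hxs⟩ := hA
          have : s ∩ Set.Iio γ' = x.s ∩ Set.Iio γ' := by
            ext β
            exact ⟨fun hβ => ⟨scoh x hx β (hxs hβ) hβ.1, hβ.2⟩, fun hβ => ⟨⟨x, hx, hβ.1⟩, hβ.2⟩⟩
          rw [this]
          exact x.s_ns γ'
        · push Not at hA
          intro hst
          have bdd : BddAbove (s ∩ Set.Iio γ') := ⟨lam.ord * ν, fun β hβ => sle β hβ.1⟩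
          have key : ∀ β < sSup (s ∩ Set.Iio γ'), ∃ x ∈ b, β < x.γ := by
            intro β hβ
            have hne : (s ∩ Set.Iio γ').Nonempty := by
              by_contra hc
              rw [Set.not_nonempty_iff_eq_empty.1 hc] at hβ
              simp at hβ
            obtain ⟨κ, ⟨⟨x, hx, hκ⟩, -⟩, hβκ⟩ := exists_lt_of_lt_csSup hne hβ
            exact ⟨x, hx, hβκ.trans (x.s_lt hκ)⟩
          have club : IsClubIn U (sSup (s ∩ Set.Iio γ')) := by
            refine ⟨?_, ?_⟩
            · intro β hβ
              obtain ⟨x, hx, hβx⟩ := key β hβ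
              obtain ⟨κ, hκ, hκx⟩ := Set.not_subset.1 (hA x hx)
              exact ⟨x.γ, ⟨x, hx, x.γ_mem⟩, hβx, (not_le.1 hκx).trans_le (le_csSup bdd hκ)⟩
            · intro β hβ hβ0 hβl
              obtain ⟨x, hx, hβx⟩ := key β hβ
              exact ⟨x, hx, lcoh x hx β hβx.le ⟨hβ0, hβl⟩⟩
          obtain ⟨β, hβ, hβU⟩ := hst U club

          exact Us β hβU hβ.1
      c_sub := by
        rintro κ (h1 | h1 | h1 | h1)
        · exact (Ule κ h1).trans (le_add_of_nonneg_right zero_le)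
        · exact (Lle κ h1).trans (le_add_of_nonneg_right zero_le)
        · exact h1.2.1.le
        · exact h1.le
      c_cl := by
        intro β hβ hβ0 hβl
        rcases hβ.eq_or_lt with e | e
        · exact Or.inr (Or.inr (Or.inr e))
        by_cases h1 : lam.ord * ν < β
        · refine Or.inr (Or.inr (Or.inl ⟨h1, e, ?_⟩))
          rintro η rfl
          rw [← add_assoc] at hβl
          obtain ⟨ξ, -, h2, h3⟩ := hβl (lam.ord * ν + η) (lt_add_one _)
          exact absurd (Order.lt_add_one_iff.1 h3) (not_le.2 h2)
        · refine Or.inr (Or.inl ⟨hβ0, ?_⟩)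
          intro γ' hγ'
          obtain ⟨ξ, h2, h3, h4⟩ := hβl γ' hγ'
          rcases c_low ξ h2 (h4.le.trans (not_lt.1 h1)) with h5 | h5
          · exact ⟨ξ, h5, h3, h4⟩
          · obtain ⟨ξ', h6, h7, h8⟩ := h5.2 γ' h3
            exact ⟨ξ', h6, h7, h8.trans h4⟩
      γ_mem := Or.inr (Or.inr (Or.inr rfl))
      disj := by
        intro β hβ hβs
        rcases c_low β hβ (sle β hβs) with h1 | h1
        · exact Us β h1 hβs
        · exact Ls β h1 hβs }
  have t_gt : ∀ x ∈ b, lt x t := by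
    intro x hx
    refine ⟨hlev x hx, (hlev x hx).le, ?_, ?_⟩
    · ext β
      exact ⟨fun hβ => scoh x hx β hβ.2 hβ.1, fun hβ => ⟨⟨x, hx, hβ⟩, x.s_sub hβ⟩⟩
    · ext β
      refine ⟨fun hβ => ?_, fun hβ => ⟨Or.inl ⟨x, hx, hβ⟩, x.c_sub hβ⟩⟩
      rcases c_low β hβ.1 (le_trans hβ.2 (hlev' x hx)) with h1 | h1
      · exact ccoh x hx β hβ.2 h1
      · exact lcoh x hx β hβ.2 h1
  refine ⟨t, rfl, fun y => ⟨fun hy => ?_, t_gt y⟩, ?_⟩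
  · have h1 : y.γ ∈ t.c := (c_iff hy.2 le_rfl).1 y.γ_mem
    have h2 : ∃ x ∈ b, y.γ ≤ x.γ := by
      rcases c_low _ h1 (y.mark.le hy.1) with h3 | h3
      · obtain ⟨x, hx, hxc⟩ := h3
        exact ⟨x, hx, x.c_sub hxc⟩
      · obtain ⟨μ, hμ⟩ := y.mark
        obtain ⟨ξ, ⟨x, hx, hξ⟩, h4, -⟩ := h3.2 (lam.ord * μ) (by
          rw [hμ]; exact lt_add_of_pos_right _ h0)
        refine ⟨x, hx, ?_⟩
        rw [hμ]
        exact x.mark.ge (h4.trans_le (x.c_sub hξ))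
    obtain ⟨x, hx, hyx⟩ := h2
    rcases lin hy (t_gt x hx) with e | e | e
    · exact e ▸ hx
    · exact hdown x hx y e
    · exact absurd e.1 (not_lt.2 hyx)
  · intro η hη
    have hlt : lam.ord * ν < lam.ord * ν + (η + 1) :=
      lt_add_of_pos_right _ (by simp)
    have hlt2 : lam.ord * ν + (η + 1) < lam.ord * ν + lam.ord := by
      apply add_lt_add_right
      rw [← Order.succ_eq_add_one]
      exact hlim.succ_lt hη
    constructor
    · rintro (h1 | h1 | h1 | h1)
      · exact absurd (Ule _ h1) (not_le.2 hlt)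
      · exact absurd (Lle _ h1) (not_le.2 hlt)
      · exact h1.2.2 η rfl
      · exact absurd h1 hlt2.ne
    · intro h1
      refine Or.inr (Or.inr (Or.inl ⟨hlt, hlt2, ?_⟩))
      intro η' e
      have := (add_right_inj _).1 e
      rw [← Order.succ_eq_add_one, ← Order.succ_eq_add_one] at this
      rwa [← Order.succ_injective this]

end Nd

@[ext] structure YT (lam : Cardinal.{0}) : Type 1 where
  γ : Ordinal.{0}
  A : Set Ordinal.{0}
  mark : Mark lam γ
  γ_lt : γ < (Order.succ lam).ord
  A_sub : A ⊆ Set.Iic γ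
  γ_mem : γ ∈ A

namespace YT
variable {lam : Cardinal.{0}}

def le (x y : YT lam) : Prop := x.γ ≤ y.γ ∧ y.A ∩ Set.Iic x.γ = x.A
def lt (x y : YT lam) : Prop := x.γ < y.γ ∧ x.le y

theorem le_refl' (x : YT lam) : x.le x :=
  ⟨le_rfl, Set.inter_eq_left.2 x.A_sub⟩

theorem le_trans' {x y z : YT lam} (h : x.le y) (h' : y.le z) : x.le z := by
  refine ⟨h.1.trans h'.1, ?_⟩
  · rw [← h.2, ← h'.2, Set.inter_assoc, Set.Iic_inter_Iic, min_eq_right h.1]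

theorem eq_of_le {x y : YT lam} (h : x.le y) (h' : y.γ ≤ x.γ) : x = y := by
  have e := le_antisymm h.1 h'
  apply YT.ext e
  · rw [← h.2, e]; exact Set.inter_eq_left.2 y.A_sub

theorem lt_trans' {x y z : YT lam} (h : x.lt y) (h' : y.lt z) : x.lt z :=
  ⟨h.1.trans h'.1, le_trans' h.2 h'.2⟩

theorem le_of_le_le {x y z : YT lam} (h : x.le z) (h' : y.le z) (hxy : x.γ ≤ y.γ) : x.le y := by
  refine ⟨hxy, ?_⟩
  · rw [← h.2, ← h'.2, Set.inter_assoc, Set.Iic_inter_Iic, min_eq_right hxy]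

theorem lin {x y z : YT lam} (h : x.lt z) (h' : y.lt z) : x = y ∨ x.lt y ∨ y.lt x := by
  rcases lt_trichotomy x.γ y.γ with e | e | e
  · exact Or.inr (Or.inl ⟨e, le_of_le_le h.2 h'.2 e.le⟩)
  · exact Or.inl (eq_of_le (le_of_le_le h.2 h'.2 e.le) e.ge)
  · exact Or.inr (Or.inr ⟨e, le_of_le_le h'.2 h.2 e.le⟩)

theorem A_iff {x y : YT lam} (h : x.le y) {β : Ordinal.{0}} (hβ : β ≤ x.γ) :
    β ∈ x.A ↔ β ∈ y.A := by
  rw [← h.2]; exact ⟨fun h => h.1, fun h => ⟨h, hβ⟩⟩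

theorem ext_node (b : Set (YT lam)) (ν : Ordinal.{0}) (hγ : lam.ord * ν + lam.ord < (Order.succ lam).ord)
    (hl : ℵ₀ ≤ lam)
    (hdown : ∀ x ∈ b, ∀ y, lt y x → y ∈ b)
    (hchain : ∀ x ∈ b, ∀ y ∈ b, x = y ∨ lt x y ∨ lt y x)
    (hlev : ∀ x ∈ b, x.γ < lam.ord * ν + lam.ord) (h : Set Ordinal.{0}) :
    ∃ t : YT lam, t.γ = lam.ord * ν + lam.ord ∧ (∀ y, lt y t ↔ y ∈ b) ∧
      ∀ η < lam.ord, (lam.ord * ν + (η + 1) ∈ t.A ↔ η ∈ h) := by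
  have hlev' : ∀ x ∈ b, x.γ ≤ lam.ord * ν := fun x hx => x.mark.le (hlev x hx)
  have hlim : Order.IsSuccLimit lam.ord := Cardinal.isSuccLimit_ord hl
  have h0 : 0 < lam.ord := by
    rw [Cardinal.lt_ord]; simpa using (Cardinal.aleph0_pos.trans_le hl)
  have hle : ∀ x ∈ b, ∀ y ∈ b, x.le y ∨ y.le x := by
    intro x hx y hy
    rcases hchain x hx y hy with e | e | e
    · exact Or.inl (e ▸ le_refl' x)
    · exact Or.inl e.2
    · exact Or.inr e.2
  let U : Set Ordinal.{0} := {β | ∃ x ∈ b, β ∈ x.A}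
  have ccoh : ∀ x ∈ b, ∀ β ≤ x.γ, β ∈ U → β ∈ x.A := by
    rintro x hx β hβ ⟨y, hy, hβy⟩
    rcases hle x hx y hy with e | e
    · exact (A_iff e hβ).2 hβy
    · exact (A_iff e (y.A_sub hβy)).1 hβy
  have Ule : ∀ β ∈ U, β ≤ lam.ord * ν := by
    rintro β ⟨x, hx, hβ⟩
    exact le_trans (x.A_sub hβ) (hlev' x hx)
  let c : Set Ordinal.{0} := {κ | κ ∈ U ∨ (lam.ord * ν < κ ∧ κ < lam.ord * ν + lam.ord ∧
    ∀ η, κ = lam.ord * ν + (η + 1) → η ∈ h) ∨ κ = lam.ord * ν + lam.ord}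
  have c_low : ∀ κ ∈ c, κ ≤ lam.ord * ν → κ ∈ U := by
    rintro κ (h1 | h1 | h1) h2
    · exact h1
    · exact absurd h1.1 (not_lt.2 h2)
    · exact absurd h2 (not_le.2 (h1 ▸ lt_add_of_pos_right _ h0))
  let t : YT lam :=
    { γ := lam.ord * ν + lam.ord
      A := c
      mark := ⟨ν, rfl⟩
      γ_lt := hγ
      A_sub := by
        rintro κ (h1 | h1 | h1)
        · exact (Ule κ h1).trans (le_add_of_nonneg_right zero_le)
        · exact h1.2.1.le
        · exact h1.le
      γ_mem := Or.inr (Or.inr rfl) }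
  have t_gt : ∀ x ∈ b, lt x t := by
    intro x hx
    refine ⟨hlev x hx, (hlev x hx).le, ?_⟩
    · ext β
      refine ⟨fun hβ => ?_, fun hβ => ⟨Or.inl ⟨x, hx, hβ⟩, x.A_sub hβ⟩⟩
      exact ccoh x hx β hβ.2 (c_low β hβ.1 (le_trans hβ.2 (hlev' x hx)))
  refine ⟨t, rfl, fun y => ⟨fun hy => ?_, t_gt y⟩, ?_⟩
  · have h1 : y.γ ∈ t.A := (A_iff hy.2 le_rfl).1 y.γ_mem
    obtain ⟨x, hx, hxc⟩ := c_low _ h1 (y.mark.le hy.1)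
    have hyx : y.γ ≤ x.γ := x.A_sub hxc
    rcases lin hy (t_gt x hx) with e | e | e
    · exact e ▸ hx
    · exact hdown x hx y e
    · exact absurd e.1 (not_lt.2 hyx)
  · intro η hη
    have hlt : lam.ord * ν < lam.ord * ν + (η + 1) :=
      lt_add_of_pos_right _ (by simp)
    have hlt2 : lam.ord * ν + (η + 1) < lam.ord * ν + lam.ord := by
      apply add_lt_add_right
      rw [← Order.succ_eq_add_one]
      exact hlim.succ_lt hη
    constructor
    · rintro (h1 | h1 | h1)
      · exact absurd (Ule _ h1) (not_le.2 hlt)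
      · exact h1.2.2 η rfl
      · exact absurd h1 hlt2.ne
    · intro h1
      refine Or.inr (Or.inl ⟨hlt, hlt2, ?_⟩)
      intro η' e
      have := (add_right_inj _).1 e
      rw [← Order.succ_eq_add_one, ← Order.succ_eq_add_one] at this
      rwa [← Order.succ_injective this]

end YT

theorem pow_bound {lam : Cardinal.{0}} (hl : ℵ₀ ≤ lam) {γ : Ordinal.{0}}
    (h : γ < (Order.succ lam).ord) : #(𝒫 (Set.Iic γ)) ≤ #(𝒫 (Set.Iio lam.ord)) := by
  rw [Cardinal.mk_powerset, Cardinal.mk_powerset, Cardinal.mk_Iio_ordinal, Cardinal.card_ord]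
  exact Cardinal.power_le_power_left two_ne_zero (mk_Iic_le hl h)

theorem node_iso (δc lam : Cardinal.{0}) (hl : ℵ₀ ≤ lam) :
    ∃ G : Nd δc lam ≃ YT lam, (∀ x, (G x).γ = x.γ) ∧ ∀ a b, a.le b ↔ (G a).le (G b) := by
  classical
  let L := {γ : Ordinal.{0} // Mark lam γ ∧ γ < (Order.succ lam).ord}
  let ltL : L → L → Prop := fun a b => a.1 < b.1
  have wfL : WellFounded ltL := InvImage.wf (fun x : L => x.1) Ordinal.lt_wf
  have inf2 : ℵ₀ ≤ #(𝒫 (Set.Iio lam.ord)) := by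
    rw [Cardinal.mk_powerset, Cardinal.mk_Iio_ordinal, Cardinal.card_ord]
    exact (Cardinal.aleph0_le_lift.2 hl).trans (Cardinal.cantor _).le
  obtain ⟨G, hG1, hG2⟩ := tree_iso (X := Nd δc lam) (Y := YT lam) (L := L) (K := Set Ordinal.{0})
    Nd.lt YT.lt ltL wfL (fun x => ⟨x.γ, x.mark, x.γ_lt⟩) (fun x => ⟨x.γ, x.mark, x.γ_lt⟩)
    (fun _ _ h => h.1) (fun _ _ _ h h' => Nd.lt_trans' h h') (fun _ _ _ h h' => Nd.lin h h')
    (fun _ _ h => h.1) (fun _ _ _ h h' => YT.lt_trans' h h') (fun _ _ _ h h' => YT.lin h h')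
    (fun _ => 𝒫 (Set.Iio lam.ord))
    (by
      rintro b ⟨l, ⟨ν, rfl⟩, hl2⟩ h1 h2 h3
      refine Cardinal.eq.1 (le_antisymm ?_ ?_)
      · have : #{x : Nd δc lam // (⟨x.γ, x.mark, x.γ_lt⟩ : L) =
            ⟨lam.ord * ν + lam.ord, ⟨ν, rfl⟩, hl2⟩ ∧ ∀ y, y.lt x ↔ y ∈ b} ≤
            #(𝒫 (Set.Iic (lam.ord * ν + lam.ord)) × 𝒫 (Set.Iic (lam.ord * ν + lam.ord))) := by
          refine Cardinal.mk_le_of_injective (f := fun x =>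
            ⟨⟨x.1.s, ?_⟩, ⟨x.1.c, ?_⟩⟩) ?_
          · have := congrArg Subtype.val x.2.1
            exact fun β hβ => le_trans (x.1.s_sub hβ) (le_of_eq this)
          · have := congrArg Subtype.val x.2.1
            exact fun β hβ => le_trans (x.1.c_sub hβ) (le_of_eq this)
          · rintro ⟨x, hx, hx2⟩ ⟨y, hy, hy2⟩ e
            have hxy := congrArg Subtype.val (hx.trans hy.symm)
            have e1 : x.s = y.s := congrArg (fun p => p.1.1) e
            have e2 : x.c = y.c := congrArg (fun p => p.2.1) e
            exact Subtype.ext (Nd.ext hxy e1 e2)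
        refine this.trans ?_
        rw [Cardinal.mk_prod, Cardinal.lift_id, ]
        exact Cardinal.mul_le_of_le inf2 (pow_bound hl hl2) (pow_bound hl hl2)
      · have ex := fun h => Nd.ext_node b ν hl2 hl h1 h2 h3 h
        choose T hT1 hT2 hT3 using ex
        refine Cardinal.mk_le_of_injective (f := fun h : 𝒫 (Set.Iio lam.ord) =>
          ⟨T h.1, Subtype.ext (hT1 _), hT2 _⟩) ?_
        rintro ⟨h, hh⟩ ⟨h', hh'⟩ e
        apply Subtype.ext
        have e : T h = T h' := congrArg Subtype.val e
        ext ζ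
        by_cases hζ : ζ < lam.ord
        · rw [← hT3 h ζ hζ, ← hT3 h' ζ hζ, e]
        · exact ⟨fun hm => absurd (hh hm) hζ, fun hm => absurd (hh' hm) hζ⟩)
    (by
      rintro b ⟨l, ⟨ν, rfl⟩, hl2⟩ h1 h2 h3
      refine Cardinal.eq.1 (le_antisymm ?_ ?_)
      · refine le_trans ?_ (pow_bound hl hl2)
        refine Cardinal.mk_le_of_injective (f := fun x => ⟨x.1.A, ?_⟩) ?_
        · have := congrArg Subtype.val x.2.1
          exact fun β hβ => le_trans (x.1.A_sub hβ) (le_of_eq this)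
        · rintro ⟨x, hx, hx2⟩ ⟨y, hy, hy2⟩ e
          have hxy := congrArg Subtype.val (hx.trans hy.symm)
          have e1 : x.A = y.A := congrArg Subtype.val e
          exact Subtype.ext (YT.ext hxy e1)
      · have ex := fun h => YT.ext_node b ν hl2 hl h1 h2 h3 h
        choose T hT1 hT2 hT3 using ex
        refine Cardinal.mk_le_of_injective (f := fun h : 𝒫 (Set.Iio lam.ord) =>
          ⟨T h.1, Subtype.ext (hT1 _), hT2 _⟩) ?_
        rintro ⟨h, hh⟩ ⟨h', hh'⟩ e
        apply Subtype.ext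
        have e : T h = T h' := congrArg Subtype.val e
        ext ζ
        by_cases hζ : ζ < lam.ord
        · rw [← hT3 h ζ hζ, ← hT3 h' ζ hζ, e]
        · exact ⟨fun hm => absurd (hh hm) hζ, fun hm => absurd (hh' hm) hζ⟩)
  have hG1' : ∀ x, (G x).γ = x.γ := fun x => congrArg Subtype.val (hG1 x)
  refine ⟨G, hG1', ?_⟩
  intro a b
  constructor
  · intro h
    rcases h.1.eq_or_lt with e | e
    · rw [Nd.eq_of_le h e.ge]; exact YT.le_refl' _
    · exact ((hG2 a b).1 ⟨e, h⟩).2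
  · intro h
    have h1 := h.1
    rw [hG1', hG1'] at h1
    rcases h1.eq_or_lt with e | e
    · rw [G.injective (YT.eq_of_le h (by rw [hG1', hG1']; exact e.ge))]; exact Nd.le_refl' _
    · exact ((hG2 a b).2 ⟨by rw [hG1', hG1']; exact e, h⟩).2

theorem cof_le_of_cofinal {σ : Ordinal.{0}} (E : Set Ordinal.{0}) (hE : ∀ e ∈ E, e < σ)
    (hcof : ∀ γ < σ, ∃ e ∈ E, γ ≤ e) : Cardinal.lift.{1} σ.cof ≤ #E := by
  by_contra hc
  rw [not_le, Ordinal.lift_cof] at hc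
  have := Ordinal.sSup_add_one_lt_of_lt_cof hc hE
  obtain ⟨e, he, h⟩ := hcof _ this
  have bdd : BddAbove ((· + 1) '' E) := ⟨σ, by
    rintro _ ⟨x, hx, rfl⟩
    exact Order.add_one_le_of_lt (hE x hx)⟩
  have h2 : e + 1 ≤ sSup ((· + 1) '' E) := le_csSup bdd ⟨e, he, rfl⟩
  exact absurd (h2.trans h) (not_le.2 (lt_add_one e))

theorem small_bdd {lam : Cardinal.{0}} (hlam : lam.IsRegular) (w : Set Ordinal.{0})
    (hw : #w < Cardinal.lift.{1} lam) (g : Ordinal.{0} → Ordinal.{0})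
    (hg : ∀ i ∈ w, g i < lam.ord) : ∃ η < lam.ord, ∀ i ∈ w, g i < η := by
  have h1 : #(g '' w) < (Ordinal.lift.{1} lam.ord).cof := by
    rw [← Ordinal.lift_cof, hlam.cof_ord]
    exact Cardinal.mk_image_le.trans_lt hw
  have h2 : ∀ i ∈ g '' w, i < lam.ord := by
    rintro _ ⟨i, hi, rfl⟩; exact hg i hi
  refine ⟨_, Ordinal.sSup_add_one_lt_of_lt_cof h1 h2, ?_⟩
  intro i hi
  have bdd : BddAbove ((· + 1) '' (g '' w)) := ⟨lam.ord, by
    rintro _ ⟨x, hx, rfl⟩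
    exact Order.add_one_le_of_lt (h2 x hx)⟩
  exact (lt_add_one _).trans_le (le_csSup bdd ⟨g i, ⟨i, hi, rfl⟩, rfl⟩)

theorem le_mk_diff_singleton {α : Type 1} {A : Set α} (p : α) {κ : Cardinal.{1}} (hκ : ℵ₀ ≤ κ)
    (h : κ ≤ #A) : κ ≤ #(A \ {p} : Set α) := by
  by_contra hc
  rw [not_le] at hc
  have h1 : #A ≤ #((A \ {p} : Set α) ∪ {p} : Set α) := by
    apply Cardinal.mk_le_mk_of_subset
    intro x hx
    by_cases hxp : x = p
    · exact Or.inr hxp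
    · exact Or.inl ⟨hx, hxp⟩
  have h2 := (h.trans h1).trans (Cardinal.mk_union_le _ _)
  rw [Cardinal.mk_singleton] at h2
  exact absurd h2 (not_le.2 (Cardinal.add_lt_of_lt hκ hc (Cardinal.one_lt_aleph0.trans_le hκ)))

theorem exists_split {α : Type 1} (E : Set α) (hE : ℵ₀ ≤ #E) :
    ∃ v : α → Bool, ∀ b : Bool, #E ≤ #({e | e ∈ E ∧ v e = b} : Set α) := by
  classical
  have h1 : #(E ⊕ E) = #E := by
    rw [Cardinal.mk_sum, Cardinal.lift_id, Cardinal.add_eq_self hE]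
  obtain ⟨φ⟩ := Cardinal.eq.1 h1
  refine ⟨fun e => decide (∃ x, (φ (Sum.inr x) : α) = e), ?_⟩
  rintro (_ | _)
  · refine Cardinal.mk_le_of_injective (f := fun x => ⟨(φ (Sum.inl x) : α), (φ (Sum.inl x)).2, ?_⟩) ?_
    · rw [decide_eq_false_iff_not]
      rintro ⟨y, hy⟩
      have := φ.injective (Subtype.ext hy)
      exact absurd this (by simp)
    · intro x y h
      have h2 := (Subtype.mk.injEq _ _ _ _).mp h
      exact Sum.inl_injective (φ.injective (Subtype.ext h2))
  · refine Cardinal.mk_le_of_injective (f := fun x => ⟨(φ (Sum.inr x) : α), (φ (Sum.inr x)).2, ?_⟩) ?_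
    · rw [decide_eq_true_iff]
      exact ⟨x, rfl⟩
    · intro x y h
      have h2 := (Subtype.mk.injEq _ _ _ _).mp h
      exact Sum.inr_injective (φ.injective (Subtype.ext h2))

theorem splitting {δc : Cardinal.{0}} (hδ : δc.IsRegular) (s : Set Ordinal.{0})
    (s_cof : ∀ β ∈ s, β.cof = δc)
    (s_ns : ∀ γ', ¬ StationaryIn (s ∩ Set.Iio γ') (sSup (s ∩ Set.Iio γ')))
    (xs : Ordinal.{0} → Set Ordinal.{0})
    (hx : ∀ β ∈ s, xs β ⊆ Set.Iio β ∧ ∀ γ < β, ∃ ξ ∈ xs β, γ ≤ ξ) :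
    ∀ γ α : Ordinal.{0}, ∃ f : Ordinal.{0} → Bool, ∀ β ∈ s, α < β → β < γ → ∀ b : Bool,
      Cardinal.lift.{1} δc ≤ #({i | i ∈ xs β ∧ α ≤ i ∧ f i = b} : Set Ordinal.{0}) := by
  classical
  have hδ' : ℵ₀ ≤ Cardinal.lift.{1} δc := Cardinal.aleph0_le_lift.2 hδ.aleph0_le
  intro γ
  induction γ using Ordinal.lt_wf.induction with
  | _ γ IH =>
  intro α
  have hC := s_ns γ
  set σ := sSup (s ∩ Set.Iio γ) with hσ
  have bdd : BddAbove (s ∩ Set.Iio γ) := ⟨γ, fun β hβ => le_of_lt hβ.2⟩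
  have hσγ : σ ≤ γ := csSup_le' (fun β hβ => le_of_lt hβ.2)
  have hle : ∀ β ∈ s, β < γ → β ≤ σ := fun β h1 h2 => le_csSup bdd ⟨h1, h2⟩
  unfold StationaryIn at hC
  push Not at hC
  obtain ⟨C, ⟨hC1, hC2⟩, hC3⟩ := hC
  have hC3' : ∀ β ∈ s, β < γ → β ∉ C := by
    intro β h1 h2 h3
    have : β ∈ s ∩ Set.Iio γ ∩ C := ⟨⟨h1, h2⟩, h3⟩
    rw [hC3] at this
    exact this
  by_cases hασ : α < σ
  swap
  · exact ⟨fun _ => true, fun β h1 h2 h3 => absurd (h2.trans_le (hle β h1 h3)) hασ⟩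
  let C' : Set Ordinal.{0} := {c | c ∈ C ∧ α < c ∧ c < σ}
  let cp : Ordinal.{0} → Ordinal.{0} := fun i => sInf {c | c ∈ C' ∧ i < c}
  have cp_ne : ∀ i < σ, ({c | c ∈ C' ∧ i < c} : Set Ordinal.{0}).Nonempty := by
    intro i hi
    obtain ⟨c, h1, h2, h3⟩ := hC1 (max i α) (max_lt hi hασ)
    exact ⟨c, ⟨h1, (le_max_right _ _).trans_lt h2, h3⟩, (le_max_left _ _).trans_lt h2⟩
  have cp_mem : ∀ i < σ, cp i ∈ C' ∧ i < cp i := fun i hi => csInf_mem (cp_ne i hi)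
  have cp_le : ∀ i, ∀ c ∈ C', i < c → cp i ≤ c := fun i c h1 h2 => csInf_le' ⟨h1, h2⟩
  let lo : Ordinal.{0} → Ordinal.{0} := fun e => sInf {i | α ≤ i ∧ ∀ c ∈ C', c < e → c ≤ i}
  have hf : ∀ e : Ordinal.{0}, ∃ f : Ordinal.{0} → Bool, e < γ → ∀ β ∈ s, lo e < β → β < e →
      ∀ b : Bool, Cardinal.lift.{1} δc ≤ #({i | i ∈ xs β ∧ lo e ≤ i ∧ f i = b} : Set Ordinal.{0}) := by
    intro e
    by_cases he : e < γ
    · obtain ⟨f, hf⟩ := IH e he (lo e)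
      exact ⟨f, fun _ => hf⟩
    · exact ⟨fun _ => true, fun h => absurd h he⟩
  choose f hf using hf
  let F : (Ordinal.{0} → Ordinal.{0}) → (Ordinal.{0} → Bool) → Ordinal.{0} → Bool := fun y v i =>
    if i = y (cp i) then v (cp i) else f (cp i) i
  have main : ∀ y v, ∀ β ∈ s, α < β → β < σ → ∀ b : Bool,
      Cardinal.lift.{1} δc ≤ #({i | i ∈ xs β ∧ α ≤ i ∧ F y v i = b} : Set Ordinal.{0}) := by
    intro y v β hβ hαβ hβσ b
    obtain ⟨he, hβe⟩ := cp_mem β hβσ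
    set e := cp β with hedef
    have heγ : e < γ := he.2.2.trans_le hσγ
    have hβlo : α ≤ β ∧ ∀ c ∈ C', c < e → c ≤ β := by
      refine ⟨hαβ.le, fun c h1 h2 => ?_⟩
      by_contra h3
      exact absurd (cp_le β c h1 (not_le.1 h3)) (not_le.2 h2)
    have hlo : α ≤ lo e ∧ ∀ c ∈ C', c < e → c ≤ lo e :=
      csInf_mem (s := {i | α ≤ i ∧ ∀ c ∈ C', c < e → c ≤ i}) ⟨β, hβlo⟩
    have hloβ : lo e < β := by
      refine lt_of_le_of_ne (csInf_le' hβlo) ?_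
      intro heq
      apply hC3' β hβ (hβσ.trans_le hσγ)
      refine hC2 β hβσ (pos_of_gt hαβ) ?_
      intro γ' hγ'
      have hnm : ¬ (α ≤ max γ' α ∧ ∀ c ∈ C', c < e → c ≤ max γ' α) := by
        intro hm
        have : lo e ≤ max γ' α := csInf_le' hm
        rw [heq] at this
        exact absurd (max_lt hγ' hαβ) (not_lt.2 this)
      push Not at hnm
      obtain ⟨c, h1, h2, h3⟩ := hnm (le_max_right _ _)
      refine ⟨c, h1.1, (le_max_left _ _).trans_lt h3, lt_of_le_of_ne (hβlo.2 c h1 h2) ?_⟩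
      rintro rfl
      exact hC3' _ hβ (hβσ.trans_le hσγ) h1.1
    have h1 := hf e heγ β hβ hloβ hβe b
    have h2 := le_mk_diff_singleton (y e) hδ' h1
    refine h2.trans (Cardinal.mk_le_mk_of_subset ?_)
    rintro i ⟨⟨hi1, hi2, hi3⟩, hi4⟩
    have hiβ : i < β := (hx β hβ).1 hi1
    have hcpi : cp i = e := by
      apply le_antisymm (cp_le i e he (hiβ.trans hβe))
      by_contra hc
      obtain ⟨h5, h6⟩ := cp_mem i (hiβ.trans hβσ)
      exact absurd ((hlo.2 _ h5 (not_le.1 hc)).trans hi2) (not_le.2 h6)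
    refine ⟨hi1, hlo.1.trans hi2, ?_⟩
    simp only [F]
    have hne : ¬ i = y e := fun h => hi4 h
    rw [hcpi, if_neg hne, hi3]
  by_cases hσs : σ ∈ s ∧ σ < γ
  swap
  · refine ⟨F (fun _ => 0) (fun _ => true), fun β hβ h1 h2 => main (fun _ => 0) (fun _ => true) β hβ h1 ?_⟩
    refine lt_of_le_of_ne (hle β hβ h2) ?_
    rintro rfl
    exact hσs ⟨hβ, h2⟩
  let E : Set Ordinal.{0} := {e | ∃ i ∈ xs σ, α ≤ i ∧ cp i = e}
  have hE1 : ∀ e ∈ E, e < σ := by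
    rintro _ ⟨i, hi, -, rfl⟩
    exact (cp_mem i ((hx σ hσs.1).1 hi)).1.2.2
  have hE2 : ∀ γ' < σ, ∃ e ∈ E, γ' ≤ e := by
    intro γ' hγ'
    obtain ⟨i, hi, h1⟩ := (hx σ hσs.1).2 (max γ' α) (max_lt hγ' hασ)
    exact ⟨cp i, ⟨i, hi, (le_max_right _ _).trans h1, rfl⟩,
      ((le_max_left _ _).trans h1).trans (cp_mem i ((hx σ hσs.1).1 hi)).2.le⟩
  have hE3 := cof_le_of_cofinal E hE1 hE2
  rw [s_cof σ hσs.1] at hE3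
  obtain ⟨v, hv⟩ := exists_split E (hδ'.trans hE3)
  have hy : ∀ e, ∃ i, e ∈ E → i ∈ xs σ ∧ α ≤ i ∧ cp i = e := by
    intro e
    by_cases he : e ∈ E
    · obtain ⟨i, h⟩ := he
      exact ⟨i, fun _ => h⟩
    · exact ⟨0, fun h => absurd h he⟩
  choose y hy using hy
  refine ⟨F y v, fun β hβ h1 h2 b => ?_⟩
  rcases (hle β hβ h2).eq_or_lt with h3 | h3
  swap
  · exact main y v β hβ h1 h3 b
  subst h3
  refine (hE3.trans (hv b)).trans ?_
  refine Cardinal.mk_le_of_injective (f := fun e => ⟨y e.1, (hy e.1 e.2.1).1, (hy e.1 e.2.1).2.1, ?_⟩) ?_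
  · simp only [F]
    rw [(hy e.1 e.2.1).2.2, if_pos rfl]
    exact e.2.2
  · rintro ⟨e, he⟩ ⟨e', he'⟩ h
    have h : y e = y e' := by
        simpa using h
    apply Subtype.ext
    show e = e'
    rw [← (hy e he.1).2.2, ← (hy e' he'.1).2.2, h]

namespace Nd
variable {δc lam : Cardinal.{0}}

noncomputable def nxt (n : Nd δc lam) (i : Ordinal.{0}) : Ordinal.{0} :=
  sInf {m | Mark lam m ∧ m ∈ n.c ∧ i < m}

theorem nxt_spec (n : Nd δc lam) {i : Ordinal.{0}} (h : i < n.γ) :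
    Mark lam (n.nxt i) ∧ n.nxt i ∈ n.c ∧ i < n.nxt i :=
  csInf_mem (s := {m | Mark lam m ∧ m ∈ n.c ∧ i < m}) ⟨n.γ, n.mark, n.γ_mem, h⟩

theorem nxt_le (n : Nd δc lam) {i m : Ordinal.{0}} (h1 : Mark lam m) (h2 : m ∈ n.c) (h3 : i < m) :
    n.nxt i ≤ m := csInf_le' ⟨h1, h2, h3⟩

theorem nxt_le_γ (n : Nd δc lam) {i : Ordinal.{0}} (h : i < n.γ) : n.nxt i ≤ n.γ :=
  n.nxt_le n.mark n.γ_mem h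

theorem nxt_mono (n : Nd δc lam) {i j : Ordinal.{0}} (h : i ≤ j) (hj : j < n.γ) :
    n.nxt i ≤ n.nxt j := by
  obtain ⟨h1, h2, h3⟩ := n.nxt_spec hj
  exact n.nxt_le h1 h2 (h.trans_lt h3)

theorem lt_of_nxt_lt (n : Nd δc lam) {i j : Ordinal.{0}} (hi : i < n.γ)
    (h : n.nxt i < n.nxt j) : i < j := by
  by_contra hc
  exact absurd (n.nxt_mono (not_lt.1 hc) hi) (not_le.2 h)

def restr (f : Nd δc lam) (m : Ordinal.{0}) (hm : Mark lam m) (hc : m ∈ f.c) : Nd δc lam where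
  γ := m
  s := f.s ∩ Set.Iic m
  c := f.c ∩ Set.Iic m
  mark := hm
  γ_lt := lt_of_le_of_lt (f.c_sub hc) f.γ_lt
  s_sub := Set.inter_subset_right
  s_cof := fun β hβ => f.s_cof β hβ.1
  s_ns := by
    intro γ'
    have : f.s ∩ Set.Iic m ∩ Set.Iio γ' = f.s ∩ Set.Iio (min γ' (m + 1)) := by
      ext x
      simp only [Set.mem_inter_iff, Set.mem_Iic, Set.mem_Iio, lt_min_iff, Order.lt_add_one_iff]
      tauto
    rw [this]
    exact f.s_ns _
  c_sub := Set.inter_subset_right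
  c_cl := by
    intro β hβ h0 h
    refine ⟨f.c_cl β (hβ.trans (f.c_sub hc)) h0 fun γ' hγ' => ?_, hβ⟩
    obtain ⟨ξ, h1, h2, h3⟩ := h γ' hγ'
    exact ⟨ξ, h1.1, h2, h3⟩
  γ_mem := ⟨hc, Set.mem_Iic.2 le_rfl⟩
  disj := fun β hβ h => f.disj β hβ.1 h.1

theorem restr_le (f : Nd δc lam) (m : Ordinal.{0}) (hm : Mark lam m) (hc : m ∈ f.c) :
    (f.restr m hm hc).le f := ⟨f.c_sub hc, rfl, rfl⟩

open Classical in
noncomputable def nd (f : Nd δc lam) (i : Ordinal.{0}) : Nd δc lam :=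
  if h : i < f.γ then f.restr (f.nxt i) (f.nxt_spec h).1 (f.nxt_spec h).2.1 else f

theorem nd_le (f : Nd δc lam) (i : Ordinal.{0}) : (f.nd i).le f := by
  unfold nd
  split_ifs with h
  · exact restr_le _ _ _ _
  · exact le_refl' f

theorem nd_γ (f : Nd δc lam) {i : Ordinal.{0}} (h : i < f.γ) : (f.nd i).γ = f.nxt i := by
  unfold nd
  rw [dif_pos h]; rfl

theorem nd_eq (f n : Nd δc lam) (hn : n.le f) {i : Ordinal.{0}} (h : i < f.γ)
    (e : n.γ = f.nxt i) : f.nd i = n := by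
  have h1 := f.nd_γ h
  exact eq_of_le (le_of_le_le (f.nd_le i) hn (by rw [h1, e])) (by rw [h1, e])

theorem nxt_of_le {f n : Nd δc lam} (hn : n.le f) {i : Ordinal.{0}} (h : i < n.γ) :
    f.nxt i = n.nxt i := by
  obtain ⟨h1, h2, h3⟩ := n.nxt_spec h
  obtain ⟨h1', h2', h3'⟩ := f.nxt_spec (h.trans_le hn.1)
  have h5 : f.nxt i ≤ n.nxt i := f.nxt_le h1 ((c_iff hn (n.c_sub h2)).1 h2) h3
  refine le_antisymm h5 (n.nxt_le h1' ?_ h3')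
  exact (c_iff hn (h5.trans (n.c_sub h2))).2 h2'

theorem nd_of_le {f n : Nd δc lam} (hn : n.le f) {i : Ordinal.{0}} (h : i < n.γ) :
    f.nd i = n.nd i := by
  apply nd_eq
  · exact le_trans' (n.nd_le i) hn
  · exact h.trans_le hn.1
  · rw [n.nd_γ h, nxt_of_le hn h]

def Bk (n : Nd δc lam) : Set Ordinal.{0} := {i | i < n.γ ∧ n.nxt i = n.γ}

theorem nd_self (n : Nd δc lam) {i : Ordinal.{0}} (h : i ∈ n.Bk) : n.nd i = n :=
  nd_eq _ _ (le_refl' n) h.1 h.2.symm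

theorem mem_Bk_nd (f : Nd δc lam) {i j : Ordinal.{0}} (hi : i < f.γ) :
    j ∈ (f.nd i).Bk ↔ j < f.γ ∧ f.nxt j = f.nxt i := by
  have hle := f.nd_le i
  have hg := f.nd_γ hi
  constructor
  · rintro ⟨h1, h2⟩
    refine ⟨h1.trans_le hle.1, ?_⟩
    rw [nxt_of_le hle h1, h2, hg]
  · rintro ⟨h1, h2⟩
    have h3 : j < (f.nd i).γ := by
      rw [hg, ← h2]; exact (f.nxt_spec h1).2.2
    refine ⟨h3, ?_⟩
    rw [← nxt_of_le hle h3, h2, hg]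

theorem self_mem_Bk (f : Nd δc lam) {i : Ordinal.{0}} (hi : i < f.γ) : i ∈ (f.nd i).Bk :=
  (f.mem_Bk_nd hi).2 ⟨hi, rfl⟩

theorem nd_congr (f : Nd δc lam) {i j : Ordinal.{0}} (hi : i < f.γ) (hj : j < f.γ)
    (h : f.nxt j = f.nxt i) : f.nd j = f.nd i :=
  nd_eq _ _ (f.nd_le i) hj (by rw [f.nd_γ hi, h])

theorem mk_Bk (hl : ℵ₀ ≤ lam) (n : Nd δc lam) : #n.Bk = Cardinal.lift.{1} lam := by
  apply le_antisymm
  · refine (Cardinal.mk_le_mk_of_subset ?_).trans (mk_Iic_le hl n.γ_lt)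
    intro i hi
    exact hi.1.le
  · obtain ⟨ν, hν⟩ := n.mark
    have hlim : Order.IsSuccLimit lam.ord := Cardinal.isSuccLimit_ord hl
    have e : Cardinal.lift.{1} lam = #(Set.Iio lam.ord) := by
      rw [Cardinal.mk_Iio_ordinal, Cardinal.card_ord]
    rw [e]
    refine Cardinal.mk_le_of_injective
      (f := fun x => (⟨lam.ord * ν + x.1, ?_, ?_⟩ : n.Bk)) ?_
    · rw [hν]; exact add_lt_add_right x.2 _
    · have hlt : lam.ord * ν + x.1 < n.γ := by rw [hν]; exact add_lt_add_right x.2 _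
      apply le_antisymm (n.nxt_le_γ hlt)
      obtain ⟨h1, h2, h3⟩ := n.nxt_spec hlt
      rw [hν]
      exact h1.ge (lt_of_le_of_lt (le_add_of_nonneg_right zero_le) h3)
    · intro x y h
      have h2 := (Subtype.mk.injEq _ _ _ _).mp h
      exact Subtype.ext (add_left_cancel h2)

theorem exists_rho (hl : ℵ₀ ≤ lam) (n : Nd δc lam) :
    ∃ ρ : Ordinal.{0} → Ordinal.{0}, Set.BijOn ρ n.Bk (Set.Iio lam.ord) := by
  classical
  have e : #n.Bk = #(Set.Iio lam.ord) := by
    rw [mk_Bk hl, Cardinal.mk_Iio_ordinal, Cardinal.card_ord]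
  obtain ⟨φ⟩ := Cardinal.eq.1 e
  refine ⟨fun i => if h : i ∈ n.Bk then (φ ⟨i, h⟩).1 else 0, ?_, ?_, ?_⟩
  · intro i hi
    simp only [dif_pos hi]
    exact (φ ⟨i, hi⟩).2
  · intro i hi j hj h
    simp only [dif_pos hi, dif_pos hj] at h
    have := φ.injective (Subtype.ext h)
    exact congrArg Subtype.val this
  · intro x hx
    refine ⟨(φ.symm ⟨x, hx⟩).1, (φ.symm ⟨x, hx⟩).2, ?_⟩
    simp

open Classical in
noncomputable def rho0 (n : Nd δc lam) : Ordinal.{0} → Ordinal.{0} :=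
  if h : ℵ₀ ≤ lam then (exists_rho h n).choose else fun _ => 0

theorem rho0_bij (hl : ℵ₀ ≤ lam) (n : Nd δc lam) : Set.BijOn n.rho0 n.Bk (Set.Iio lam.ord) := by
  unfold rho0
  rw [dif_pos hl]
  exact (exists_rho hl n).choose_spec

noncomputable def R (f : Nd δc lam) (i : Ordinal.{0}) : Ordinal.{0} := (f.nd i).rho0 i

theorem R_lt (hl : ℵ₀ ≤ lam) (f : Nd δc lam) {i : Ordinal.{0}} (h : i < f.γ) : f.R i < lam.ord :=
  (rho0_bij hl (f.nd i)).mapsTo (f.self_mem_Bk h)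

theorem R_of_le {f n : Nd δc lam} (hn : n.le f) {i : Ordinal.{0}} (h : i < n.γ) :
    f.R i = n.R i := by
  unfold R
  rw [nd_of_le hn h]

theorem R_self (n : Nd δc lam) {i : Ordinal.{0}} (h : i ∈ n.Bk) : n.R i = n.rho0 i := by
  unfold R
  rw [nd_self n h]

/-- The lower boundary of the top block. -/
theorem exists_low (n : Nd δc lam) : ∃ α, (∀ i, α ≤ i → i < n.γ → i ∈ n.Bk) ∧
    ∀ β ∈ n.s, β ∈ n.Bk → α < β := by
  let T : Set Ordinal.{0} := {m | Mark lam m ∧ m ∈ n.c ∧ m < n.γ}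
  have bdd : BddAbove T := ⟨n.γ, fun m hm => hm.2.2.le⟩
  have hαγ : sSup T ≤ n.γ := csSup_le' (fun m hm => hm.2.2.le)
  refine ⟨sSup T, ?_, ?_⟩
  · intro i h1 h2
    refine ⟨h2, ?_⟩
    obtain ⟨h3, h4, h5⟩ := n.nxt_spec h2
    by_contra hc
    have : n.nxt i ∈ T := ⟨h3, h4, lt_of_le_of_ne (n.nxt_le_γ h2) hc⟩
    exact absurd ((le_csSup bdd this).trans h1) (not_le.2 h5)
  · rintro β hβs ⟨hβ1, hβ2⟩
    have hle : sSup T ≤ β := by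
      apply csSup_le'
      intro m hm
      by_contra hc
      have := n.nxt_le hm.1 hm.2.1 (not_le.1 hc)
      rw [hβ2] at this
      exact absurd hm.2.2 (not_lt.2 this)
    refine lt_of_le_of_ne hle ?_
    intro e
    have hβ0 : 0 < β := pos_of_gt (n.s_cof β hβs).2
    refine n.disj β ?_ hβs
    by_cases hmem : β ∈ T
    · exact hmem.2.1
    apply n.c_cl β hβ1.le hβ0
    intro γ' hγ'
    rw [← e] at hγ'
    obtain ⟨m, hm, hm2⟩ := exists_lt_of_lt_csSup' hγ'
    refine ⟨m, hm.2.1, hm2, lt_of_le_of_ne (e ▸ le_csSup bdd hm) ?_⟩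
    rintro rfl
    exact hmem hm

def toP0 (hl : ℵ₀ ≤ lam) (n : Nd δc lam) : P0 δc lam where
  dom := n.γ + 1
  s := n.s
  dom_lt := add_one_lt_succ hl n.γ_lt
  s_sub := fun β hβ => by
    rw [Set.mem_Iio, Order.lt_add_one_iff]; exact n.s_sub hβ
  s_cof := n.s_cof
  s_nonstat := by
    have h := n.s_ns (n.γ + 1)
    have e : n.s ∩ Set.Iio (n.γ + 1) = n.s := by
      apply Set.inter_eq_left.2
      intro β hβ
      rw [Set.mem_Iio, Order.lt_add_one_iff]; exact n.s_sub hβ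
    rwa [e] at h
  s_nonstat_init := n.s_ns

theorem Iio_add_one (γ : Ordinal.{0}) : Set.Iio (γ + 1) = Set.Iic γ := by
  ext x; simp

theorem toP0_le (hl : ℵ₀ ≤ lam) {n f : Nd δc lam} (h : n.le f) : (n.toP0 hl).le (f.toP0 hl) := by
  refine ⟨?_, ?_, ?_⟩
  · exact add_le_add_left h.1 1
  · intro β hβ
    exact (s_iff h (n.s_sub hβ)).1 hβ
  · change f.s ∩ Set.Iio (n.γ + 1) = n.s
    rw [Iio_add_one]; exact h.2.1

end Nd

/-- Number of entries of both kinds is full. -/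
def Sp (δc : Cardinal.{0}) (g : Ordinal.{0} → Bool) (z : Set Ordinal.{0}) : Prop :=
  #({i | i ∈ z ∧ g i = false} : Set Ordinal.{0}) = Cardinal.lift.{1} δc ∧
  #({i | i ∈ z ∧ g i = true} : Set Ordinal.{0}) = Cardinal.lift.{1} δc

theorem Sp_congr (δc : Cardinal.{0}) (g g' : Ordinal.{0} → Bool) (z : Set Ordinal.{0})
    (h : ∀ i ∈ z, g i = g' i) (hs : Sp δc g z) : Sp δc g' z := by
  have e : ∀ b, {i | i ∈ z ∧ g' i = b} = {i | i ∈ z ∧ g i = b} := by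
    intro b
    ext i
    constructor
    · rintro ⟨h1, h2⟩; exact ⟨h1, (h i h1).trans h2⟩
    · rintro ⟨h1, h2⟩; exact ⟨h1, (h i h1).symm.trans h2⟩
  unfold Sp
  rw [e, e]
  exact hs

structure Ctx where
  δc : Cardinal.{0}
  lam : Cardinal.{0}
  xseq : Set Ordinal.{0} → Ordinal.{0} → Set Ordinal.{0}
  hδ : δc.IsRegular
  hlam : lam.IsRegular
  hlam1 : ℵ₀ < lam
  hdlt : δc < lam
  hx : ∀ (S : Set Ordinal.{0}), ∀ β ∈ S,
      xseq S β ⊆ Set.Iio β ∧ ∀ γ < β, ∃ ξ ∈ xseq S β, γ ≤ ξ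
  hstab : ∀ p q : P0 δc lam, P0.le p q → ∀ β ∈ p.s, xseq q.s β = xseq p.s β

namespace Ctx
variable (C : Ctx)

abbrev ND := Nd C.δc C.lam

theorem hl : ℵ₀ ≤ C.lam := C.hlam1.le

theorem xs_stab {n f : C.ND} (h : n.le f) {β : Ordinal.{0}} (hβ : β ∈ n.s) :
    C.xseq f.s β = C.xseq n.s β :=
  C.hstab (n.toP0 C.hl) (f.toP0 C.hl) (Nd.toP0_le C.hl h) β hβ

def Mz (n : C.ND) (η : Ordinal.{0}) : Set (Set Ordinal.{0}) :=
  {z | ∃ β ∈ n.s, β ∈ n.Bk ∧ z = C.xseq n.s β ∧ #z = Cardinal.lift.{1} C.δc ∧ ∀ i ∈ z, n.R i ≤ η}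

noncomputable def bd (n : C.ND) : BData where
  Lam := C.lam.ord
  Bk := n.Bk
  ρ := n.rho0
  hρ := n.rho0_bij C.hl
  M := C.Mz n
  Mmono := by
    rintro η η' h z ⟨β, h1, h2, h3, h4, h5⟩
    exact ⟨β, h1, h2, h3, h4, fun i hi => (h5 i hi).trans h⟩
  hM := by
    rintro η z ⟨β, h1, h2, h3, h4, h5⟩ i hi hib
    rw [← n.R_self hib]
    exact h5 i hi

theorem exists_f0 (n : C.ND) : ∃ f0 : Ordinal.{0} → Bool, ∀ η, ∀ z ∈ (C.bd n).M η,
    ∀ g : Ordinal.{0} → Bool, (∀ i ∈ z, i ∈ (C.bd n).Bk → g i = f0 i) → Sp C.δc g z := by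
  obtain ⟨α, hα1, hα2⟩ := n.exists_low
  obtain ⟨f0, hf0⟩ := splitting C.hδ n.s (fun β hβ => (n.s_cof β hβ).1) n.s_ns
    (fun β => C.xseq n.s β) (fun β hβ => C.hx n.s β hβ) n.γ α
  refine ⟨f0, ?_⟩
  rintro η z ⟨β, h1, h2, rfl, h4, h5⟩ g hg
  have key : ∀ b : Bool, #({i | i ∈ C.xseq n.s β ∧ g i = b} : Set Ordinal.{0}) =
      Cardinal.lift.{1} C.δc := by
    intro b
    apply le_antisymm
    · rw [← h4]
      exact Cardinal.mk_le_mk_of_subset (fun i hi => hi.1)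
    · refine (hf0 β h1 (hα2 β h1 h2) (n.s_lt h1) b).trans (Cardinal.mk_le_mk_of_subset ?_)
      rintro i ⟨hi1, hi2, hi3⟩
      refine ⟨hi1, ?_⟩
      rw [hg i hi1 (hα1 i hi2 (((C.hx n.s β h1).1 hi1).trans (n.s_lt h1)))]
      exact hi3
  exact ⟨key false, key true⟩

noncomputable def FF (n : C.ND) : Ordinal.{0} → (Ordinal.{0} → Ordinal.{0} → Bool) →
    (Ordinal.{0} → Ordinal.{0} → Bool) :=
  ((C.bd n).block_main (Sp C.δc) (Sp_congr C.δc) (C.exists_f0 n).choose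
    (C.exists_f0 n).choose_spec).choose

theorem FF2 (n : C.ND) : ∀ η r, Ordinal.omega0 ≤ η → η < C.lam.ord → (C.bd n).Fl η r →
      (C.bd n).Fl η (C.FF n η r) ∧ ∀ i ∈ (C.bd n).N η, ∀ ξ ≤ η, C.FF n η r i ξ = r i ξ :=
  ((C.bd n).block_main (Sp C.δc) (Sp_congr C.δc) (C.exists_f0 n).choose
    (C.exists_f0 n).choose_spec).choose_spec.1

theorem FF3 (n : C.ND) : ∀ η r η' r', Ordinal.omega0 ≤ η → η ≤ η' → η' < C.lam.ord →
    (C.bd n).Fl η r → (C.bd n).Fl η' r' →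
      (((C.bd n).Agree η r r' ∧ ∀ z ∈ C.Mz n η, ∀ ξ, η < ξ → ξ ≤ η' → Sp C.δc (fun i => r' i ξ) z) ↔
        (C.bd n).Agree η (C.FF n η r) (C.FF n η' r')) :=
  ((C.bd n).block_main (Sp C.δc) (Sp_congr C.δc) (C.exists_f0 n).choose
    (C.exists_f0 n).choose_spec).choose_spec.2.1

theorem FF4 (n : C.ND) : ∀ η r, Ordinal.omega0 ≤ η → η < C.lam.ord → (C.bd n).Fl η r →
      ∃ r', (C.bd n).Fl η r' ∧ (C.bd n).Agree η (C.FF n η r') r :=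
  ((C.bd n).block_main (Sp C.δc) (Sp_congr C.δc) (C.exists_f0 n).choose
    (C.exists_f0 n).choose_spec).choose_spec.2.2

structure Good (f : C.ND) (w : Set Ordinal.{0}) (η : Ordinal.{0}) : Prop where
  ωη : Ordinal.omega0 ≤ η
  ηΛ : η < C.lam.ord
  ne : w.Nonempty
  sm : #w < Cardinal.lift.{1} C.lam
  lt : ∀ i ∈ w, i < f.γ
  rk : ∀ i ∈ w, f.R i ≤ η
  bl : ∀ i ∈ w, ∀ j < f.γ, f.nxt j = f.nxt i → f.R j ≤ η → j ∈ w
  pm : ∀ β ∈ f.s, #(C.xseq f.s β) = Cardinal.lift.{1} C.δc → (∀ i ∈ C.xseq f.s β, f.R i ≤ η) →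
    (∃ i ∈ w, f.nxt i = f.nxt β) → C.xseq f.s β ⊆ w

@[ext] structure Cd where
  f : C.ND
  w : Set Ordinal.{0}
  η : Ordinal.{0}
  r : Ordinal.{0} → Ordinal.{0} → Bool
  good : C.Good f w η
  supp : ∀ i ξ, r i ξ = true → i ∈ w ∧ ξ ≤ η
  flag : ∀ i ∈ w, f.R i = η → r i 0 = true

structure CLE (pr : Prop) (x y : C.Cd) : Prop where
  f : x.f.le y.f
  w : x.w ⊆ y.w
  η : x.η ≤ y.η
  r : ∀ i ∈ x.w, ∀ ξ ≤ x.η, y.r i ξ = x.r i ξ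
  p : pr → ∀ β ∈ x.f.s, C.xseq x.f.s β ⊆ x.w → #(C.xseq x.f.s β) = Cardinal.lift.{1} C.δc →
    ∀ ξ, x.η < ξ → ξ ≤ y.η → Sp C.δc (fun i => y.r i ξ) (C.xseq x.f.s β)

variable {C}

theorem CLE.refl (pr : Prop) (x : C.Cd) : C.CLE pr x x :=
  ⟨Nd.le_refl' _, subset_rfl, le_rfl, fun _ _ _ _ => rfl, fun _ _ _ _ _ ξ h1 h2 =>
    absurd h1 (not_lt.2 h2)⟩

theorem CLE.antisymm (pr : Prop) {x y : C.Cd} (h : C.CLE pr x y) (h' : C.CLE pr y x) : x = y := by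
  have e1 : x.f = y.f := Nd.eq_of_le h.f h'.f.1
  have e2 := subset_antisymm h.w h'.w
  have e3 := le_antisymm h.η h'.η
  refine Cd.ext e1 e2 e3 ?_
  funext i ξ
  by_cases hi : i ∈ x.w ∧ ξ ≤ x.η
  · exact (h.r i hi.1 ξ hi.2).symm
  · have h1 : x.r i ξ = false := by
      by_contra hc
      exact hi (x.supp i ξ (by simpa using hc))
    have h2 : y.r i ξ = false := by
      by_contra hc
      have := y.supp i ξ (by simpa using hc)
      rw [← e2, ← e3] at this
      exact hi this
    rw [h1, h2]

theorem Good.mz {f : C.ND} {w : Set Ordinal.{0}} {η : Ordinal.{0}} (h : C.Good f w η)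
    {i : Ordinal.{0}} (hi : i ∈ w) {z : Set Ordinal.{0}} (hz : z ∈ C.Mz (f.nd i) η) :
    ∃ β ∈ f.s, z = C.xseq f.s β ∧ C.xseq f.s β ⊆ w ∧ #z = Cardinal.lift.{1} C.δc := by
  obtain ⟨β, h1, h2, rfl, h4, h5⟩ := hz
  have hle := f.nd_le i
  have hβf : β ∈ f.s := (Nd.s_iff hle ((f.nd i).s_sub h1)).1 h1
  have e := C.xs_stab hle h1
  refine ⟨β, hβf, e.symm, ?_, h4⟩
  apply h.pm β hβf
  · rw [e]; exact h4
  · rw [e]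
    intro j hj
    have hjl : j < (f.nd i).γ := ((C.hx _ β h1).1 hj).trans ((f.nd i).s_lt h1)
    rw [Nd.R_of_le hle hjl]
    exact h5 j hj
  · refine ⟨i, hi, ?_⟩
    exact (((f.mem_Bk_nd (h.lt i hi)).1 h2).2).symm

theorem Good.dm {f : C.ND} {w : Set Ordinal.{0}} {η : Ordinal.{0}} (h : C.Good f w η)
    {i : Ordinal.{0}} (hi : i ∈ w) : (C.bd (f.nd i)).Dm η ⊆ w := by
  rintro j (⟨h1, h2⟩ | ⟨h1, z, hz, hj⟩)
  · have h1' : j ∈ (f.nd i).Bk := h1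
    have h3 := (f.mem_Bk_nd (h.lt i hi)).1 h1'
    refine h.bl i hi j h3.1 h3.2 ?_
    unfold Nd.R
    rw [f.nd_congr (h.lt i hi) h3.1 h3.2]
    exact h2
  · obtain ⟨β, h3, rfl, h5, -⟩ := h.mz hi hz
    exact h5 hj

theorem Good.mem_dm {f : C.ND} {w : Set Ordinal.{0}} {η : Ordinal.{0}} (h : C.Good f w η)
    {i : Ordinal.{0}} (hi : i ∈ w) : i ∈ (C.bd (f.nd i)).Dm η :=
  Or.inl ⟨f.self_mem_Bk (h.lt i hi), h.rk i hi⟩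

/-- Rows of `N` lie in strictly lower blocks. -/
theorem Good.n_lt {f : C.ND} {w : Set Ordinal.{0}} {η : Ordinal.{0}} (h : C.Good f w η)
    {i j : Ordinal.{0}} (hi : i ∈ w) (hj : j ∈ (C.bd (f.nd i)).N η) : f.nxt j < f.nxt i := by
  have hjw : j ∈ w := h.dm hi (Or.inr hj)
  obtain ⟨h1, z, ⟨β, h2, h3, rfl, h4, h5⟩, h6⟩ := hj
  have h1' : j ∉ (f.nd i).Bk := h1
  rw [f.mem_Bk_nd (h.lt i hi)] at h1'
  have hjβ : j < β := (C.hx _ β h2).1 h6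
  have hβ := (f.mem_Bk_nd (h.lt i hi)).1 h3
  refine lt_of_le_of_ne ?_ (fun e => h1' ⟨h.lt j hjw, e⟩)
  rw [← hβ.2]
  exact f.nxt_mono hjβ.le hβ.1

theorem Good.fl {f : C.ND} {w : Set Ordinal.{0}} {η : Ordinal.{0}} (h : C.Good f w η)
    {r : Ordinal.{0} → Ordinal.{0} → Bool} (hr : ∀ i ∈ w, f.R i = η → r i 0 = true)
    {i : Ordinal.{0}} (hi : i ∈ w) : (C.bd (f.nd i)).Fl η r := by
  intro j hj hjη
  have hj' : j ∈ (f.nd i).Bk := hj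
  have h3 := (f.mem_Bk_nd (h.lt i hi)).1 hj'
  have e : f.R j = η := by
    unfold Nd.R
    rw [f.nd_congr (h.lt i hi) h3.1 h3.2]
    exact hjη
  exact hr j (h.bl i hi j h3.1 h3.2 e.le) e

open Classical in
/-- The translation. -/
noncomputable def Phi (x : C.Cd) : C.Cd where
  f := x.f
  w := x.w
  η := x.η
  r := fun i ξ => if i ∈ x.w ∧ ξ ≤ x.η then C.FF (x.f.nd i) x.η x.r i ξ else false
  good := x.good
  supp := by
    intro i ξ h
    by_contra hc
    rw [if_neg hc] at h
    exact absurd h (by simp)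
  flag := by
    intro i hi hη
    rw [if_pos ⟨hi, zero_le⟩]
    exact (C.FF2 (x.f.nd i) x.η x.r x.good.ωη x.good.ηΛ (x.good.fl x.flag hi)).1 i
      (x.f.self_mem_Bk (x.good.lt i hi)) hη

theorem Phi_r (x : C.Cd) {i ξ : Ordinal.{0}} (hi : i ∈ x.w) (hξ : ξ ≤ x.η) :
    (Phi x).r i ξ = C.FF (x.f.nd i) x.η x.r i ξ := if_pos ⟨hi, hξ⟩

theorem Phi_le_iff (x y : C.Cd) : C.CLE True x y ↔ C.CLE False (Phi x) (Phi y) := by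
  constructor
  · intro h
    refine ⟨h.f, h.w, h.η, ?_, fun h => h.elim⟩
    intro i hi ξ hξ
    have hi : i ∈ x.w := hi
    have hξ : ξ ≤ x.η := hξ
    rw [Phi_r x hi hξ, Phi_r y (h.w hi) (hξ.trans h.η), Nd.nd_of_le h.f (x.good.lt i hi)]
    have hfy : (C.bd (x.f.nd i)).Fl y.η y.r := by
      rw [← Nd.nd_of_le h.f (x.good.lt i hi)]
      exact y.good.fl y.flag (h.w hi)
    refine (C.FF3 (x.f.nd i) x.η x.r y.η y.r x.good.ωη h.η y.good.ηΛ (x.good.fl x.flag hi)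
      hfy).1 ⟨?_, ?_⟩ i (x.good.mem_dm hi) ξ hξ
    · intro j hj ξ' hξ'
      exact h.r j (x.good.dm hi hj) ξ' hξ'
    · intro z hz ξ' h1 h2
      obtain ⟨β, h3, rfl, h4, h5⟩ := x.good.mz hi hz
      exact h.p trivial β h3 h4 h5 ξ' h1 h2
  · intro h
    have hf : x.f.le y.f := h.f
    have hw : x.w ⊆ y.w := h.w
    have hη : x.η ≤ y.η := h.η
    have hfy : ∀ i ∈ x.w, (C.bd (x.f.nd i)).Fl y.η y.r := by
      intro i hi
      rw [← Nd.nd_of_le hf (x.good.lt i hi)]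
      exact y.good.fl y.flag (hw hi)
    have main : ∀ m : Ordinal.{0}, ∀ i ∈ x.w, x.f.nxt i = m →
        ((C.bd (x.f.nd i)).Agree x.η x.r y.r ∧ ∀ z ∈ C.Mz (x.f.nd i) x.η, ∀ ξ, x.η < ξ → ξ ≤ y.η →
          Sp C.δc (fun i => y.r i ξ) z) := by
      intro m
      induction m using WellFoundedLT.induction with
      | ind m IH =>
      intro i hi him
      refine (C.FF3 (x.f.nd i) x.η x.r y.η y.r x.good.ωη hη y.good.ηΛ (x.good.fl x.flag hi)
        (hfy i hi)).2 ?_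
      intro j hj ξ hξ
      have hjw := x.good.dm hi hj
      rcases hj with hj | hj
      · have hj1 : j ∈ (x.f.nd i).Bk := hj.1
        have h3 := (x.f.mem_Bk_nd (x.good.lt i hi)).1 hj1
        have e := x.f.nd_congr (x.good.lt i hi) h3.1 h3.2
        have h4 := h.r j hjw ξ hξ
        rw [Phi_r x hjw hξ, Phi_r y (hw hjw) (hξ.trans hη), Nd.nd_of_le hf (x.good.lt j hjw), e] at h4
        exact h4
      · have hlt := x.good.n_lt hi hj
        rw [(C.FF2 (x.f.nd i) x.η x.r x.good.ωη x.good.ηΛ (x.good.fl x.flag hi)).2 j hj ξ hξ,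
          (C.FF2 (x.f.nd i) y.η y.r y.good.ωη y.good.ηΛ (hfy i hi)).2 j
            ((C.bd (x.f.nd i)).Nmono hη hj) ξ (hξ.trans hη)]
        exact (IH _ (him ▸ hlt) j hjw rfl).1 j (x.good.mem_dm hjw) ξ hξ
    refine ⟨hf, hw, hη, ?_, ?_⟩
    · intro i hi ξ hξ
      exact (main _ i hi rfl).1 i (x.good.mem_dm hi) ξ hξ
    · intro _ β hβ hsub hcard ξ h1 h2
      have hβγ : β < x.f.γ := x.f.s_lt hβ
      have hle := x.f.nd_le β
      have hβB := x.f.self_mem_Bk hβγ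
      have hβn : β ∈ (x.f.nd β).s := (Nd.s_iff hle hβB.1.le).2 hβ
      obtain ⟨α, hα1, hα2⟩ := (x.f.nd β).exists_low
      obtain ⟨i, hi, hαi⟩ := (C.hx x.f.s β hβ).2 α (hα2 β hβn hβB)
      have hiβ : i < β := (C.hx x.f.s β hβ).1 hi
      have hiB := hα1 i hαi (hiβ.trans hβB.1)
      have h3 := (x.f.mem_Bk_nd hβγ).1 hiB
      have e := x.f.nd_congr hβγ h3.1 h3.2
      refine (main _ i (hsub hi) rfl).2 _ ?_ ξ h1 h2
      rw [e]
      have e2 := C.xs_stab hle hβn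
      refine ⟨β, hβn, hβB, e2, hcard, ?_⟩
      intro j hj
      have hjβ : j < β := (C.hx x.f.s β hβ).1 hj
      rw [← Nd.R_of_le hle (hjβ.trans hβB.1)]
      exact x.good.rk j (hsub hj)

theorem Phi_surj : Function.Surjective (Phi (C := C)) := by
  classical
  intro y
  have hG : ∀ n : C.ND, ∃ GG : (Ordinal.{0} → Ordinal.{0} → Bool) → (Ordinal.{0} → Ordinal.{0} → Bool),
      ∀ r, (C.bd n).Fl y.η r → (C.bd n).Fl y.η (GG r) ∧ (C.bd n).Agree y.η (C.FF n y.η (GG r)) r := by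
    intro n
    have : ∀ r, ∃ r', (C.bd n).Fl y.η r → (C.bd n).Fl y.η r' ∧ (C.bd n).Agree y.η (C.FF n y.η r') r := by
      intro r
      by_cases h : (C.bd n).Fl y.η r
      · obtain ⟨r', h'⟩ := C.FF4 n y.η r y.good.ωη y.good.ηΛ h
        exact ⟨r', fun _ => h'⟩
      · exact ⟨r, fun h' => absurd h' h⟩
    choose GG hGG using this
    exact ⟨GG, hGG⟩
  choose GG hGG using hG
  have wf : WellFounded (fun i j : Ordinal.{0} => y.f.nxt i < y.f.nxt j) :=
    InvImage.wf y.f.nxt Ordinal.lt_wf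
  let step : ∀ i : Ordinal.{0}, (∀ j : Ordinal.{0}, y.f.nxt j < y.f.nxt i → Ordinal.{0} → Bool) →
      Ordinal.{0} → Bool := fun i rec ξ =>
    if i ∈ y.w ∧ ξ ≤ y.η then
      GG (y.f.nd i) (fun j ξ => if h : y.f.nxt j < y.f.nxt i then rec j h ξ else y.r j ξ) i ξ
    else false
  let r0 : Ordinal.{0} → Ordinal.{0} → Bool := wf.fix step
  let rh : Ordinal.{0} → Ordinal.{0} → Ordinal.{0} → Bool := fun i j ξ =>
    if y.f.nxt j < y.f.nxt i then r0 j ξ else y.r j ξ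
  have hr0 : ∀ i ξ, r0 i ξ = if i ∈ y.w ∧ ξ ≤ y.η then GG (y.f.nd i) (rh i) i ξ else false := by
    intro i ξ
    change wf.fix step i ξ = _
    rw [wf.fix_eq]
    rfl
  have rh_congr : ∀ i j, y.f.nxt i = y.f.nxt j → rh i = rh j := by
    intro i j h
    funext k ξ
    simp only [rh, h]
  have hrh : ∀ i ∈ y.w, (C.bd (y.f.nd i)).Fl y.η (rh i) := by
    intro i hi j hj hjη
    have hj' : j ∈ (y.f.nd i).Bk := hj
    have h3 := (y.f.mem_Bk_nd (y.good.lt i hi)).1 hj'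
    simp only [rh, h3.2, lt_irrefl, if_false]
    exact y.good.fl y.flag hi j hj hjη
  have agr : ∀ i ∈ y.w, (C.bd (y.f.nd i)).Agree y.η (GG (y.f.nd i) (rh i)) r0 := by
    intro i hi j hj ξ hξ
    have hjw := y.good.dm hi hj
    obtain ⟨h1, h2⟩ := hGG (y.f.nd i) (rh i) (hrh i hi)
    have hj0 := hj
    rcases hj with hj | hj
    · have hj1 : j ∈ (y.f.nd i).Bk := hj.1
      have h3 := (y.f.mem_Bk_nd (y.good.lt i hi)).1 hj1
      rw [hr0, if_pos ⟨hjw, hξ⟩, y.f.nd_congr (y.good.lt i hi) h3.1 h3.2, rh_congr j i h3.2]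
    · have hlt := y.good.n_lt hi hj
      have h4 := h2 j hj0 ξ hξ
      rw [(C.FF2 (y.f.nd i) y.η _ y.good.ωη y.good.ηΛ h1).2 j hj ξ hξ] at h4
      rw [← h4]
      simp only [rh, hlt, if_true]
  have fl0 : ∀ i ∈ y.w, (C.bd (y.f.nd i)).Fl y.η r0 := by
    intro i hi j hj hjη
    rw [agr i hi j (Or.inl ⟨hj, hjη.le⟩) 0 zero_le]
    exact (hGG (y.f.nd i) (rh i) (hrh i hi)).1 j hj hjη
  let x : C.Cd :=
    { f := y.f, w := y.w, η := y.η, r := r0, good := y.good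
      supp := by
        intro i ξ h
        by_contra hc
        rw [hr0, if_neg hc] at h
        exact absurd h (by simp)
      flag := by
        intro i hi hη
        exact fl0 i hi i (y.f.self_mem_Bk (y.good.lt i hi)) hη }
  refine ⟨x, ?_⟩
  apply CLE.antisymm False
  all_goals
    refine ⟨Nd.le_refl' _, subset_rfl, le_rfl, ?_, fun h => h.elim⟩
    intro i hi ξ hξ
    have hi : i ∈ y.w := hi
    have hξ : ξ ≤ y.η := hξ
    have key : (Phi x).r i ξ = y.r i ξ := by
      rw [Phi_r x (show i ∈ x.w from hi) (show ξ ≤ x.η from hξ)]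
      change C.FF (y.f.nd i) y.η r0 i ξ = y.r i ξ
      obtain ⟨h1, h2⟩ := hGG (y.f.nd i) (rh i) (hrh i hi)
      have h3 := (C.FF3 (y.f.nd i) y.η _ y.η r0 y.good.ωη le_rfl y.good.ηΛ h1 (fl0 i hi)).1
        ⟨agr i hi, fun z _ ξ' h1 h2 => absurd h1 (not_lt.2 h2)⟩ i (y.good.mem_dm hi) ξ hξ
      rw [h3, ← h2 i (y.good.mem_dm hi) ξ hξ]
      simp only [rh, lt_irrefl, if_false]
    first | exact key | exact key.symm

end Ctx

namespace Ctx
variable {C : Ctx}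

theorem mk_Iic_lt {η : Ordinal.{0}} (h : η < C.lam.ord) : #(Set.Iic η) < Cardinal.lift.{1} C.lam := by
  rw [← Nd.Iio_add_one, Cardinal.mk_Iio_ordinal, Cardinal.lift_lt, ← Cardinal.lt_ord]
  exact (Cardinal.isSuccLimit_ord C.hl).add_one_lt h

theorem omega_lt : Ordinal.omega0 < C.lam.ord := by
  rw [Cardinal.lt_ord]
  simpa using C.hlam1

theorem lreg : (Cardinal.lift.{1} C.lam).IsRegular := C.hlam.lift

/-- A promise ordinal. -/
def IsP (f : C.ND) (η β : Ordinal.{0}) : Prop :=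
  β ∈ f.s ∧ #(C.xseq f.s β) = Cardinal.lift.{1} C.δc ∧ ∀ i ∈ C.xseq f.s β, f.R i ≤ η

def rows (f : C.ND) (η : Ordinal.{0}) (T : Set Ordinal.{0}) : Set Ordinal.{0} :=
  {j | j < f.γ ∧ f.nxt j ∈ T ∧ f.R j ≤ η}

theorem rows_small (f : C.ND) {η : Ordinal.{0}} (hη : η < C.lam.ord) {T : Set Ordinal.{0}}
    (hT : #T < Cardinal.lift.{1} C.lam) : #(rows f η T) < Cardinal.lift.{1} C.lam := by
  have h1 : #(rows f η T) ≤ #(T ×ˢ Set.Iic η : Set (Ordinal.{0} × Ordinal.{0})) := by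
    refine Cardinal.mk_le_of_injective
      (f := fun j => ⟨(f.nxt j.1, f.R j.1), j.2.2.1, j.2.2.2⟩) ?_
    intro i j h
    have h2 := (Subtype.mk.injEq _ _ _ _).mp h
    rw [Prod.mk.injEq] at h2
    have e := f.nd_congr j.2.1 i.2.1 h2.1
    have h3 := h2.2
    unfold Nd.R at h3
    rw [e] at h3
    apply Subtype.ext
    exact ((f.nd j.1).rho0_bij C.hl).injOn ((f.mem_Bk_nd j.2.1).2 ⟨i.2.1, h2.1⟩)
      (f.self_mem_Bk j.2.1) h3
  refine h1.trans_lt ?_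
  rw [Cardinal.mk_setProd]
  exact Cardinal.mul_lt_of_lt lreg.aleph0_le hT (mk_Iic_lt hη)

def Bs (f : C.ND) (η : Ordinal.{0}) (T : Set Ordinal.{0}) : Set Ordinal.{0} :=
  {β | IsP f η β ∧ f.nxt β ∈ T}

/-- Every promise ordinal is a limit of rows of its own block. -/
theorem IsP.near {f : C.ND} {β : Ordinal.{0}} (hβ : β ∈ f.s)
    {β' : Ordinal.{0}} (h : β' < β) : ∃ i ∈ C.xseq f.s β, β' ≤ i ∧ i < β ∧ f.nxt i = f.nxt β := by
  have hβγ : β < f.γ := f.s_lt hβ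
  have hle := f.nd_le β
  have hβB := f.self_mem_Bk hβγ
  have hβn : β ∈ (f.nd β).s := (Nd.s_iff hle hβB.1.le).2 hβ
  obtain ⟨α, hα1, hα2⟩ := (f.nd β).exists_low
  obtain ⟨i, hi, hαi⟩ := (C.hx f.s β hβ).2 (max α β') (max_lt (hα2 β hβn hβB) h)
  have hiβ : i < β := (C.hx f.s β hβ).1 hi
  have hiB := hα1 i ((le_max_left _ _).trans hαi) (hiβ.trans hβB.1)
  exact ⟨i, hi, (le_max_right _ _).trans hαi, hiβ, ((f.mem_Bk_nd hβγ).1 hiB).2⟩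

theorem Bs_small (f : C.ND) {η : Ordinal.{0}} (hη : η < C.lam.ord) {T : Set Ordinal.{0}}
    (hT : #T < Cardinal.lift.{1} C.lam) : #(Bs f η T) < Cardinal.lift.{1} C.lam := by
  let g : Ordinal.{0} → Ordinal.{0} := fun β => sInf {j | β ≤ j ∧ (j ∈ rows f η T ∨ j = f.γ)}
  have hg : ∀ β ∈ Bs f η T, β ≤ g β ∧ (g β ∈ rows f η T ∨ g β = f.γ) := fun β hβ =>
    csInf_mem (s := {j | β ≤ j ∧ (j ∈ rows f η T ∨ j = f.γ)}) ⟨f.γ, (f.s_lt hβ.1.1).le, Or.inr rfl⟩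
  have hlt : ∀ β ∈ Bs f η T, ∀ β' < β, g β' < g β := by
    intro β hβ β' h
    obtain ⟨i, h1, h2, h3, h4⟩ := IsP.near hβ.1.1 h
    refine lt_of_le_of_lt (csInf_le' ⟨h2, Or.inl ⟨?_, ?_, ?_⟩⟩) (h3.trans_le (hg β hβ).1)
    · exact h3.trans (f.s_lt hβ.1.1)
    · rw [h4]; exact hβ.2
    · exact hβ.1.2.2 i h1
  have h1 : #(Bs f η T) ≤ #(rows f η T ∪ {f.γ} : Set Ordinal.{0}) := by
    refine Cardinal.mk_le_of_injective (f := fun β => ⟨g β.1, (hg β.1 β.2).2⟩) ?_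
    intro β β' h
    have h2 := (Subtype.mk.injEq _ _ _ _).mp h
    apply Subtype.ext
    rcases lt_trichotomy β.1 β'.1 with h3 | h3 | h3
    · exact absurd h2 (hlt _ β'.2 _ h3).ne
    · exact h3
    · exact absurd h2 (hlt _ β.2 _ h3).ne'
  refine h1.trans_lt ((Cardinal.mk_union_le _ _).trans_lt ?_)
  refine Cardinal.add_lt_of_lt lreg.aleph0_le (rows_small f hη hT) ?_
  rw [Cardinal.mk_singleton]
  exact Cardinal.one_lt_aleph0.trans_le lreg.aleph0_le

def stp (f : C.ND) (η : Ordinal.{0}) (T : Set Ordinal.{0}) : Set Ordinal.{0} :=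
  T ∪ ⋃ β ∈ Bs f η T, f.nxt '' (C.xseq f.s β)

theorem stp_small (f : C.ND) {η : Ordinal.{0}} (hη : η < C.lam.ord) {T : Set Ordinal.{0}}
    (hT : #T < Cardinal.lift.{1} C.lam) : #(stp f η T) < Cardinal.lift.{1} C.lam := by
  refine (Cardinal.mk_union_le _ _).trans_lt (Cardinal.add_lt_of_lt lreg.aleph0_le hT ?_)
  rw [Cardinal.card_biUnion_lt_iff_forall_of_isRegular lreg (Bs_small f hη hT)]
  intro β hβ
  refine Cardinal.mk_image_le.trans_lt ?_
  rw [hβ.1.2.1, Cardinal.lift_lt]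
  exact C.hdlt

theorem closure (f : C.ND) (w0 : Set Ordinal.{0}) (h0 : ∀ i ∈ w0, i < f.γ)
    (hs : #w0 < Cardinal.lift.{1} C.lam) (ζ : Ordinal.{0}) (hζ : ζ < C.lam.ord) :
    ∃ η w, ζ ≤ η ∧ w0 ⊆ w ∧ C.Good f w η ∧ ∀ i ∈ w0, f.R i < η := by
  have hγ0 : 0 < f.γ := by
    obtain ⟨ν, hν⟩ := f.mark
    rw [hν]
    have : 0 < C.lam.ord := (Ordinal.omega0_pos).trans omega_lt
    exact this.trans_le (le_add_of_nonneg_left zero_le)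
  let w1 : Set Ordinal.{0} := w0 ∪ {0}
  have hs1 : #w1 < Cardinal.lift.{1} C.lam := by
    refine (Cardinal.mk_union_le _ _).trans_lt (Cardinal.add_lt_of_lt lreg.aleph0_le hs ?_)
    rw [Cardinal.mk_singleton]
    exact Cardinal.one_lt_aleph0.trans_le lreg.aleph0_le
  have h1 : ∀ i ∈ w1, i < f.γ := by
    rintro i (hi | rfl)
    · exact h0 i hi
    · exact hγ0
  obtain ⟨η0, hη0, hη1⟩ := small_bdd C.hlam w1 hs1 f.R (fun i hi => f.R_lt C.hl (h1 i hi))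
  let η := max (max η0 ζ) Ordinal.omega0
  have hη : η < C.lam.ord := max_lt (max_lt hη0 hζ) omega_lt
  have hηR : ∀ i ∈ w1, f.R i < η := fun i hi =>
    (hη1 i hi).trans_le ((le_max_left _ _).trans (le_max_left _ _))
  let T : ℕ → Set Ordinal.{0} := fun k => (stp f η)^[k] (f.nxt '' w1)
  have hT : ∀ k, #(T k) < Cardinal.lift.{1} C.lam := by
    intro k
    induction k with
    | zero => exact Cardinal.mk_image_le.trans_lt hs1
    | succ k ih =>
      simp only [T, Function.iterate_succ_apply']
      exact stp_small f hη ih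
  let TT : Set Ordinal.{0} := ⋃ k : ULift.{1} ℕ, T k.down
  have hTT : #TT < Cardinal.lift.{1} C.lam := by
    rw [Cardinal.card_iUnion_lt_iff_forall_of_isRegular lreg]
    · exact fun k => hT _
    · simpa using C.hlam1
  have hin : ∀ i ∈ w1, i ∈ rows f η TT := fun i hi =>
    ⟨h1 i hi, Set.mem_iUnion.2 ⟨⟨0⟩, i, hi, rfl⟩, (hηR i hi).le⟩
  refine ⟨η, rows f η TT, (le_max_right _ _).trans (le_max_left _ _),
    fun i hi => hin i (Or.inl hi), ?_, fun i hi => hηR i (Or.inl hi)⟩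
  refine ⟨le_max_right _ _, hη, ⟨0, hin 0 (Or.inr rfl)⟩, rows_small f hη hTT, fun i hi => hi.1,
    fun i hi => hi.2.2, ?_, ?_⟩
  · intro i hi j hj e hR
    exact ⟨hj, by rw [e]; exact hi.2.1, hR⟩
  · rintro β hβ hc hR ⟨i, hi, e⟩ j hj
    obtain ⟨⟨k⟩, hk⟩ := Set.mem_iUnion.1 hi.2.1
    refine ⟨((C.hx _ β hβ).1 hj).trans (f.s_lt hβ), Set.mem_iUnion.2 ⟨⟨k + 1⟩, ?_⟩, hR j hj⟩
    simp only [T, Function.iterate_succ_apply']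
    refine Or.inr ?_
    simp only [Set.mem_iUnion]
    exact ⟨β, ⟨⟨hβ, hc, hR⟩, by rw [← e]; exact hk⟩, j, hj, rfl⟩

end Ctx

theorem range_iso {X α β : Type*} (leA : α → α → Prop) (leB : β → β → Prop) (T : X → α) (U : X → β)
    (hT : Function.Injective T) (hU : Function.Injective U) (Φ : X ≃ X)
    (h : ∀ x y, leA (T x) (T y) ↔ leB (U (Φ x)) (U (Φ y))) :
    Nonempty ((fun a b : ↥(Set.range T) => leA a.1 b.1) ≃r
      (fun a b : ↥(Set.range U) => leB a.1 b.1)) := by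
  refine ⟨⟨(Equiv.ofInjective T hT).symm.trans (Φ.trans (Equiv.ofInjective U hU)), ?_⟩⟩
  rintro ⟨_, x, rfl⟩ ⟨_, y, rfl⟩
  have e : ∀ x : X, (Equiv.ofInjective T hT).symm ⟨T x, x, rfl⟩ = x := fun x =>
    Equiv.ofInjective_symm_apply hT x
  simp only [Equiv.trans_apply, e, Equiv.ofInjective_apply]
  exact (h x y).symm

theorem ord_succ_le {a b : Ordinal.{0}} : a + 1 ≤ b + 1 ↔ a ≤ b := by
  rw [Order.add_one_le_iff, Order.lt_add_one_iff]

namespace Ctx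
variable {C : Ctx}

def toP2 (f : C.ND) : P2 C.lam where
  dom := f.γ + 1
  c := f.c
  dom_lt := add_one_lt_succ C.hl f.γ_lt
  dom_succ := ⟨f.γ, rfl⟩
  c_sub := by rw [Nd.Iio_add_one]; exact f.c_sub
  c_closed := fun β hβ => f.c_cl β (Order.lt_add_one_iff.1 hβ)
  c_unbdd := fun β hβ => ⟨f.γ, f.γ_mem, Order.lt_add_one_iff.1 hβ⟩

def ZZ (f : C.ND) (w : Set Ordinal.{0}) : Set (Set Ordinal.{0}) :=
  {z | ∃ β ∈ f.s, z = C.xseq f.s β ∧ ∃ y : Set Ordinal.{0},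
    y ⊆ z ∧ y ⊆ w ∧ Cardinal.mk ↥y = Cardinal.lift.{1} C.δc ∧
    ∃ b < β, ∀ ξ ∈ z \ y, ξ < b}

def toTrip (x : C.Cd) : Trip C.δc C.lam C.xseq where
  p := x.f.toP0 C.hl
  w := x.w
  a := x.η + 1
  r := x.r
  Z := ZZ x.f x.w
  q2 := toP2 x.f
  w_sub := fun i hi => (x.good.lt i hi).trans x.f.γ_lt
  w_small := x.good.sm
  a_lt := (Cardinal.isSuccLimit_ord C.hl).add_one_lt x.good.ηΛ
  Z_mem := fun z hz => hz
  q2_avoids := by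
    ext β
    constructor
    · rintro ⟨h1, h2⟩; exact x.f.disj β h1 h2
    · exact fun h => h.elim
  q2_dom := le_rfl

theorem toTrip_le (x y : C.Cd) : TripLE (toTrip x) (toTrip y) ↔ C.CLE True x y := by
  constructor
  · rintro ⟨h1, h2, h3, h4, h5, h6, h7, h8⟩
    refine ⟨⟨?_, ?_, ?_⟩, h2, ?_, ?_, ?_⟩
    · exact ord_succ_le.1 h7
    · have := h1.2.2
      change y.f.s ∩ Set.Iio (x.f.γ + 1) = x.f.s at this
      rwa [Nd.Iio_add_one] at this
    · change y.f.c ∩ Set.Iio (x.f.γ + 1) = x.f.c at h8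
      rwa [Nd.Iio_add_one] at h8
    · exact ord_succ_le.1 h3
    · exact fun i hi ξ hξ => h4 i hi ξ (Order.lt_add_one_iff.2 hξ)
    · intro _ β hβ hs hc ξ hξ1 hξ2
      refine h6 (C.xseq x.f.s β) ?_ hs hc ξ (Order.add_one_le_of_lt hξ1) (Order.lt_add_one_iff.2 hξ2)
      refine ⟨β, hβ, rfl, _, subset_rfl, hs, hc, 0, pos_of_gt (x.f.s_cof β hβ).2, ?_⟩
      rintro ξ ⟨h, h'⟩
      exact absurd h h'
  · intro h
    refine ⟨Nd.toP0_le C.hl h.f, h.w, ?_, ?_, ?_, ?_, ?_, ?_⟩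
    · exact ord_succ_le.2 h.η
    · exact fun i hi ξ hξ => h.r i hi ξ (Order.lt_add_one_iff.1 hξ)
    · rintro z ⟨β, h1, rfl, y', h3, h4, h5⟩
      exact ⟨β, (Nd.s_iff h.f (x.f.s_sub h1)).1 h1, (C.xs_stab h.f h1).symm, y', h3, h4.trans h.w, h5⟩
    · rintro z ⟨β, h1, rfl, -⟩ hs hc ξ hξ1 hξ2
      exact h.p trivial β h1 hs hc ξ (Order.add_one_le_iff.1 hξ1) (Order.lt_add_one_iff.1 hξ2)
    · exact ord_succ_le.2 h.f.1
    · change y.f.c ∩ Set.Iio (x.f.γ + 1) = x.f.c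
      rw [Nd.Iio_add_one]; exact h.f.2.2

theorem toTrip_dense : IsDenseR TripLE (Set.range (toTrip (C := C))) := by
  classical
  intro t
  have hsucc : (Order.succ C.lam).IsRegular := Cardinal.isRegular_succ C.hl
  obtain ⟨θ, hθ, hθw⟩ := small_bdd hsucc t.w
    (t.w_small.trans (Cardinal.lift_lt.2 (Order.lt_succ _))) id (fun i hi => t.w_sub hi)
  obtain ⟨γ, hγm, hγ, hγl⟩ := exists_mark C.hl (max θ t.p.dom) (max_lt hθ t.p.dom_lt)
  have hdom : t.p.dom < γ := (le_max_right _ _).trans_lt hγ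
  have hqdom : t.q2.dom < γ := t.q2_dom.trans_lt hdom
  have hav : ∀ β ∈ t.q2.c, β ∉ t.p.s := by
    intro β h1 h2
    have : β ∈ t.q2.c ∩ t.p.s := ⟨h1, h2⟩
    rw [t.q2_avoids] at this
    exact this
  let f : C.ND :=
    { γ := γ
      s := t.p.s
      c := t.q2.c ∪ {γ}
      mark := hγm
      γ_lt := hγl
      s_sub := fun β hβ => ((show β < t.p.dom from t.p.s_sub hβ).trans hdom).le
      s_cof := t.p.s_cof
      s_ns := t.p.s_nonstat_init
      c_sub := by
        rintro β (hβ | rfl)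
        · exact ((show β < t.q2.dom from t.q2.c_sub hβ).trans hqdom).le
        · exact Set.mem_Iic.2 le_rfl
      c_cl := by
        intro β hβ h0 h
        rcases hβ.lt_or_eq with hlt | rfl
        swap
        · exact Or.inr rfl
        have h' : ∀ γ' < β, ∃ ξ ∈ t.q2.c, γ' < ξ ∧ ξ < β := by
          intro γ' hγ'
          obtain ⟨ξ, h1 | h1, h2, h3⟩ := h γ' hγ'
          · exact ⟨ξ, h1, h2, h3⟩
          · rw [Set.mem_singleton_iff] at h1
            rw [h1] at h3
            exact absurd h3 (not_lt.2 hβ)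
        by_cases hβd : β < t.q2.dom
        · exact Or.inl (t.q2.c_closed β hβd h0 h')
        · obtain ⟨γ0, hγ0⟩ := t.q2.dom_succ
          obtain ⟨ξ, h1, h2, h3⟩ := h' γ0
            (lt_of_lt_of_le (hγ0 ▸ Order.lt_add_one_iff.2 le_rfl) (not_lt.1 hβd))
          have h4 : ξ < t.q2.dom := t.q2.c_sub h1
          rw [hγ0, Order.lt_add_one_iff] at h4
          exact absurd h2 (not_lt.2 h4)
      γ_mem := Or.inr rfl
      disj := by
        rintro β (hβ | rfl) h
        · exact hav β hβ h
        · exact absurd (show β < t.p.dom from t.p.s_sub h) (not_lt.2 hdom.le) }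
  obtain ⟨η, w, hη, hw, hgood, hR⟩ := closure f t.w
    (fun i hi => (hθw i hi).trans ((le_max_left _ _).trans_lt hγ)) t.w_small t.a t.a_lt
  obtain ⟨f0, hf0⟩ := splitting C.hδ f.s (fun β hβ => (f.s_cof β hβ).1) f.s_ns
    (fun β => C.xseq f.s β) (fun β hβ => C.hx f.s β hβ) f.γ 0
  let x : C.Cd :=
    { f := f, w := w, η := η, good := hgood
      r := fun i ξ => if i ∈ w ∧ ξ ≤ η then
        (if i ∈ t.w then (if ξ < t.a then t.r i ξ else f0 i) else true) else false
      supp := by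
        intro i ξ h
        by_contra hc
        rw [if_neg hc] at h
        exact absurd h (by simp)
      flag := by
        intro i hi hiη
        have : i ∉ t.w := fun h => absurd hiη (hR i h).ne
        rw [if_pos ⟨hi, zero_le⟩, if_neg this] }
  refine ⟨toTrip x, ⟨x, rfl⟩, ⟨?_, ?_, ?_⟩, hw, ?_, ?_, ?_, ?_, ?_, ?_⟩
  · exact hdom.le.trans (Order.lt_add_one_iff.2 le_rfl).le
  · exact subset_rfl
  · exact Set.inter_eq_left.2 t.p.s_sub
  · exact hη.trans (Order.lt_add_one_iff.2 le_rfl).le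
  · intro i hi ξ hξ
    change (if i ∈ w ∧ ξ ≤ η then _ else false) = _
    rw [if_pos ⟨hw hi, (hξ.le.trans hη)⟩, if_pos hi, if_pos hξ]
  · intro z hz
    obtain ⟨β, h1, h2, y, h3, h4, h5⟩ := t.Z_mem z hz
    exact ⟨β, h1, h2, y, h3, h4.trans hw, h5⟩
  · intro z hz hzw hzc ξ hξ1 hξ2
    have hξ2' : ξ ≤ η := Order.lt_add_one_iff.1 hξ2
    obtain ⟨β, h1, rfl, -⟩ := t.Z_mem z hz
    have h1f : β ∈ f.s := h1
    have key : ∀ b : Bool, #({i | i ∈ C.xseq t.p.s β ∧ x.r i ξ = b} : Set Ordinal.{0}) =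
        Cardinal.lift.{1} C.δc := by
      intro b
      apply le_antisymm
      · rw [← hzc]
        exact Cardinal.mk_le_mk_of_subset (fun i hi => hi.1)
      · refine (hf0 β h1 (pos_of_gt (f.s_cof β h1f).2) (f.s_lt h1f) b).trans
          (Cardinal.mk_le_mk_of_subset ?_)
        rintro i ⟨hi1, hi2, hi3⟩
        refine ⟨hi1, ?_⟩
        change (if i ∈ w ∧ ξ ≤ η then _ else false) = _
        rw [if_pos ⟨hw (hzw hi1), hξ2'⟩, if_pos (hzw hi1), if_neg (not_lt.2 hξ1)]
        exact hi3
    exact ⟨key false, key true⟩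
  · exact hqdom.le.trans (Order.lt_add_one_iff.2 le_rfl).le
  · ext β
    constructor
    · rintro ⟨h1 | h1, h2⟩
      · exact h1
      · rw [Set.mem_singleton_iff] at h1
        rw [h1] at h2
        exact absurd h2 (not_lt.2 hqdom.le)
    · intro h
      exact ⟨Or.inl h, t.q2.c_sub h⟩

open Classical in
noncomputable def toQ0 (hl : ℵ₀ ≤ C.lam) (y : YT C.lam) : Q0 C.lam where
  g := {t | t.1 ≤ y.γ ∧ t.2 = decide (t.1 ∈ y.A)}
  pfun := by
    rintro a b b' ⟨-, h⟩ ⟨-, h'⟩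
    exact h.trans h'.symm
  dom_sub := fun t ht => ht.1.trans_lt y.γ_lt
  small := by
    refine le_trans ?_ (mk_Iic_le hl y.γ_lt)
    refine Cardinal.mk_le_of_injective (f := fun t => ⟨t.1.1, t.2.1⟩) ?_
    intro t t' h
    have h2 := (Subtype.mk.injEq _ _ _ _).mp h
    apply Subtype.ext
    apply Prod.ext h2
    rw [t.2.2, t'.2.2, h2]

theorem toQ0_le (y y' : YT C.lam) : (toQ0 C.hl y).g ⊆ (toQ0 C.hl y').g ↔ y.le y' := by
  classical
  constructor
  · intro h
    have h1 : ∀ ξ ≤ y.γ, ξ ≤ y'.γ ∧ (ξ ∈ y.A ↔ ξ ∈ y'.A) := by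
      intro ξ hξ
      have : (ξ, decide (ξ ∈ y.A)) ∈ (toQ0 C.hl y).g := ⟨hξ, by simp⟩
      obtain ⟨h2, h3⟩ := h this
      refine ⟨h2, ?_⟩
      simpa using h3
    refine ⟨(h1 _ le_rfl).1, ?_⟩
    ext ξ
    constructor
    · rintro ⟨h2, h3⟩
      exact (h1 ξ h3).2.2 h2
    · intro h2
      have := y.A_sub h2
      exact ⟨(h1 ξ this).2.1 h2, this⟩
  · rintro h ⟨ξ, b⟩ ⟨h1, h2⟩
    have h1 : ξ ≤ y.γ := h1
    have h2 : b = @decide (ξ ∈ y.A) (Classical.propDecidable _) := h2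
    refine ⟨h1.trans h.1, ?_⟩
    have h3 := YT.A_iff h h1
    change b = @decide (ξ ∈ y'.A) (Classical.propDecidable _)
    rw [h2]
    simp only [h3]

noncomputable def toQ1 (x : C.Cd) : Q1 C.lam where
  g := {t | t.1.2 ∈ x.w ∧ t.1.1 ≤ x.η ∧ t.2 = x.r t.1.2 t.1.1}
  pfun := by
    rintro a b b' ⟨-, -, h⟩ ⟨-, -, h'⟩
    exact h.trans h'.symm
  dom_sub := fun t ht => ⟨ht.2.1.trans_lt x.good.ηΛ, (x.good.lt _ ht.1).trans x.f.γ_lt⟩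
  small := by
    have h1 : #(x.w ×ˢ Set.Iic x.η : Set (Ordinal.{0} × Ordinal.{0})) < Cardinal.lift.{1} C.lam := by
      rw [Cardinal.mk_setProd]
      exact Cardinal.mul_lt_of_lt lreg.aleph0_le x.good.sm (mk_Iic_lt x.good.ηΛ)
    refine lt_of_le_of_lt ?_ h1
    refine Cardinal.mk_le_of_injective (f := fun t => ⟨(t.1.1.2, t.1.1.1), t.2.1, t.2.2.1⟩) ?_
    intro t t' h
    have h2 := (Subtype.mk.injEq _ _ _ _).mp h
    rw [Prod.mk.injEq] at h2
    apply Subtype.ext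
    refine Prod.ext (Prod.ext h2.2 h2.1) ?_
    rw [t.2.2.2, t'.2.2.2, h2.1, h2.2]

theorem toQ1_le (x y : C.Cd) : (toQ1 x).g ⊆ (toQ1 y).g ↔
    (x.w ⊆ y.w ∧ x.η ≤ y.η ∧ ∀ i ∈ x.w, ∀ ξ ≤ x.η, y.r i ξ = x.r i ξ) := by
  constructor
  · intro h
    have h1 : ∀ i ∈ x.w, ∀ ξ ≤ x.η, i ∈ y.w ∧ ξ ≤ y.η ∧ y.r i ξ = x.r i ξ := by
      intro i hi ξ hξ
      have : ((ξ, i), x.r i ξ) ∈ (toQ1 x).g := ⟨hi, hξ, rfl⟩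
      obtain ⟨h2, h3, h4⟩ := h this
      exact ⟨h2, h3, h4.symm⟩
    obtain ⟨i0, hi0⟩ := x.good.ne
    exact ⟨fun i hi => (h1 i hi _ le_rfl).1, (h1 i0 hi0 _ le_rfl).2.1,
      fun i hi ξ hξ => (h1 i hi ξ hξ).2.2⟩
  · rintro ⟨h1, h2, h3⟩ ⟨⟨ξ, i⟩, b⟩ ⟨h4, h5, h6⟩
    exact ⟨h1 h4, h5.trans h2, h6.trans (h3 i h4 ξ h5).symm⟩

noncomputable def toQ (G : C.ND ≃ YT C.lam) (x : C.Cd) : Q0 C.lam × Q1 C.lam :=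
  (toQ0 C.hl (G x.f), toQ1 x)

theorem toQ_le (G : C.ND ≃ YT C.lam) (hG : ∀ a b, a.le b ↔ (G a).le (G b)) (x y : C.Cd) :
    QLE (toQ G x) (toQ G y) ↔ C.CLE False x y := by
  have h1 : QLE (toQ G x) (toQ G y) ↔
      ((toQ0 C.hl (G x.f)).g ⊆ (toQ0 C.hl (G y.f)).g ∧ (toQ1 x).g ⊆ (toQ1 y).g) := Iff.rfl
  rw [h1, toQ0_le, toQ1_le, ← hG]
  exact ⟨fun h => ⟨h.1, h.2.1, h.2.2.1, h.2.2.2, fun h => h.elim⟩,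
    fun h => ⟨h.f, h.w, h.η, h.r⟩⟩

theorem toQ_dense (G : C.ND ≃ YT C.lam) (hGγ : ∀ x, (G x).γ = x.γ) :
    IsDenseR QLE (Set.range (toQ G)) := by
  classical
  rintro ⟨q0, q1⟩
  have hsucc : (Order.succ C.lam).IsRegular := Cardinal.isRegular_succ C.hl
  have hs1 : Cardinal.lift.{1} C.lam < Cardinal.lift.{1} (Order.succ C.lam) :=
    Cardinal.lift_lt.2 (Order.lt_succ _)
  obtain ⟨θ, hθ, hθ1⟩ := small_bdd hsucc (Prod.fst '' q0.g)
    ((Cardinal.mk_image_le.trans q0.small).trans_lt hs1) id (by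
      rintro _ ⟨t, ht, rfl⟩; exact q0.dom_sub t ht)
  let w0 : Set Ordinal.{0} := (fun t => t.1.2) '' q1.g
  have hw0 : #w0 < Cardinal.lift.{1} C.lam := Cardinal.mk_image_le.trans_lt q1.small
  obtain ⟨θ', hθ', hθ1'⟩ := small_bdd hsucc w0 (hw0.trans hs1) id (by
      rintro _ ⟨t, ht, rfl⟩; exact (q1.dom_sub t ht).2)
  obtain ⟨ζ, hζ, hζ1⟩ := small_bdd C.hlam ((fun t => t.1.1) '' q1.g)
    (Cardinal.mk_image_le.trans_lt q1.small) id (by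
      rintro _ ⟨t, ht, rfl⟩; exact (q1.dom_sub t ht).1)
  obtain ⟨γ, hγm, hγ, hγl⟩ := exists_mark C.hl (max θ θ') (max_lt hθ hθ')
  let Y : YT C.lam :=
    { γ := γ
      A := {ξ | ξ ≤ γ ∧ ((ξ, true) ∈ q0.g ∨ ξ = γ)}
      mark := hγm
      γ_lt := hγl
      A_sub := fun ξ hξ => hξ.1
      γ_mem := ⟨le_rfl, Or.inr rfl⟩ }
  let f := G.symm Y
  have hGf : G f = Y := G.apply_symm_apply Y
  have hfγ : f.γ = γ := by rw [← hGγ, hGf]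
  obtain ⟨η, w, hη, hw, hgood, hR⟩ := closure f w0
    (fun i hi => by
      rw [hfγ]; exact (hθ1' i hi).trans ((le_max_right _ _).trans_lt hγ)) hw0 ζ hζ
  let x : C.Cd :=
    { f := f, w := w, η := η, good := hgood
      r := fun i ξ => if i ∈ w ∧ ξ ≤ η then
        (if ((ξ, i), false) ∈ q1.g then false else true) else false
      supp := by
        intro i ξ h
        by_contra hc
        rw [if_neg hc] at h
        exact absurd h (by simp)
      flag := by
        intro i hi hiη
        have : ((0, i), false) ∉ q1.g := fun h => absurd hiη (hR i ⟨_, h, rfl⟩).ne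
        rw [if_pos ⟨hi, zero_le⟩, if_neg this] }
  refine ⟨toQ G x, ⟨x, rfl⟩, ?_, ?_⟩
  · change q0.g ⊆ (toQ0 C.hl (G f)).g
    rw [hGf]
    rintro ⟨ξ, b⟩ ht
    have h1 : ξ < θ := hθ1 ξ ⟨_, ht, rfl⟩
    have h2 : ξ < γ := h1.trans ((le_max_left _ _).trans_lt hγ)
    refine ⟨h2.le, ?_⟩
    change b = @decide (ξ ≤ γ ∧ ((ξ, true) ∈ q0.g ∨ ξ = γ)) (Classical.propDecidable _)
    cases b
    · symm
      refine @decide_eq_false _ (Classical.propDecidable _) ?_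
      rintro ⟨-, h | h⟩
      · exact absurd (q0.pfun _ _ _ ht h) (by simp)
      · exact h2.ne h
    · symm
      exact @decide_eq_true _ (Classical.propDecidable _) ⟨h2.le, Or.inl ht⟩
  · rintro ⟨⟨ξ, i⟩, b⟩ ht
    have h1 : ξ < ζ := hζ1 ξ ⟨_, ht, rfl⟩
    have hiw : i ∈ w := hw ⟨_, ht, rfl⟩
    have hξ : ξ ≤ η := h1.le.trans hη
    refine ⟨hiw, hξ, ?_⟩
    change b = if i ∈ w ∧ ξ ≤ η then
        (if ((ξ, i), false) ∈ q1.g then false else true) else false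
    rw [if_pos ⟨hiw, hξ⟩]
    cases b
    · rw [if_pos ht]
    · rw [if_neg (fun h => absurd (q1.pfun _ _ _ ht h) (by simp))]

theorem final (C : Ctx) :
    ∃ (D : Set (Trip C.δc C.lam C.xseq)) (E : Set (Q0 C.lam × Q1 C.lam)),
      IsDenseR TripLE D ∧ IsDenseR QLE E ∧
      Nonempty ((fun a b : ↥D => TripLE a.1 b.1) ≃r
                (fun a b : ↥E => QLE a.1 b.1)) := by
  obtain ⟨G, hGγ, hG⟩ := node_iso C.δc C.lam C.hl
  refine ⟨Set.range (toTrip (C := C)), Set.range (toQ G), toTrip_dense, toQ_dense G hGγ, ?_⟩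
  have inj : ∀ x y : C.Cd, C.CLE True x y → C.CLE True y x → x = y :=
    fun x y h h' => h.antisymm True h'
  have hT : Function.Injective (toTrip (C := C)) := by
    intro x y h
    apply inj
    · rw [← toTrip_le, h, toTrip_le]; exact CLE.refl _ _
    · rw [← toTrip_le, h, toTrip_le]; exact CLE.refl _ _
  have hU : Function.Injective (toQ G) := by
    intro x y h
    apply CLE.antisymm False
    · rw [← toQ_le G hG, h, toQ_le G hG]; exact CLE.refl _ _
    · rw [← toQ_le G hG, h, toQ_le G hG]; exact CLE.refl _ _
  have hP : Function.Injective (Phi (C := C)) := by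
    intro x y h
    apply inj
    · rw [Phi_le_iff, h]; exact CLE.refl _ _
    · rw [Phi_le_iff, h]; exact CLE.refl _ _
  apply range_iso TripLE QLE _ _ hT hU (Equiv.ofBijective Phi ⟨hP, Phi_surj⟩)
  intro x y
  rw [toTrip_le, Phi_le_iff, ← toQ_le G hG]
  rfl

end Ctx
/-- (Lemma 4.)  Assume GCH and let `δ < λ` be regular, `λ ≥ ℵ₁`.  The
three-step forcing `P⁰_{δ,λ} * (P¹_{δ,λ}[Ṡ] × P²_{δ,λ}[Ṡ])` is forcing
equivalent to `Q⁰_λ * Q̇¹_λ`, the addition of a Cohen subset of `λ⁺` followed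
by the addition of `λ⁺` many Cohen subsets of `λ`: the two posets have
isomorphic dense subsets.  Here `xseq` is the name for the `♣(Ṡ)`-sequence
from which `P¹` is defined; it is stable under extension of the `P⁰`-part and
yields cofinal subsets. -/
theorem three_step_iteration_equiv_cohen (δc lam : Cardinal.{0})
    (gch : GCHolds)
    (hδ : δc.IsRegular) (hlam : lam.IsRegular) (hlam1 : ℵ₀ < lam)
    (hdlt : δc < lam)
    (xseq : Set Ordinal.{0} → Ordinal.{0} → Set Ordinal.{0})
    (hx : ∀ (S : Set Ordinal.{0}), ∀ β ∈ S,
      xseq S β ⊆ Set.Iio β ∧ ∀ γ < β, ∃ ξ ∈ xseq S β, γ ≤ ξ)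
    (hstab : ∀ p q : P0 δc lam, P0.le p q → ∀ β ∈ p.s, xseq q.s β = xseq p.s β) :
    ∃ (D : Set (Trip δc lam xseq)) (E : Set (Q0 lam × Q1 lam)),
      IsDenseR TripLE D ∧ IsDenseR QLE E ∧
      Nonempty ((fun a b : ↥D => TripLE a.1 b.1) ≃r
                (fun a b : ↥E => QLE a.1 b.1)) := by
  exact Ctx.final ⟨δc, lam, xseq, hδ, hlam, hlam1, hdlt, hx, hstab⟩
end
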